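/- Theorem A (lattice equivariance of the return map): For every e ∈ ℰ there exists λ₀ > 0 such that for all 0 < λ < λ₀ the following holds: for every l ∈ 𝕃^e and every z ∈ (λℤ)² with z ∈ X̃^e and z + l ∈ X̃^e, one has Φ(z + l) − Φ(z) − l ∈ ℤ·𝐰_{v₁,v₁}, i.e. the first-return map Φ commutes with translation by l modulo integer multiples of the vector 𝐰_{v₁,v₁}, where v₁ is the first entry of the vertex list V(e). -/

import Mathlib

open scoped Classical

noncomputable section

open Set

/-- The scaled round-off map `F_λ` on the plane: `F_λ(z) = λ·F(z/λ)`,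
so `F_λ(z) = (λ⌊z₁⌋ − z₂, z₁)`. -/
def Fl (lam : ℝ) (z : ℝ × ℝ) : ℝ × ℝ := (lam * (⌊z.1⌋ : ℝ) - z.2, z.1)

/-- The inverse of `F_λ`. -/
def Flinv (lam : ℝ) (z : ℝ × ℝ) : ℝ × ℝ := (z.2, lam * (⌊z.2⌋ : ℝ) - z.1)

/-- Integer iterate `F_λ^k`, `k ∈ ℤ`. -/
def FlIter (lam : ℝ) (k : ℤ) (z : ℝ × ℝ) : ℝ × ℝ :=
  if 0 ≤ k then (Fl lam)^[k.toNat] z else (Flinv lam)^[(-k).toNat] z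

/-- Membership in the scaled lattice `(λℤ)²`. -/
def IsLatticePt (lam : ℝ) (z : ℝ × ℝ) : Prop := ∃ a b : ℤ, z = (lam * a, lam * b)

/-- The discrete vector field `𝐯(z) = F_λ⁴(z) − z`. -/
def vfield (lam : ℝ) (z : ℝ × ℝ) : ℝ × ℝ := (Fl lam)^[4] z - z

/-- The auxiliary (integrable) vector field `𝐰`. -/
def wfield (lam : ℝ) (z : ℝ × ℝ) : ℝ × ℝ :=
  (lam * (2 * (⌊z.2⌋ : ℝ) + 1), -(lam * (2 * (⌊z.1⌋ : ℝ) + 1)))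

/-- The constant value `𝐰_{m,n}` of `𝐰` on the box `B_{m,n}`. -/
def wmn (lam : ℝ) (m n : ℤ) : ℝ × ℝ :=
  (lam * (2 * (n : ℝ) + 1), -(lam * (2 * (m : ℝ) + 1)))

/-- The piecewise-affine function `P(x) = ⌊x⌋² + (2⌊x⌋+1)(x − ⌊x⌋)`. -/
def Pfun (x : ℝ) : ℝ := (⌊x⌋ : ℝ) ^ 2 + (2 * (⌊x⌋ : ℝ) + 1) * (x - (⌊x⌋ : ℝ))

/-- The Hamiltonian `𝒫(x,y) = P(x) + P(y)`. -/
def Ham (z : ℝ × ℝ) : ℝ := Pfun z.1 + Pfun z.2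

/-- The round Hamiltonian `𝒬(x,y) = x² + y²`. -/
def Qfun (z : ℝ × ℝ) : ℝ := z.1 ^ 2 + z.2 ^ 2

/-- The level set `Π(z)` of `𝒫` through `z`. -/
def levelSet (z : ℝ × ℝ) : Set (ℝ × ℝ) := {w | Ham w = Ham z}

/-- The grid `Δ` of horizontal and vertical integer lines. -/
def DeltaSet : Set (ℝ × ℝ) := {z | (∃ m : ℤ, z.1 = (m : ℝ)) ∨ (∃ n : ℤ, z.2 = (n : ℝ))}

/-- The box `B_{m,n}`. -/
def Bbox (m n : ℤ) : Set (ℝ × ℝ) := {z | ⌊z.1⌋ = m ∧ ⌊z.2⌋ = n}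

/-- The lattice `ℤ² ⊂ ℝ²`. -/
def intLattice : Set (ℝ × ℝ) := {z | ∃ a b : ℤ, z = ((a : ℝ), (b : ℝ))}

/-- `r(c)`: the number of representations of `c` as a sum of two integer squares. -/
def rfun (c : ℝ) : ℕ := Set.ncard {p : ℤ × ℤ | ((p.1 : ℝ)) ^ 2 + ((p.2 : ℝ)) ^ 2 = c}

/-- Euclidean distance from `z` to the symmetry line `y = x`. -/
def dG (z : ℝ × ℝ) : ℝ := |z.1 - z.2| / Real.sqrt 2

/-- The integer round-off `R`. -/
def Rfl (z : ℝ × ℝ) : ℤ × ℤ := (⌊z.1⌋, ⌊z.2⌋)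

/-- The rescaled round-off `R_λ(w) = λ·R(w/λ)`. -/
def Rlam (lam : ℝ) (w : ℝ × ℝ) : ℝ × ℝ :=
  (lam * (⌊w.1 / lam⌋ : ℝ), lam * (⌊w.2 / lam⌋ : ℝ))

/-- The return domain `X`. -/
def Xdom (lam : ℝ) : Set (ℝ × ℝ) :=
  {z | IsLatticePt lam z ∧ 0 ≤ z.1 ∧ 0 ≤ z.2 ∧
    dG z ≤ dG ((Fl lam)^[4] z) ∧ dG z < dG ((Flinv lam)^[4] z)}

/-- Forward transit time `τ` to `X`. -/
def tau (lam : ℝ) (z : ℝ × ℝ) : ℕ := sInf {k : ℕ | 1 ≤ k ∧ (Fl lam)^[k] z ∈ Xdom lam}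

/-- Backward transit time `τ₋` to `X`. -/
def tauMinus (lam : ℝ) (z : ℝ × ℝ) : ℕ := sInf {k : ℕ | (Flinv lam)^[k] z ∈ Xdom lam}

/-- The return orbit `O_τ(z)`. -/
def returnOrbit (lam : ℝ) (z : ℝ × ℝ) : Set (ℝ × ℝ) :=
  {w | ∃ k : ℤ, -(tauMinus lam z : ℤ) ≤ k ∧ k ≤ (tau lam z : ℤ) ∧ w = FlIter lam k z}

/-- The first-return map `Φ`. -/
def Phi (lam : ℝ) (z : ℝ × ℝ) : ℝ × ℝ := (Fl lam)^[tau lam z] z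

/-- The full orbit `O(z) = {F_λ^t(z) : t ∈ ℤ}`. -/
def fullOrbit (lam : ℝ) (z : ℝ × ℝ) : Set (ℝ × ℝ) := {w | ∃ t : ℤ, w = FlIter lam t z}

/-- The set `Λ` of transition points. -/
def TransSet (lam : ℝ) : Set (ℝ × ℝ) :=
  {z | IsLatticePt lam z ∧ Rfl ((Fl lam)^[4] z) ≠ Rfl z}

/-- The set `Σ = ⋃ Σ_{m,n}`. -/
def SigmaSet (lam : ℝ) : Set (ℝ × ℝ) :=
  {z | z ∈ TransSet lam ∧ ∃ m n : ℤ,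
    max |z.1 - (m : ℝ)| |z.2 - (n : ℝ)| ≤
      lam * (max |2 * (m : ℝ) + 1| |2 * (n : ℝ) + 1| + 2)}

/-- `ℰ`: the natural numbers which are sums of two integer squares. -/
def Eset : Set ℕ := {n | ∃ a b : ℤ, (n : ℤ) = a ^ 2 + b ^ 2}

/-- The successor of `e` in `ℰ`. -/
def nextE (e : ℕ) : ℕ := sInf {f | f ∈ Eset ∧ e < f}

/-- The critical interval `I^e = (e, e′)`. -/
def Icrit (e : ℕ) : Set ℝ := Set.Ioo (e : ℝ) (nextE e : ℝ)

/-- The set `X^e`. -/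
def Xe (lam : ℝ) (e : ℕ) : Set (ℝ × ℝ) :=
  {z | z ∈ Xdom lam ∧ ∀ w ∈ returnOrbit lam z, Ham w ∈ Icrit e}

/-- A point of `X^e` is regular if it is not a transition point and its return
orbit avoids `Σ`. -/
def IsRegularPt (lam : ℝ) (e : ℕ) (z : ℝ × ℝ) : Prop :=
  z ∈ Xe lam e ∧ z ∉ TransSet lam ∧ returnOrbit lam z ∩ SigmaSet lam = ∅

/-- `J` is a maximal subinterval `Ĩ^e(λ)` of `I^e` on which all points of `X^e`
are regular. -/
def IsMaxRegInterval (lam : ℝ) (e : ℕ) (J : Set ℝ) : Prop :=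
  J ⊆ Icrit e ∧ J.OrdConnected ∧
    (∀ z ∈ Xe lam e, Ham z ∈ J → IsRegularPt lam e z) ∧
    ∀ J' : Set ℝ, J ⊆ J' → J' ⊆ Icrit e → J'.OrdConnected →
      (∀ z ∈ Xe lam e, Ham z ∈ J' → IsRegularPt lam e z) → J' = J

/-- The regular domain `X̃^e` determined by the interval `J = Ĩ^e(λ)`. -/
def Xtilde (lam : ℝ) (e : ℕ) (J : Set ℝ) : Set (ℝ × ℝ) :=
  {z | z ∈ Xe lam e ∧ Ham z ∈ J}

/-- The type of a vertex: the floor of the absolute value of its non-integer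
coordinate. -/
def vtype (z : ℝ × ℝ) : ℕ :=
  if ∃ m : ℤ, z.1 = (m : ℝ) then (⌊|z.2|⌋).toNat else (⌊|z.1|⌋).toNat

/-- `v` (1-indexed, entries `v 1, …, v k` with `k = ⌊√e⌋+1`) is the vertex list
of the polygon class of `e`, and `o j` records whether the `j`-th vertex lies on
a horizontal lattice line (i.e. has integer `y`-coordinate): for every value
`a ∈ I^e`, the vertices of the level polygon `{𝒫 = a}` lying in the first octant,
enumerated clockwise (i.e. by increasing `x`-coordinate), have types
`v 1, …, v k`. -/
def IsVertexList (e : ℕ) (v : ℕ → ℕ) (o : ℕ → Bool) : Prop :=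
  ∀ a ∈ Icrit e, ∃ p : ℕ → ℝ × ℝ,
    (∀ j, 1 ≤ j → j ≤ Nat.sqrt e + 1 →
      Ham (p j) = a ∧ p j ∈ DeltaSet ∧ 0 ≤ (p j).2 ∧ (p j).2 ≤ (p j).1 ∧
        vtype (p j) = v j ∧ (o j = true ↔ ∃ n : ℤ, (p j).2 = (n : ℝ))) ∧
    (∀ i j, 1 ≤ i → i < j → j ≤ Nat.sqrt e + 1 → (p i).1 < (p j).1) ∧
    (∀ w : ℝ × ℝ, Ham w = a → w ∈ DeltaSet → 0 ≤ w.2 → w.2 ≤ w.1 →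
      ∃ j, 1 ≤ j ∧ j ≤ Nat.sqrt e + 1 ∧ w = p j)

/-- The extended vertex list: `v_j = v_{2k−j}` for `k < j ≤ 2k−1`. -/
def vext (e : ℕ) (v : ℕ → ℕ) (j : ℕ) : ℕ :=
  if j ≤ Nat.sqrt e + 1 then v j else v (2 * (Nat.sqrt e + 1) - j)

/-- The extended orientation list. -/
def oext (e : ℕ) (o : ℕ → Bool) (j : ℕ) : Bool :=
  if j ≤ Nat.sqrt e + 1 then o j else o (2 * (Nat.sqrt e + 1) - j)

/-- The recursively defined integers `q_j` (here `v` is the extended vertex list):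
`q₁ = (2v₁+1)²`, `q_j = q_{j−1}` if `v_j = v_{j−1}`, and
`q_j = lcm((2v_j+1)(2v_{j−1}+1), q_{j−1})` otherwise. -/
def qseq (v : ℕ → ℕ) : ℕ → ℕ
  | 0 => (2 * v 1 + 1) ^ 2
  | 1 => (2 * v 1 + 1) ^ 2
  | j + 2 =>
    if v (j + 2) = v (j + 1) then qseq v (j + 1)
    else Nat.lcm ((2 * v (j + 2) + 1) * (2 * v (j + 1) + 1)) (qseq v (j + 1))

/-- `p_j = q_j/(2v_j+1)`. -/
def pseq (v : ℕ → ℕ) (j : ℕ) : ℕ := qseq v j / (2 * v j + 1)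

/-- `q = q_{2k−1}`. -/
def qval (e : ℕ) (v : ℕ → ℕ) : ℕ := qseq (vext e v) (2 * (Nat.sqrt e + 1) - 1)

/-- The vector `L_j = (λ q_j/(2v₁+1))·(1,1)`. -/
def Lvec (lam : ℝ) (v1 : ℕ) (qj : ℕ) : ℝ × ℝ :=
  (lam * (qj : ℝ) / (2 * (v1 : ℝ) + 1), lam * (qj : ℝ) / (2 * (v1 : ℝ) + 1))

/-- The lattice `𝕃 = ℤ·L_j + ℤ·((L_j − 𝐰_{v₁,v₁})/2)` as an additive subgroup
of `ℝ²`. -/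
def latticeL (lam : ℝ) (v1 : ℕ) (qj : ℕ) : AddSubgroup (ℝ × ℝ) :=
  AddSubgroup.closure
    {Lvec lam v1 qj, (2⁻¹ : ℝ) • (Lvec lam v1 qj - wmn lam (v1 : ℤ) (v1 : ℤ))}

/-- Forward transit time of `F_λ⁴` to `Λ`. -/
def tTrans (lam : ℝ) (z : ℝ × ℝ) : ℕ :=
  sInf {i : ℕ | 1 ≤ i ∧ (Fl lam)^[4 * i] z ∈ TransSet lam}

/-- The strip map `Ψ(z) = F_λ^{4t(z)}(z)`. -/
def Psi (lam : ℝ) (z : ℝ × ℝ) : ℝ × ℝ := (Fl lam)^[4 * tTrans lam z] z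

/-- Backward transit time of `F_λ⁻⁴` to `Λ`. -/
def sTrans (lam : ℝ) (z : ℝ × ℝ) : ℕ :=
  sInf {i : ℕ | 1 ≤ i ∧ (Flinv lam)^[4 * i] z ∈ TransSet lam}

/-- The inverse strip map `Ψ⁻¹`. -/
def PsiInv (lam : ℝ) (z : ℝ × ℝ) : ℝ × ℝ := (Flinv lam)^[4 * sTrans lam z] z

/-- `Ψ^j` for `j ∈ {−1} ∪ ℕ`. -/
def PsiPow (lam : ℝ) (j : ℤ) (z : ℝ × ℝ) : ℝ × ℝ :=
  if j < 0 then PsiInv lam z else (Psi lam)^[j.toNat] z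

/-- The coordinate unit vector in the non-integer direction of a vertex lying
on a horizontal (`horiz = true`) resp. vertical lattice line. -/
def evec (horiz : Bool) : ℝ × ℝ := if horiz then (1, 0) else (0, 1)

/-- `s ∈ {0, …, 2v_j}` is the code entry at a vertex point `w` of type `vj`: if
the vertex lies on a horizontal line `y = n` then, writing
`w = λ(⌈v_j/λ⌉ + x_j, ⌈n/λ⌉ + y_j)` with `|y_j| < 2v_j+1`, `s ≡ y_j (mod 2v_j+1)`;
analogously in the vertical case. -/
def CodeAt (lam : ℝ) (vj : ℕ) (horiz : Bool) (w : ℝ × ℝ) (s : ℤ) : Prop :=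
  0 ≤ s ∧ s < 2 * (vj : ℤ) + 1 ∧
    (if horiz then
        ∃ n Y yj : ℤ, w.2 = lam * (Y : ℝ) ∧ Y = ⌈(n : ℝ) / lam⌉ + yj ∧
          |yj| < 2 * (vj : ℤ) + 1 ∧ s ≡ yj [ZMOD (2 * (vj : ℤ) + 1)]
      else
        ∃ m X xj : ℤ, w.1 = lam * (X : ℝ) ∧ X = ⌈(m : ℝ) / lam⌉ + xj ∧
          |xj| < 2 * (vj : ℤ) + 1 ∧ s ≡ xj [ZMOD (2 * (vj : ℤ) + 1)])

/-- `σ` is the orbit code `(σ₋₁, σ₁, …, σ_{2k−1})` of `z`. -/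
def IsOrbitCode (lam : ℝ) (e : ℕ) (v : ℕ → ℕ) (o : ℕ → Bool) (z : ℝ × ℝ)
    (σ : ℤ → ℤ) : Prop :=
  CodeAt lam (v 1) (!(o 1)) (PsiInv lam z) (σ (-1)) ∧
    ∀ j : ℕ, 1 ≤ j → j ≤ 2 * (Nat.sqrt e + 1) - 1 →
      CodeAt lam (vext e v j) (oext e o j) ((Psi lam)^[j] z) (σ (j : ℤ))

/-- The Euclidean norm on `ℝ²`. -/
def enorm2 (z : ℝ × ℝ) : ℝ := Real.sqrt (z.1 ^ 2 + z.2 ^ 2)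

/-- The rotation number `ν(λ) = arccos(λ/2)/(2π)`. -/
def nuRot (lam : ℝ) : ℝ := Real.arccos (lam / 2) / (2 * Real.pi)

/-- Distance from a real number to the nearest integer. -/
def distInt (x : ℝ) : ℝ := |x - (round x : ℝ)|

/-- The first-order recurrence time `t*(λ)`. -/
def tstar (lam : ℝ) : ℕ :=
  sInf {k : ℕ | 1 ≤ k ∧ distInt ((k : ℝ) * nuRot lam) < distInt (4 * nuRot lam)}

/-- The square `A(r,λ)` of lattice points. -/
def Aset (r lam : ℝ) : Set (ℝ × ℝ) := {z | IsLatticePt lam z ∧ max |z.1| |z.2| < r}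

end

/-- Integer data of the floor function `X ↦ ⌊λ X⌋` and the ceilings `C k = ⌈k/λ⌉`. -/
structure FC (f C : ℤ → ℤ) (G : ℤ) : Prop where
  iff : ∀ k X, k ≤ f X ↔ C k ≤ X
  gap : ∀ k, C k + G ≤ C (k + 1)
  neg1 : ∀ k, - C k ≤ C (-k)
  neg2 : ∀ k, C (-k) ≤ - C k + 1
  zero : C 0 = 0

/-- The integer map. -/
def FI (f : ℤ → ℤ) (p : ℤ × ℤ) : ℤ × ℤ := (f p.1 - p.2, p.1)

/-- The fourth iterate. -/
def F4 (f : ℤ → ℤ) (p : ℤ × ℤ) : ℤ × ℤ := FI f (FI f (FI f (FI f p)))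

theorem FC.low {f C : ℤ → ℤ} {G : ℤ} (h : FC f C G) (X : ℤ) : C (f X) ≤ X :=
  (h.iff _ _).1 le_rfl

theorem FC.high {f C : ℤ → ℤ} {G : ℤ} (h : FC f C G) (X : ℤ) : X < C (f X + 1) := by
  by_contra hh
  have := (h.iff (f X + 1) X).2 (by omega)
  omega

theorem FC.eq {f C : ℤ → ℤ} {G : ℤ} (h : FC f C G) {k X : ℤ} (h1 : C k ≤ X) (h2 : X < C (k+1)) :
    f X = k := by
  have h3 := (h.iff k X).2 h1
  have h4 : ¬ (k + 1 ≤ f X) := fun h5 => by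
    have := (h.iff _ _).1 h5
    omega
  omega

theorem FC.lt {f C : ℤ → ℤ} {G : ℤ} (h : FC f C G) {k X : ℤ} : f X < k ↔ X < C k := by
  have := h.iff k X
  omega

theorem FC.mono {f C : ℤ → ℤ} {G : ℤ} (h : FC f C G) {X Y : ℤ} (hXY : X ≤ Y) : f X ≤ f Y := by
  have := h.low X
  exact (h.iff _ _).2 (by omega)

theorem F4_eq (f : ℤ → ℤ) (X Y : ℤ) {a1 a2 a3 a4 : ℤ} (h1 : f X = a1) (h2 : f (a1 - Y) = a2)
    (h3 : f (a2 - X) = a3) (h4 : f (Y + a3 - a1) = a4) :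
    F4 f (X, Y) = (X + a4 - a2, Y + a3 - a1) := by
  simp only [F4, FI]
  rw [h1, h2, h3]
  have : a3 - (a1 - Y) = Y + a3 - a1 := by ring
  rw [this, h4]
  ext <;> simp
  ring

/-- near a corner -/
def NC (C : ℤ → ℤ) (m n : ℤ) (p : ℤ × ℤ) : Prop :=
  ∃ r : ℤ, r ≤ max |2 * m + 1| |2 * n + 1| + 2 ∧
    C m - r ≤ p.1 ∧ p.1 ≤ C m + r - 1 ∧ C n - r ≤ p.2 ∧ p.2 ≤ C n + r - 1

theorem NC.mk' {C : ℤ → ℤ} {m n X Y r : ℤ}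
    (hr : r ≤ 2 * m + 3 ∨ r ≤ 1 - 2 * m ∨ r ≤ 2 * n + 3 ∨ r ≤ 1 - 2 * n)
    (h1 : C m - r ≤ X) (h2 : X ≤ C m + r - 1) (h3 : C n - r ≤ Y) (h4 : Y ≤ C n + r - 1) :
    NC C m n (X, Y) := by
  refine ⟨r, ?_, h1, h2, h3, h4⟩
  have e1 := le_max_left |2 * m + 1| |2 * n + 1|
  have e2 := le_max_right |2 * m + 1| |2 * n + 1|
  have e3 := le_abs_self (2 * m + 1)
  have e4 := neg_le_abs (2 * m + 1)
  have e5 := le_abs_self (2 * n + 1)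
  have e6 := neg_le_abs (2 * n + 1)
  omega

/-- box of a point -/
def RI (f : ℤ → ℤ) (p : ℤ × ℤ) : ℤ × ℤ := (f p.1, f p.2)

/-- not a transition near a corner -/
def NS (f C : ℤ → ℤ) (p : ℤ × ℤ) : Prop :=
  RI f (F4 f p) ≠ RI f p → ∀ m n, ¬ NC C m n p

/-- clean step, upper half plane -/
theorem step_up {f C : ℤ → ℤ} {G K X Y m n : ℤ} (h : FC f C G) (hG : 10 * K + 20 ≤ G)
    (hm : f X = m) (hn : f Y = n) (m0 : 0 ≤ m) (n0 : 0 ≤ n) (mK : m ≤ K) (nK : n ≤ K)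
    (ho : 0 < X ∨ 0 < Y)
    (hS : NS f C (X, Y)) :
    F4 f (X, Y) = (X + (2 * n + 1), Y - (2 * m + 1)) ∧ RI f (F4 f (X, Y)) = (m, n)
    ∨ F4 f (X, Y) = (X + (n - 1) - f (m - Y), Y - (2 * m + 1)) ∧
        RI f (F4 f (X, Y)) = (m, n - 1) ∧ C n ≤ Y ∧ Y < C n + (2 * m + 1)
    ∨ F4 f (X, Y) = (X + (2 * n + 1), Y + f (-n - 1 - X) - m) ∧
        RI f (F4 f (X, Y)) = (m + 1, n) ∧ C (m+1) - (2 * n + 1) ≤ X ∧ X < C (m+1) := by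
  have X1 := h.low X
  have X2 := h.high X
  have Y1 := h.low Y
  have Y2 := h.high Y
  rw [hm] at X1 X2
  rw [hn] at Y1 Y2
  obtain ⟨a2, h2⟩ : ∃ a2, f (m - Y) = a2 := ⟨_, rfl⟩
  obtain ⟨a3, h3⟩ : ∃ a3, f (a2 - X) = a3 := ⟨_, rfl⟩
  obtain ⟨a4, h4⟩ : ∃ a4, f (Y + a3 - m) = a4 := ⟨_, rfl⟩
  have hF := F4_eq f X Y hm h2 h3 h4
  have gm := h.gap m
  have gm1 := h.gap (m+1)
  have gn := h.gap n
  have gn0 := h.gap (n-1)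
  have gn1 := h.gap (n-2)
  rw [show n - 1 + 1 = n by ring] at gn0
  rw [show n - 2 + 1 = n - 1 by ring] at gn1
  have pm := h.neg1 m
  have pm' := h.neg2 m
  have pm1 := h.neg1 (m+1)
  have pm1' := h.neg2 (m+1)
  have pm2 := h.gap (-(m+1)-1)
  rw [show -(m+1)-1+1 = -(m+1) by ring] at pm2
  have pn := h.neg1 n
  have pn' := h.neg2 n
  have pn1 := h.neg1 (n+1)
  have pn1' := h.neg2 (n+1)
  have pn2 := h.gap (-n)
  have pm0 := h.gap (-m)
  -- a2
  have c2 : (a2 = -(n+1) ∧ m - Y < C (-n)) ∨ (a2 = -n ∧ C (-n) ≤ m - Y) := by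
    rcases lt_or_ge (m - Y) (C (-n)) with hlt | hge
    · left
      refine ⟨?_, hlt⟩
      rw [← h2]
      apply h.eq
      · omega
      · rw [show -(n+1)+1 = -n by ring]; exact hlt
    · right
      refine ⟨?_, hge⟩
      rw [← h2]
      apply h.eq hge
      omega
  have c3 : (a3 = -(m+1) ∧ C (-(m+1)) ≤ a2 - X ∧ a2 - X < C (-m)) ∨
      (a3 = -(m+1)-1 ∧ a2 - X < C (-(m+1))) ∨ (a3 = -m ∧ C (-m) ≤ a2 - X) := by
    rcases lt_or_ge (a2 - X) (C (-(m+1))) with hlt | hge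
    · right; left
      refine ⟨?_, hlt⟩
      rw [← h3]
      apply h.eq
      · omega
      · rw [show -(m+1)-1+1 = -(m+1) by ring]; exact hlt
    · rcases lt_or_ge (a2 - X) (C (-m)) with hlt | hge'
      · left
        refine ⟨?_, hge, hlt⟩
        rw [← h3]
        apply h.eq hge
        rw [show -(m+1)+1 = -m by ring]; exact hlt
      · right; right
        refine ⟨?_, hge'⟩
        rw [← h3]
        apply h.eq hge'
        omega
  have c4 : (a4 = n ∧ C n ≤ Y + a3 - m) ∨ (a4 = n - 1 ∧ Y + a3 - m < C n) := by
    rcases lt_or_ge (Y + a3 - m) (C n) with hlt | hge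
    · right
      refine ⟨?_, hlt⟩
      rw [← h4]
      apply h.eq
      · omega
      · rw [show n - 1 + 1 = n by ring]; exact hlt
    · left
      refine ⟨?_, hge⟩
      rw [← h4]
      apply h.eq hge
      omega
  have c5 : (f (X + a4 - a2) = m ∧ C m ≤ X + a4 - a2 ∧ X + a4 - a2 < C (m+1)) ∨
      (f (X + a4 - a2) = m + 1 ∧ C (m+1) ≤ X + a4 - a2) ∨
      (f (X + a4 - a2) ≠ m ∧ X + a4 - a2 < C m) := by
    rcases lt_or_ge (X + a4 - a2) (C (m+1)) with hlt | hge
    · rcases lt_or_ge (X + a4 - a2) (C m) with hlt' | hge'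
      · right; right
        refine ⟨?_, hlt'⟩
        intro hh
        have := h.low (X + a4 - a2)
        rw [hh] at this
        omega
      · left
        exact ⟨h.eq hge' hlt, hge', hlt⟩
    · right; left
      refine ⟨?_, hge⟩
      apply h.eq hge
      omega
  have hS1 := fun (hne : RI f (F4 f (X,Y)) ≠ RI f (X,Y)) => hS hne (m+1) n
  have hS0 := fun (hne : RI f (F4 f (X,Y)) ≠ RI f (X,Y)) => hS hne m 0
  rw [h2]
  rw [hF] at hS1 hS0 ⊢
  simp only [RI, h4, hm, hn, Prod.mk.injEq, ne_eq] at hS1 hS0 ⊢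
  have h0 := h.zero
  rcases c4 with ⟨c4, c4'⟩ | ⟨c4, c4'⟩
  · -- n same
    have ha3 : a2 = -(n+1) → a3 ≠ -m := by omega
    have ha2 : a2 = -(n+1) := by
      rcases c2 with c2 | c2
      · exact c2.1
      · exfalso
        by_cases hn0 : n = 0
        · subst hn0
          simp only [neg_zero] at *
          by_cases hm0 : m = 0
          · subst hm0
            simp only [neg_zero] at *
            omega
          · omega
        · have h00 := h.gap (-n)
          omega
    have hne := ha3 ha2
    rcases c5 with c5 | c5 | c5
    · left
      refine ⟨⟨by omega, by omega⟩, by omega, by omega⟩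
    · right; right
      have : f (-n - 1 - X) = a3 := by rw [← h3, ha2]; congr 1; ring
      rw [this]
      refine ⟨⟨by omega, by omega⟩, ⟨by omega, by omega⟩, by omega, by omega⟩
    · omega
  · right; left
    replace hS1 := hS1 (by omega)
    replace hS0 := hS0 (by omega)
    by_cases hy : Y < C n + (2 * m + 1)
    · by_cases h3' : a3 = -(m+1)
      · rcases c5 with c5 | c5 | c5
        · refine ⟨⟨by omega, by omega⟩, ⟨by omega, by omega⟩, by omega, by omega⟩
        · exfalso
          apply hS1
          rcases le_total m n with hmn | hmn
          · apply NC.mk' (r := 2 * n + 3) <;> omega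
          · apply NC.mk' (r := 2 * m + 3) <;> omega
        · have hn0 : n = 0 := by omega
          subst hn0
          simp only [neg_zero] at *
          exfalso
          apply hS0
          apply NC.mk' (r := 2 * m + 3) <;> omega
      · exfalso
        rcases c3 with c3 | c3 | c3
        · omega
        · apply hS1
          rcases le_total m n with hmn | hmn
          · apply NC.mk' (r := 2 * n + 3) <;> omega
          · apply NC.mk' (r := 2 * m + 3) <;> omega
        · have hn0 : n = 0 := by omega
          subst hn0
          simp only [neg_zero] at *
          apply hS0
          apply NC.mk' (r := 2 * m + 3) <;> omega
    · exfalso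
      apply hS1
      rcases le_total m n with hmn | hmn
      · apply NC.mk' (r := 2 * n + 3) <;> omega
      · apply NC.mk' (r := 2 * m + 3) <;> omega


/-- clean step, lower half plane -/
theorem step_dn {f C : ℤ → ℤ} {G K X Y m n : ℤ} (h : FC f C G) (hG : 10 * K + 20 ≤ G)
    (hm : f X = m) (hn : f Y = n) (m0 : 0 ≤ m) (n0 : n < 0) (mK : m ≤ K) (nK : -n ≤ K)
    (hS : NS f C (X, Y)) :
    F4 f (X, Y) = (X + (2 * n + 1), Y - (2 * m + 1)) ∧ RI f (F4 f (X, Y)) = (m, n)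
    ∨ F4 f (X, Y) = (X + (n - 1) - f (m - Y), Y - (2 * m + 1)) ∧
        RI f (F4 f (X, Y)) = (m, n - 1) ∧ C n ≤ Y ∧ Y < C n + (2 * m + 1)
    ∨ F4 f (X, Y) = (X + (2 * n + 1), Y + f (-n - 1 - X) - m) ∧
        RI f (F4 f (X, Y)) = (m - 1, n) ∧ C m ≤ X ∧ X < C m - (2 * n + 1) ∧ 1 ≤ m
    ∨ (m = 0 ∧ (F4 f (X, Y)).1 < 0) := by
  have X1 := h.low X
  have X2 := h.high X
  have Y1 := h.low Y
  have Y2 := h.high Y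
  rw [hm] at X1 X2
  rw [hn] at Y1 Y2
  obtain ⟨a2, h2⟩ : ∃ a2, f (m - Y) = a2 := ⟨_, rfl⟩
  obtain ⟨a3, h3⟩ : ∃ a3, f (a2 - X) = a3 := ⟨_, rfl⟩
  obtain ⟨a4, h4⟩ : ∃ a4, f (Y + a3 - m) = a4 := ⟨_, rfl⟩
  have hF := F4_eq f X Y hm h2 h3 h4
  have gm := h.gap m
  have gm1 := h.gap (m-1)
  rw [show m - 1 + 1 = m by ring] at gm1
  have gn := h.gap n
  have gn0 := h.gap (n-1)
  rw [show n - 1 + 1 = n by ring] at gn0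
  have pm := h.neg1 m
  have pm' := h.neg2 m
  have pm1 := h.neg1 (m+1)
  have pm1' := h.neg2 (m+1)
  have pn := h.neg1 n
  have pn' := h.neg2 n
  have pn1 := h.neg1 (n+1)
  have pn1' := h.neg2 (n+1)
  have pn2 := h.gap (-n)
  have pm0 := h.gap (-m)
  have c2 : (a2 = -(n+1) ∧ m - Y < C (-n)) ∨ (a2 = -n ∧ C (-n) ≤ m - Y) := by
    rcases lt_or_ge (m - Y) (C (-n)) with hlt | hge
    · left
      refine ⟨?_, hlt⟩
      rw [← h2]
      apply h.eq
      · omega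
      · rw [show -(n+1)+1 = -n by ring]; exact hlt
    · right
      refine ⟨?_, hge⟩
      rw [← h2]
      apply h.eq hge
      omega
  have c3 : (a3 = -(m+1) ∧ a2 - X < C (-m)) ∨ (a3 = -m ∧ C (-m) ≤ a2 - X) := by
    rcases lt_or_ge (a2 - X) (C (-m)) with hlt | hge'
    · left
      refine ⟨?_, hlt⟩
      rw [← h3]
      apply h.eq
      · omega
      · rw [show -(m+1)+1 = -m by ring]; exact hlt
    · right
      refine ⟨?_, hge'⟩
      rw [← h3]
      apply h.eq hge'
      omega
  have c4 : (a4 = n ∧ C n ≤ Y + a3 - m) ∨ (a4 = n - 1 ∧ Y + a3 - m < C n) := by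
    rcases lt_or_ge (Y + a3 - m) (C n) with hlt | hge
    · right
      refine ⟨?_, hlt⟩
      rw [← h4]
      apply h.eq
      · omega
      · rw [show n - 1 + 1 = n by ring]; exact hlt
    · left
      refine ⟨?_, hge⟩
      rw [← h4]
      apply h.eq hge
      omega
  have c5 : (f (X + a4 - a2) = m ∧ C m ≤ X + a4 - a2) ∨
      (f (X + a4 - a2) = m - 1 ∧ X + a4 - a2 < C m) := by
    rcases lt_or_ge (X + a4 - a2) (C m) with hlt | hge
    · right
      refine ⟨?_, hlt⟩
      apply h.eq
      · omega
      · rw [show m - 1 + 1 = m by ring]; exact hlt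
    · left
      refine ⟨?_, hge⟩
      apply h.eq hge
      omega
  have hS1 := fun (hne : RI f (F4 f (X,Y)) ≠ RI f (X,Y)) => hS hne m n
  rw [h2]
  rw [hF] at hS1 ⊢
  simp only [RI, h4, hm, hn, Prod.mk.injEq, ne_eq] at hS1 ⊢
  have h0 := h.zero
  rcases c4 with ⟨c4, c4'⟩ | ⟨c4, c4'⟩
  · rcases c5 with c5 | c5
    · left
      by_cases hm0 : m = 0
      · subst hm0
        simp only [neg_zero] at *
        refine ⟨⟨by omega, by omega⟩, by omega, by omega⟩
      · refine ⟨⟨by omega, by omega⟩, by omega, by omega⟩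
    · right; right
      by_cases hm0 : m = 0
      · right
        refine ⟨hm0, ?_⟩
        rw [hm0] at c5
        omega
      · left
        have ha2 : a2 = -(n+1) := by omega
        have : f (-n - 1 - X) = a3 := by rw [← h3, ha2]; congr 1; ring
        rw [this]
        refine ⟨⟨by omega, by omega⟩, ⟨by omega, by omega⟩, by omega, by omega, by omega⟩
  · right; left
    replace hS1 := hS1 (by omega)
    by_cases hX : X ≤ C m - 2 * n
    · exfalso
      apply hS1
      rcases le_total m (-n-1) with hmn | hmn
      · apply NC.mk' (r := 1 - 2 * n) <;> omega
      · apply NC.mk' (r := 2 * m + 3) <;> omega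
    · refine ⟨⟨by omega, by omega⟩, ⟨by omega, by omega⟩, by omega, by omega⟩


/-- floor on lattice -/
noncomputable def fl (lam : ℝ) (X : ℤ) : ℤ := ⌊lam * (X : ℝ)⌋
/-- ceiling -/
noncomputable def cl (lam : ℝ) (k : ℤ) : ℤ := ⌈(k : ℝ) / lam⌉
/-- embedding -/
def emb (lam : ℝ) (p : ℤ × ℤ) : ℝ × ℝ := (lam * (p.1 : ℝ), lam * (p.2 : ℝ))

theorem cl_ge {lam : ℝ} (h : 0 < lam) (k : ℤ) : (k : ℝ) ≤ lam * (cl lam k : ℝ) := by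
  have := Int.le_ceil ((k : ℝ) / lam)
  rw [div_le_iff₀ h] at this
  unfold cl; linarith

theorem cl_lt {lam : ℝ} (h : 0 < lam) (k : ℤ) : lam * (cl lam k : ℝ) < k + lam := by
  have := Int.ceil_lt_add_one ((k : ℝ) / lam)
  have h2 : (k : ℝ) / lam * lam = k := by field_simp
  unfold cl; nlinarith

theorem fl_iff {lam : ℝ} (h : 0 < lam) (k X : ℤ) : k ≤ fl lam X ↔ cl lam k ≤ X := by
  unfold fl cl
  rw [Int.le_floor, Int.ceil_le, div_le_iff₀ h, mul_comm]

theorem fl_FC {lam : ℝ} {G : ℤ} (h : 0 < lam) (hG : (G : ℝ) * lam ≤ 1) :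
    FC (fl lam) (cl lam) G where
  iff := fl_iff h
  gap := by
    intro k
    unfold cl
    rw [← Int.ceil_add_intCast]
    apply Int.ceil_le_ceil
    rw [← sub_nonneg]
    have : (((k + 1 : ℤ) : ℝ)) / lam - ((k : ℝ) / lam + G) = (1 - G * lam) / lam := by
      push_cast; field_simp; ring
    rw [this]
    apply div_nonneg _ h.le
    linarith
  neg1 := by
    intro k
    have h1 := cl_ge h k
    have h2 := cl_ge h (-k)
    have h3 := cl_lt h k
    push_cast at h2
    have : lam * ((-1 : ℤ) : ℝ) < lam * ((cl lam k + cl lam (-k) : ℤ) : ℝ) := by push_cast; nlinarith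
    have := lt_of_mul_lt_mul_left this h.le
    have : (-1 : ℤ) < cl lam k + cl lam (-k) := by exact_mod_cast this
    omega
  neg2 := by
    intro k
    have h2 := cl_lt h (-k)
    have h3 := cl_lt h k
    push_cast at h2
    have : lam * ((cl lam k + cl lam (-k) : ℤ) : ℝ) < lam * ((2 : ℤ) : ℝ) := by push_cast; nlinarith
    have := lt_of_mul_lt_mul_left this h.le
    have : cl lam k + cl lam (-k) < (2 : ℤ) := by exact_mod_cast this
    omega
  zero := by simp [cl]

theorem NC_dist {lam : ℝ} (h : 0 < lam) {m n : ℤ} {p : ℤ × ℤ} (hp : NC (cl lam) m n p) :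
    max |(emb lam p).1 - (m : ℝ)| |(emb lam p).2 - (n : ℝ)| ≤
      lam * (max |2 * (m : ℝ) + 1| |2 * (n : ℝ) + 1| + 2) := by
  obtain ⟨r, hr, h1, h2, h3, h4⟩ := hp
  have hr' : (r : ℝ) ≤ max |2 * (m : ℝ) + 1| |2 * (n : ℝ) + 1| + 2 := by
    have : ((r : ℤ) : ℝ) ≤ ((max |2 * m + 1| |2 * n + 1| + 2 : ℤ) : ℝ) := by exact_mod_cast hr
    push_cast at this
    exact this
  refine le_trans ?_ (mul_le_mul_of_nonneg_left hr' h.le)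
  have key : ∀ (k X : ℤ), cl lam k - r ≤ X → X ≤ cl lam k + r - 1 →
      |lam * (X : ℝ) - k| ≤ lam * r := by
    intro k X e1 e2
    have e1' : (cl lam k : ℝ) - r ≤ X := by exact_mod_cast e1
    have e2' : (X : ℝ) ≤ cl lam k + r - 1 := by exact_mod_cast e2
    have c1 := cl_ge h k
    have c2 := cl_lt h k
    rw [abs_le]
    constructor <;> nlinarith
  exact max_le (key _ _ h1 h2) (key _ _ h3 h4)

theorem Pfun_box {lam : ℝ} {X m : ℤ} (hm : fl lam X = m) :
    Pfun (lam * X) = (m : ℝ)^2 + (2 * m + 1) * (lam * X - m) ∧ (m : ℝ) ≤ lam * X ∧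
      lam * X < m + 1 := by
  unfold fl at hm
  refine ⟨by unfold Pfun; rw [hm], ?_, ?_⟩
  · rw [← hm]; exact Int.floor_le _
  · rw [← hm]; exact Int.lt_floor_add_one _

/-- exit through a horizontal side, decided by `e` -/
def exY (e m n : ℤ) : Prop := if 0 ≤ n then e < (m+1)^2 + n^2 else m^2 + n^2 ≤ e

/-- box invariant -/
def InvB (e m n : ℤ) : Prop :=
  if 0 ≤ n then m^2 + n^2 ≤ e ∧ e < (m+1)^2 + (n+1)^2
  else m^2 + (n+1)^2 ≤ e ∧ e < (m+1)^2 + n^2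

theorem inv_of_ham {lam : ℝ} {X Y m n e e' : ℤ}
    (hE : ∀ a b : ℤ, a^2 + b^2 ≤ e ∨ e' ≤ a^2 + b^2)
    (hm : fl lam X = m) (hn : fl lam Y = n) (m0 : 0 ≤ m)
    (H1 : (e : ℝ) < Ham (emb lam (X, Y))) (H2 : Ham (emb lam (X, Y)) < e') : InvB e m n := by
  obtain ⟨p1, p2, p3⟩ := Pfun_box hm
  obtain ⟨q1, q2, q3⟩ := Pfun_box hn
  simp only [Ham, emb] at H1 H2
  rw [p1, q1] at H1 H2
  have m0' : (0 : ℝ) ≤ m := by exact_mod_cast m0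
  unfold InvB
  split_ifs with hn0
  · have n0' : (0 : ℝ) ≤ n := by exact_mod_cast hn0
    constructor
    · rcases hE m n with h | h
      · exact h
      · exfalso
        have h' : (e' : ℝ) ≤ (m : ℝ)^2 + n^2 := by exact_mod_cast h
        nlinarith
    · have : (e : ℝ) < ((m:ℝ)+1)^2 + (n+1)^2 := by nlinarith
      exact_mod_cast this
  · have n0' : (n : ℝ) + 1 ≤ 0 := by
      have : n + 1 ≤ 0 := by omega
      exact_mod_cast this
    constructor
    · rcases hE m (n+1) with h | h
      · exact h
      · exfalso
        have h' : (e' : ℝ) ≤ (m : ℝ)^2 + (n+1)^2 := by exact_mod_cast h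
        nlinarith
    · have : (e : ℝ) < ((m:ℝ)+1)^2 + n^2 := by nlinarith
      exact_mod_cast this

theorem cl_le_of_gt {lam : ℝ} (h : 0 < lam) {k X r : ℤ}
    (hx : (k : ℝ) - lam * r < lam * X) : cl lam k - r ≤ X := by
  have c2 := cl_lt h k
  have : lam * ((cl lam k - r - 1 : ℤ) : ℝ) < lam * (X : ℝ) := by push_cast; nlinarith
  have := lt_of_mul_lt_mul_left this h.le
  have : cl lam k - r - 1 < X := by exact_mod_cast this
  omega

theorem lt_cl_of_lt {lam : ℝ} (h : 0 < lam) {k X r : ℤ}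
    (hx : lam * X < (k : ℝ) + lam * r) : X < cl lam k + r := by
  have c2 := cl_ge h k
  have : lam * (X : ℝ) < lam * ((cl lam k + r : ℤ) : ℝ) := by push_cast; nlinarith
  have := lt_of_mul_lt_mul_left this h.le
  exact_mod_cast this

theorem real_of_lt_cl {lam : ℝ} (h : 0 < lam) {k X r : ℤ}
    (hx : X < cl lam k + r) : lam * X < (k : ℝ) + lam * r := by
  have c2 := cl_lt h k
  have : (X : ℝ) + 1 ≤ cl lam k + r := by exact_mod_cast hx
  nlinarith

theorem real_of_cl_le {lam : ℝ} (h : 0 < lam) {k X r : ℤ}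
    (hx : cl lam k - r ≤ X) : (k : ℝ) - lam * r ≤ lam * X := by
  have c2 := cl_ge h k
  have : (cl lam k : ℝ) - r ≤ X := by exact_mod_cast hx
  nlinarith

theorem NC_ext {C : ℤ → ℤ} {m n X Y r s : ℤ}
    (hr : r ≤ 2 * m + 2 ∨ r ≤ - 2 * m ∨ r ≤ 2 * n + 2 ∨ r ≤ - 2 * n)
    (hs : s ≤ 2 * m + 2 ∨ s ≤ - 2 * m ∨ s ≤ 2 * n + 2 ∨ s ≤ - 2 * n)
    (h1 : C m - r ≤ X) (h2 : X ≤ C m + r) (h3 : C n - s ≤ Y) (h4 : Y ≤ C n + s) :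
    NC C m n (X, Y) := by
  rcases le_total r s with hrs | hrs
  · apply NC.mk' (r := s + 1) <;> omega
  · apply NC.mk' (r := r + 1) <;> omega

theorem exY_up {lam : ℝ} {X Y m n e : ℤ} (h : 0 < lam)
    (hm : fl lam X = m) (hn : fl lam Y = n) (m0 : 0 ≤ m) (n0 : 0 ≤ n)
    (H1 : (e : ℝ) < Ham (emb lam (X, Y)))
    (y1 : cl lam n ≤ Y) (y2 : Y < cl lam n + (2 * m + 1))
    (hS : ¬ NC (cl lam) (m+1) n (X, Y)) : exY e m n := by
  obtain ⟨p1, p2, p3⟩ := Pfun_box hm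
  obtain ⟨q1, q2, q3⟩ := Pfun_box hn
  simp only [Ham, emb] at H1
  rw [p1, q1] at H1
  have m0' : (0 : ℝ) ≤ m := by exact_mod_cast m0
  have n0' : (0 : ℝ) ≤ n := by exact_mod_cast n0
  unfold exY
  rw [if_pos n0]
  by_contra hc
  push Not at hc
  have hc' : ((m:ℝ)+1)^2 + n^2 ≤ e := by exact_mod_cast hc
  have y2' := real_of_lt_cl h y2
  push_cast at y2'
  have : ((m + 1 : ℤ) : ℝ) - lam * ((2 * n + 1 : ℤ) : ℝ) < lam * X := by
    push_cast
    have : 0 < (2 * (m:ℝ) + 1) * (lam * X - (m + 1 - lam * (2 * n + 1))) := by nlinarith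
    have := pos_of_mul_pos_right this (by linarith)
    linarith
  have hx := cl_le_of_gt h this
  have hx2 : X < cl lam (m+1) := by
    by_contra hh
    have := (fl_iff h (m+1) X).2 (by omega)
    omega
  apply hS
  apply NC_ext (r := 2 * n + 1) (s := 2 * m + 1) <;> omega

theorem exX_up {lam : ℝ} {X Y m n e e' : ℤ} (h : 0 < lam)
    (hE : ∀ a b : ℤ, a^2 + b^2 ≤ e ∨ e' ≤ a^2 + b^2)
    (hm : fl lam X = m) (hn : fl lam Y = n) (m0 : 0 ≤ m) (n0 : 0 ≤ n)
    (H2 : Ham (emb lam (X, Y)) < e')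
    (x1 : cl lam (m+1) - (2 * n + 1) ≤ X) (x2 : X < cl lam (m+1))
    (hS : ¬ NC (cl lam) (m+1) n (X, Y)) : ¬ exY e m n := by
  obtain ⟨p1, p2, p3⟩ := Pfun_box hm
  obtain ⟨q1, q2, q3⟩ := Pfun_box hn
  simp only [Ham, emb] at H2
  rw [p1, q1] at H2
  have m0' : (0 : ℝ) ≤ m := by exact_mod_cast m0
  have n0' : (0 : ℝ) ≤ n := by exact_mod_cast n0
  unfold exY
  rw [if_pos n0]
  intro hc
  have hc' : (e' : ℝ) ≤ ((m:ℝ)+1)^2 + n^2 := by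
    rcases hE (m+1) n with h | h
    · omega
    · exact_mod_cast h
  have x1' := real_of_cl_le h x1
  push_cast at x1'
  have : lam * Y < (n : ℝ) + lam * ((2 * m + 1 : ℤ) : ℝ) := by
    push_cast
    have : 0 < (2 * (n:ℝ) + 1) * ((n + lam * (2 * m + 1)) - lam * Y) := by nlinarith
    have := pos_of_mul_pos_right this (by linarith)
    linarith
  have hy := lt_cl_of_lt h this
  have hy2 : cl lam n ≤ Y := (fl_iff h n Y).1 (by omega)
  apply hS
  apply NC_ext (r := 2 * n + 1) (s := 2 * m + 1) <;> omega

theorem exY_dn {lam : ℝ} {X Y m n e e' : ℤ} (h : 0 < lam)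
    (hE : ∀ a b : ℤ, a^2 + b^2 ≤ e ∨ e' ≤ a^2 + b^2)
    (hm : fl lam X = m) (hn : fl lam Y = n) (m0 : 0 ≤ m) (n0 : n < 0)
    (H2 : Ham (emb lam (X, Y)) < e')
    (y1 : cl lam n ≤ Y) (y2 : Y < cl lam n + (2 * m + 1))
    (hS : ¬ NC (cl lam) m n (X, Y)) : exY e m n := by
  obtain ⟨p1, p2, p3⟩ := Pfun_box hm
  obtain ⟨q1, q2, q3⟩ := Pfun_box hn
  simp only [Ham, emb] at H2
  rw [p1, q1] at H2
  have m0' : (0 : ℝ) ≤ m := by exact_mod_cast m0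
  have n0' : (n : ℝ) + 1 ≤ 0 := by
    have : n + 1 ≤ 0 := by omega
    exact_mod_cast this
  unfold exY
  rw [if_neg (by omega)]
  by_contra hc
  have hc' : (e' : ℝ) ≤ (m:ℝ)^2 + n^2 := by
    rcases hE m n with h | h
    · omega
    · exact_mod_cast h
  have y2' := real_of_lt_cl h y2
  push_cast at y2'
  have : lam * X < (m : ℝ) + lam * ((-2 * n - 1 : ℤ) : ℝ) := by
    push_cast
    have : 0 < (2 * (m:ℝ) + 1) * ((m + lam * (-2 * n - 1)) - lam * X) := by nlinarith
    have := pos_of_mul_pos_right this (by linarith)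
    linarith
  have hx := lt_cl_of_lt h this
  have hx2 : cl lam m ≤ X := (fl_iff h m X).1 (by omega)
  apply hS
  apply NC_ext (r := -2 * n - 1) (s := 2 * m + 1) <;> omega

theorem exX_dn {lam : ℝ} {X Y m n e : ℤ} (h : 0 < lam)
    (hm : fl lam X = m) (hn : fl lam Y = n) (m0 : 0 ≤ m) (n0 : n < 0)
    (H1 : (e : ℝ) < Ham (emb lam (X, Y)))
    (x1 : cl lam m ≤ X) (x2 : X < cl lam m - (2 * n + 1))
    (hS : ¬ NC (cl lam) m n (X, Y)) : ¬ exY e m n := by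
  obtain ⟨p1, p2, p3⟩ := Pfun_box hm
  obtain ⟨q1, q2, q3⟩ := Pfun_box hn
  simp only [Ham, emb] at H1
  rw [p1, q1] at H1
  have m0' : (0 : ℝ) ≤ m := by exact_mod_cast m0
  have n0' : (n : ℝ) + 1 ≤ 0 := by
    have : n + 1 ≤ 0 := by omega
    exact_mod_cast this
  unfold exY
  rw [if_neg (by omega)]
  intro hc
  have hc' : (m:ℝ)^2 + n^2 ≤ e := by exact_mod_cast hc
  have x2' : lam * X < (m : ℝ) + lam * ((-2 * n - 1 : ℤ) : ℝ) := real_of_lt_cl h (by omega)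
  push_cast at x2'
  have : lam * Y < (n : ℝ) + lam * ((2 * m + 1 : ℤ) : ℝ) := by
    push_cast
    have : 0 < (-2 * (n:ℝ) - 1) * ((n + lam * (2 * m + 1)) - lam * Y) := by nlinarith
    have := pos_of_mul_pos_right this (by linarith)
    linarith
  have hy := lt_cl_of_lt h this
  have hy2 : cl lam n ≤ Y := (fl_iff h n Y).1 (by omega)
  apply hS
  apply NC_ext (r := -2 * n - 1) (s := 2 * m + 1) <;> omega


/-- the regular step alternatives at a point `p` in box `(m,n)` -/
def StepOK (f C : ℤ → ℤ) (e : ℤ) (p : ℤ × ℤ) (m n : ℤ) : Prop :=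
    (F4 f p = (p.1 + (2 * n + 1), p.2 - (2 * m + 1)) ∧ RI f (F4 f p) = (m, n))
    ∨ (F4 f p = (p.1 + (n - 1) - f (m - p.2), p.2 - (2 * m + 1)) ∧
        RI f (F4 f p) = (m, n - 1) ∧ C n ≤ p.2 ∧ p.2 < C n + (2 * m + 1) ∧ exY e m n)
    ∨ (F4 f p = (p.1 + (2 * n + 1), p.2 + f (-n - 1 - p.1) - m) ∧
        RI f (F4 f p) = (m + 1, n) ∧ C (m+1) - (2 * n + 1) ≤ p.1 ∧ p.1 < C (m+1) ∧ 0 ≤ n ∧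
          ¬ exY e m n)
    ∨ (F4 f p = (p.1 + (2 * n + 1), p.2 + f (-n - 1 - p.1) - m) ∧
        RI f (F4 f p) = (m - 1, n) ∧ C m ≤ p.1 ∧ p.1 < C m - (2 * n + 1) ∧ 1 ≤ m ∧ n < 0 ∧
          ¬ exY e m n)

theorem sq_le_bound {a b e : ℤ} (h : a^2 + b^2 ≤ e) : a ≤ e ∧ b ≤ e ∧ -b ≤ e := by
  refine ⟨by nlinarith [sq_nonneg (a-1), sq_nonneg b, sq_nonneg a], by nlinarith [sq_nonneg (b-1), sq_nonneg a],
    by nlinarith [sq_nonneg (b+1), sq_nonneg a]⟩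

theorem stepOK_of {lam : ℝ} {G K X Y m n e e' : ℤ} (h : 0 < lam) (hGl : (G : ℝ) * lam ≤ 1)
    (hG : 10 * K + 20 ≤ G) (hK : e' ≤ K) (hee : e < e')
    (hE : ∀ a b : ℤ, a^2 + b^2 ≤ e ∨ e' ≤ a^2 + b^2)
    (hm : fl lam X = m) (hn : fl lam Y = n) (m0 : 0 ≤ m)
    (ho : 0 ≤ n → 0 < X ∨ 0 < Y)
    (H1 : (e : ℝ) < Ham (emb lam (X, Y))) (H2 : Ham (emb lam (X, Y)) < e')
    (hS : NS (fl lam) (cl lam) (X, Y)) :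
    StepOK (fl lam) (cl lam) e (X, Y) m n ∨ (m = 0 ∧ n < 0 ∧ (F4 (fl lam) (X, Y)).1 < 0) := by
  have hFC := fl_FC h hGl
  have hI := inv_of_ham hE hm hn m0 H1 H2
  unfold InvB at hI
  unfold StepOK
  have hb : RI (fl lam) (X, Y) = (m, n) := by simp [RI, hm, hn]
  unfold NS at hS
  rw [hb] at hS
  by_cases n0 : 0 ≤ n
  · rw [if_pos n0] at hI
    obtain ⟨b1, b2, b3⟩ := sq_le_bound hI.1
    rcases step_up hFC hG hm hn m0 n0 (by omega) (by omega) (ho n0) (by unfold NS; rw [hb]; exact hS) with c | c | c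
    · left; left; exact c
    · left; right; left
      refine ⟨c.1, c.2.1, c.2.2.1, c.2.2.2, ?_⟩
      refine exY_up h hm hn m0 n0 H1 c.2.2.1 c.2.2.2 (hS ?_ _ _)
      rw [c.2.1]; simp
    · left; right; right; left
      refine ⟨c.1, c.2.1, c.2.2.1, c.2.2.2, n0, ?_⟩
      refine exX_up h hE hm hn m0 n0 H2 c.2.2.1 c.2.2.2 (hS ?_ _ _)
      rw [c.2.1]; simp
  · rw [if_neg n0] at hI
    obtain ⟨b1, b2, b3⟩ := sq_le_bound hI.1
    rcases step_dn hFC hG hm hn m0 (by omega) (by omega) (by omega) (by unfold NS; rw [hb]; exact hS) with c | c | c | c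
    · left; left; exact c
    · left; right; left
      refine ⟨c.1, c.2.1, c.2.2.1, c.2.2.2, ?_⟩
      refine exY_dn h hE hm hn m0 (by omega) H2 c.2.2.1 c.2.2.2 (hS ?_ _ _)
      rw [c.2.1]; simp
    · left; right; right; right
      refine ⟨c.1, c.2.1, c.2.2.1, c.2.2.2.1, c.2.2.2.2, by omega, ?_⟩
      refine exX_dn h hm hn m0 (by omega) H1 c.2.2.1 c.2.2.2.1 (hS ?_ _ _)
      rw [c.2.1]; simp
    · right; exact ⟨c.1, by omega, c.2⟩

/-- a path of regular steps ending in the final box -/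
structure RPath (f C : ℤ → ℤ) (e μ : ℤ) (z : ℕ → ℤ × ℤ) (T : ℕ) : Prop where
  next : ∀ i, i < T → z (i+1) = F4 f (z i)
  step : ∀ i, i < T → StepOK f C e (z i) (f (z i).1) (f (z i).2)
  inv : ∀ i, i < T → InvB e (f (z i).1) (f (z i).2)
  pos : ∀ i, i ≤ T → 0 ≤ f (z i).1
  diag : ∀ i, i ≤ T → f (z i).2 < 0 → -1 ≤ f (z i).1 + f (z i).2
  fin : RI f (z T) = (μ, -μ-1)

/-- synchronised state of two points -/
structure SyncSt (f : ℤ → ℤ) (e μ H : ℤ) (p p' : ℤ × ℤ) (m n : ℤ) : Prop where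
  box : RI f p = (m, n)
  box' : RI f p' = (m, n)
  nm : n ≤ m
  ham : (2 * m + 1) * (p'.1 - p.1) + (2 * n + 1) * (p'.2 - p.2) = H
  dy : exY e m n ∨ (m = μ ∧ n = -μ-1) → (2 * m + 1) ∣ p'.2 - p.2
  dx : ¬ exY e m n ∨ (m = μ ∧ n = -μ-1) → (2 * n + 1) ∣ p'.1 - p.1

theorem eq_of_window {a b c w : ℤ} (h : w ∣ b - a) (h1 : c ≤ a) (h2 : a < c + w) (h3 : c ≤ b)
    (h4 : b < c + w) : b = a := by
  have := Int.eq_zero_of_abs_lt_dvd h (by rw [abs_lt]; omega)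
  omega

/-- turn divisibility -/
structure TurnDvd (e μ H : ℤ) : Prop where
  yx : ∀ m j : ℤ, 0 ≤ j → j < m → m^2 + (j+1)^2 ≤ e → (m+1)^2 + j^2 ≤ e →
    e < (m+1)^2 + (j+1)^2 → (2*m+1)*(2*j+1) ∣ H
  xy : ∀ m j : ℤ, 0 ≤ j → j < m → m^2 + j^2 ≤ e → e < m^2 + (j+1)^2 → e < (m+1)^2 + j^2 →
    (2*m+1)*(2*j+1) ∣ H
  fin : (2*μ+1)*(2*μ+1) ∣ H
  mu1 : 2 * μ^2 ≤ e
  mu2 : e < 2 * (μ+1)^2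
  mu0 : 0 ≤ μ

theorem mu_unique {e μ m : ℤ} (h1 : 2 * μ^2 ≤ e) (h2 : e < 2 * (μ+1)^2) (_h0 : 0 ≤ μ) (m0 : 0 ≤ m)
    (g1 : 2 * m^2 ≤ e) (g2 : e < 2 * (m+1)^2) : m = μ := by
  have a : μ < m + 1 := by nlinarith
  have b : m < μ + 1 := by nlinarith
  omega

theorem sq_mono {m : ℤ} (h : 0 ≤ m) : m^2 ≤ (m+1)^2 := by nlinarith

theorem RPath.T_pos {f C : ℤ → ℤ} {e μ : ℤ} {z : ℕ → ℤ × ℤ} {T i : ℕ} (h : RPath f C e μ z T)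
    (hi : i ≤ T) {m n : ℤ} (hb : RI f (z i) = (m, n)) (hne : ¬ (m = μ ∧ n = -μ-1)) : i < T := by
  rcases hi.lt_or_eq with h1 | h1
  · exact h1
  · subst h1
    rw [h.fin] at hb
    simp only [Prod.mk.injEq] at hb
    exfalso; apply hne; constructor <;> omega

set_option maxHeartbeats 1000000 in
theorem pair_sync {f C : ℤ → ℤ} {e μ H : ℤ} {z z' : ℕ → ℤ × ℤ} {T T' : ℕ}
    (hT : TurnDvd e μ H) (hz : RPath f C e μ z T) (hz' : RPath f C e μ z' T') :
    ∀ (N i i' : ℕ) (m n : ℤ), i ≤ T → i' ≤ T' → (T - i) + (T' - i') = N →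
      SyncSt f e μ H (z i) (z' i') m n →
      ∃ j j', j ≤ T ∧ j' ≤ T' ∧ SyncSt f e μ H (z j) (z' j') μ (-μ-1) := by
  intro N
  induction N using Nat.strong_induction_on with
  | _ N ih =>
  intro i i' m n hi hi' hN st
  by_cases hfin : m = μ ∧ n = -μ-1
  · obtain ⟨rfl, rfl⟩ := hfin
    exact ⟨i, i', hi, hi', st⟩
  have hiT := hz.T_pos hi st.box hfin
  have hiT' := hz'.T_pos hi' st.box' hfin
  have s1 := hz.step i hiT
  have s2 := hz'.step i' hiT'
  have n1 := hz.next i hiT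
  have n2 := hz'.next i' hiT'
  have bx := st.box
  have bx' := st.box'
  have inv := hz.inv i hiT
  have pos := hz.pos i hi
  have posn := hz.pos (i+1) hiT
  have dgn := hz.diag (i+1) hiT
  simp only [RI, Prod.mk.injEq] at bx bx'
  rw [bx.1, bx.2] at s1 inv
  rw [bx'.1, bx'.2] at s2
  rw [bx.1] at pos
  have ham := st.ham
  have nm := st.nm
  unfold StepOK at s1 s2
  rw [← n1] at s1
  rw [← n2] at s2
  -- advance z alone
  rcases s1 with ⟨a1, a2⟩ | s1
  · refine ih ((T - (i+1)) + (T' - i')) (by omega) (i+1) i' m n hiT hi' rfl ?_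
    refine ⟨a2, st.box', nm, ?_, ?_, ?_⟩
    · rw [a1]; simp only; linarith
    · intro hh
      rw [a1]
      have := (st.dy hh).add (dvd_refl (2*m+1))
      simp only
      rw [show (z' i').2 - ((z i).2 - (2 * m + 1)) = (z' i').2 - (z i).2 + (2 * m + 1) by ring]; exact this
    · intro hh
      rw [a1]
      have := (st.dx hh).sub (dvd_refl (2*n+1))
      simp only
      rw [show (z' i').1 - ((z i).1 + (2 * n + 1)) = (z' i').1 - (z i).1 - (2 * n + 1) by ring]; exact this
  rcases s2 with ⟨a1, a2⟩ | s2
  · refine ih ((T - i) + (T' - (i'+1))) (by omega) i (i'+1) m n hi hiT' rfl ?_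
    refine ⟨st.box, a2, nm, ?_, ?_, ?_⟩
    · rw [a1]; simp only; linarith
    · intro hh
      rw [a1]
      have := (st.dy hh).sub (dvd_refl (2*m+1))
      simp only
      rw [show (z' i').2 - (2 * m + 1) - (z i).2 = (z' i').2 - (z i).2 - (2 * m + 1) by ring]; exact this
    · intro hh
      rw [a1]
      have := (st.dx hh).add (dvd_refl (2*n+1))
      simp only
      rw [show (z' i').1 + (2 * n + 1) - (z i).1 = (z' i').1 - (z i).1 + (2 * n + 1) by ring]; exact this
  have hlt : (T - (i+1)) + (T' - (i'+1)) < N := by omega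
  rcases s1 with ⟨a1, a2, a3, a4, a5⟩ | s1
  · -- Y crossing
    rcases s2 with ⟨b1, b2, b3, b4, b5⟩ | s2
    swap
    · exfalso
      rcases s2 with s2 | s2
      · exact s2.2.2.2.2.2 a5
      · exact s2.2.2.2.2.2.2 a5
    have hY : (z' i').2 = (z i).2 := eq_of_window (st.dy (Or.inl a5)) a3 a4 b3 b4
    refine ih _ hlt (i+1) (i'+1) m (n-1) hiT hiT' rfl ?_
    have hD : (z' (i'+1)).1 - (z (i+1)).1 = (z' i').1 - (z i).1 := by
      rw [a1, b1, hY]; simp only; ring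
    have hDY : (z' (i'+1)).2 - (z (i+1)).2 = 0 := by
      rw [a1, b1, hY]; simp
    rw [hY] at ham
    simp only [sub_self, mul_zero, add_zero] at ham
    have hbn := a2
    simp only [RI, Prod.mk.injEq] at hbn
    rw [hbn.1, hbn.2] at dgn
    refine ⟨a2, b2, by omega, ?_, ?_, ?_⟩
    · rw [hD, hDY]; simpa using ham
    · intro _; rw [hDY]; exact dvd_zero _
    · intro hh
      rw [hD]
      have key : (2*m+1)*(2*(n-1)+1) ∣ H := by
        rcases hh with hh | hh
        · unfold exY at hh a5
          unfold InvB at inv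
          by_cases n0 : 0 ≤ n - 1
          · rw [if_pos n0] at hh
            rw [if_pos (by omega)] at inv a5
            apply hT.yx m (n-1) n0 (by omega)
            · rw [show n - 1 + 1 = n by ring]; exact inv.1
            · push Not at hh; exact hh
            · rw [show n - 1 + 1 = n by ring]; exact a5
          · rw [if_neg n0] at hh
            have hd := dgn (by omega)
            -- j = -n
            have e1 : m^2 + (-n)^2 ≤ e := by
              rw [neg_sq]
              split_ifs at a5 inv with c
              · exact inv.1
              · exact a5
            have e2 : e < m^2 + (-n+1)^2 := by
              rw [show (-n+1)^2 = (n-1)^2 by ring]; exact not_le.1 hh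
            have e3 : e < (m+1)^2 + (-n)^2 := by
              rw [neg_sq]
              split_ifs at a5 inv with c
              · exact a5
              · exact inv.2
            have : (2*m+1)*(2*(-n)+1) ∣ H := by
              rcases lt_or_ge (-n) m with hj | hj
              · exact hT.xy m (-n) (by omega) hj e1 e2 e3
              · have hj' : -n = m := by omega
                rw [hj'] at e1 e2 e3 ⊢
                have := mu_unique hT.mu1 hT.mu2 hT.mu0 pos (by linarith) (by linarith [sq_mono pos])
                rw [this]; exact hT.fin
            rw [show (2*m+1)*(2*(n-1)+1) = -((2*m+1)*(2*(-n)+1)) by ring]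
            exact (neg_dvd).2 this
        · rw [hh.1, hh.2, show (2*μ+1)*(2*(-μ-1)+1) = -((2*μ+1)*(2*μ+1)) by ring]
          exact (neg_dvd).2 hT.fin
      rw [← ham] at key
      exact (mul_dvd_mul_iff_left (by omega)).1 key
  · -- X crossing
    have hne : ¬ exY e m n := by
      rcases s1 with s1 | s1
      · exact s1.2.2.2.2.2
      · exact s1.2.2.2.2.2.2
    rcases s2 with s2 | s2
    · exact absurd s2.2.2.2.2 hne
    have hdx := st.dx (Or.inl hne)
    have ineq : (0 ≤ n ∧ ¬ n < 0) ∨ (n < 0 ∧ ¬ 0 ≤ n) := by omega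
    rcases ineq with ⟨n0, n0'⟩ | ⟨n0, n0'⟩
    · replace s1 := s1.resolve_right (fun c => n0' c.2.2.2.2.2.1)
      replace s2 := s2.resolve_right (fun c => n0' c.2.2.2.2.2.1)
      obtain ⟨a1, a2, a3, a4, a5, a6⟩ := s1
      obtain ⟨b1, b2, b3, b4, b5, b6⟩ := s2
      have hX : (z' i').1 = (z i).1 := eq_of_window hdx a3 (by omega) b3 (by omega)
      refine ih _ hlt (i+1) (i'+1) (m+1) n hiT hiT' rfl ?_
      have hD : (z' (i'+1)).2 - (z (i+1)).2 = (z' i').2 - (z i).2 := by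
        rw [a1, b1, hX]; simp only; ring
      have hDX : (z' (i'+1)).1 - (z (i+1)).1 = 0 := by
        rw [a1, b1, hX]; simp
      rw [hX] at ham
      simp only [sub_self, mul_zero, zero_add] at ham
      refine ⟨a2, b2, by omega, ?_, ?_, ?_⟩
      · rw [hD, hDX]; simpa using ham
      · intro hh
        rw [hD]
        have key : (2*(m+1)+1)*(2*n+1) ∣ H := by
          rcases hh with hh | hh
          · unfold exY at hh a6
            unfold InvB at inv
            rw [if_pos n0] at hh a6 inv
            exact hT.xy (m+1) n n0 (by omega) (by omega) inv.2 hh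
          · have := hT.mu0
            omega
        rw [← ham, mul_comm] at key
        exact (mul_dvd_mul_iff_left (by omega)).1 key
      · intro _; rw [hDX]; exact dvd_zero _
    · replace s1 := s1.resolve_left (fun c => n0' c.2.2.2.2.1)
      replace s2 := s2.resolve_left (fun c => n0' c.2.2.2.2.1)
      obtain ⟨a1, a2, a3, a4, a5, a6, a7⟩ := s1
      obtain ⟨b1, b2, b3, b4, b5, b6, b7⟩ := s2
      have hdx' : -(2*n+1) ∣ (z' i').1 - (z i).1 := (neg_dvd).2 hdx
      have hX : (z' i').1 = (z i).1 := eq_of_window hdx' a3 (by omega) b3 (by omega)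
      have hbn := a2
      simp only [RI, Prod.mk.injEq] at hbn
      rw [hbn.1, hbn.2] at dgn
      have hd := dgn n0
      refine ih _ hlt (i+1) (i'+1) (m-1) n hiT hiT' rfl ?_
      have hD : (z' (i'+1)).2 - (z (i+1)).2 = (z' i').2 - (z i).2 := by
        rw [a1, b1, hX]; simp only; ring
      have hDX : (z' (i'+1)).1 - (z (i+1)).1 = 0 := by
        rw [a1, b1, hX]; simp
      rw [hX] at ham
      simp only [sub_self, mul_zero, zero_add] at ham
      refine ⟨a2, b2, by omega, ?_, ?_, ?_⟩
      · rw [hD, hDX]; simpa using ham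
      · intro hh
        rw [hD]
        have key : (2*(m-1)+1)*(2*n+1) ∣ H := by
          rcases hh with hh | hh
          · unfold exY at hh a7
            unfold InvB at inv
            rw [if_neg n0'] at hh a7 inv
            have e1 : (m-1)^2 + (-n-1+1)^2 ≤ e := by
              rw [show -n-1+1 = -n by ring, neg_sq]; exact hh
            have e2 : (m-1+1)^2 + (-n-1)^2 ≤ e := by
              rw [show (-n-1)^2 = (n+1)^2 by ring, show m-1+1 = m by ring]; exact inv.1
            have e3 : e < (m-1+1)^2 + (-n-1+1)^2 := by
              rw [show -n-1+1 = -n by ring, neg_sq, show m-1+1=m by ring]; omega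
            have : (2*(m-1)+1)*(2*(-n-1)+1) ∣ H := by
              rcases lt_or_ge (-n-1) (m-1) with hj | hj
              · exact hT.yx (m-1) (-n-1) (by omega) hj e1 e2 e3
              · have hj' : -n-1 = m-1 := by omega
                rw [hj'] at e1 e2 e3 ⊢
                have := mu_unique hT.mu1 hT.mu2 hT.mu0 (m := m-1) (by omega) (by linarith [sq_mono (show 0 ≤ m - 1 by omega)]) (by linarith)
                rw [this]; exact hT.fin
            rw [show (2*(m-1)+1)*(2*n+1) = -((2*(m-1)+1)*(2*(-n-1)+1)) by ring]
            exact (neg_dvd).2 this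
          · rw [hh.1, hh.2, show (2*μ+1)*(2*(-μ-1)+1) = -((2*μ+1)*(2*μ+1)) by ring]
            exact (neg_dvd).2 hT.fin
        rw [← ham, mul_comm] at key
        exact (mul_dvd_mul_iff_left (by omega)).1 key
      · intro _; rw [hDX]; exact dvd_zero _


theorem nextE_spec (e : ℕ) : nextE e ∈ Eset ∧ e < nextE e := by
  have hne : {f | f ∈ Eset ∧ e < f}.Nonempty := by
    refine ⟨(e+1)^2, ⟨(e:ℤ)+1, 0, by push_cast; ring⟩, by nlinarith⟩
  exact Nat.sInf_mem hne

theorem nextE_alt (e : ℕ) (a b : ℤ) :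
    a^2 + b^2 ≤ (e : ℤ) ∨ (nextE e : ℤ) ≤ a^2 + b^2 := by
  rcases le_or_gt (a^2+b^2) (e:ℤ) with h | h
  · exact Or.inl h
  · right
    have h0 : 0 ≤ a^2 + b^2 := by positivity
    obtain ⟨n, hn⟩ := Int.eq_ofNat_of_zero_le h0
    rw [hn] at h ⊢
    have : nextE e ≤ n := Nat.sInf_le ⟨⟨a, b, hn.symm⟩, by exact_mod_cast h⟩
    exact_mod_cast this

theorem Pfun_strictMono {x y : ℝ} (h0 : 0 ≤ x) (h : x < y) : Pfun x < Pfun y := by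
  unfold Pfun
  have a0 : 0 ≤ ⌊x⌋ := Int.floor_nonneg.2 h0
  have a0' : (0:ℝ) ≤ ⌊x⌋ := by exact_mod_cast a0
  have h1 := Int.floor_le x
  have h2 := Int.lt_floor_add_one x
  have h3 := Int.floor_le y
  have h4 := Int.lt_floor_add_one y
  rcases (Int.floor_le_floor h.le).lt_or_eq with hlt | heq
  · have hlt' : (⌊x⌋ : ℝ) + 1 ≤ ⌊y⌋ := by exact_mod_cast hlt
    have e1 : (⌊x⌋ : ℝ)^2 + (2 * ⌊x⌋ + 1) * (x - ⌊x⌋) < (⌊x⌋ + 1)^2 := by nlinarith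
    have e2 : ((⌊x⌋:ℝ) + 1)^2 ≤ (⌊y⌋:ℝ)^2 := by nlinarith
    have e3 : (0:ℝ) ≤ (2 * (⌊y⌋:ℝ) + 1) * (y - ⌊y⌋) := by
      apply mul_nonneg <;> linarith
    linarith
  · rw [← heq]
    nlinarith

theorem Pfun_inv {n : ℤ} (n0 : 0 ≤ n) {c : ℝ} (h1 : (n:ℝ)^2 < c) (h2 : c < ((n:ℝ)+1)^2) :
    ∃ x : ℝ, (n:ℝ) < x ∧ x < n + 1 ∧ Pfun x = c := by
  have n0' : (0:ℝ) ≤ n := by exact_mod_cast n0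
  have hp : (0:ℝ) < 2 * n + 1 := by linarith
  have g1 : (n:ℝ) < n + (c - (n:ℝ)^2) / (2*n+1) := by
    have : 0 < (c - (n:ℝ)^2) / (2*n+1) := div_pos (by linarith) hp
    linarith
  have g2 : n + (c - (n:ℝ)^2) / (2*n+1) < (n:ℝ) + 1 := by
    have : (c - (n:ℝ)^2) / (2*n+1) < 1 := by
      rw [div_lt_one hp]; nlinarith
    linarith
  refine ⟨n + (c - (n:ℝ)^2) / (2*n+1), g1, g2, ?_⟩
  have : ⌊(n:ℝ) + (c - (n:ℝ)^2) / (2*n+1)⌋ = n := Int.floor_eq_iff.2 ⟨g1.le, g2⟩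
  unfold Pfun
  rw [this]
  field_simp
  ring

theorem Pfun_int {n : ℤ} : Pfun (n:ℝ) = (n:ℝ)^2 := by
  unfold Pfun; simp

theorem not_int_of {x : ℝ} {n : ℤ} (h1 : (n:ℝ) < x) (h2 : x < n + 1) : ¬ ∃ m : ℤ, x = (m:ℝ) := by
  rintro ⟨m, rfl⟩
  have a : n < m := by exact_mod_cast h1
  have b : m < n + 1 := by exact_mod_cast h2
  omega

theorem vtype_h {x y : ℝ} {m : ℤ} (m0 : 0 ≤ m) (h1 : (m:ℝ) < x) (h2 : x < m + 1) :
    (vtype (x, y) : ℤ) = m := by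
  have m0' : (0:ℝ) ≤ m := by exact_mod_cast m0
  unfold vtype
  rw [if_neg (not_int_of h1 h2)]
  simp only
  rw [abs_of_nonneg (by linarith), Int.floor_eq_iff.2 ⟨h1.le, h2⟩]
  omega

theorem vtype_v {k j : ℤ} {y : ℝ} (j0 : 0 ≤ j) (h1 : (j:ℝ) < y) (h2 : y < j + 1) :
    (vtype ((k:ℝ), y) : ℤ) = j := by
  have m0' : (0:ℝ) ≤ j := by exact_mod_cast j0
  unfold vtype
  rw [if_pos ⟨k, rfl⟩]
  simp only
  rw [abs_of_nonneg (by linarith), Int.floor_eq_iff.2 ⟨h1.le, h2⟩]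
  omega

theorem not_delta {x y : ℝ} {m j : ℤ} (h1 : (m:ℝ) < x) (h2 : x < m + 1) (h3 : (j:ℝ) < y)
    (h4 : y < j + 1) : (x, y) ∉ DeltaSet := by
  rintro (h | h)
  · exact not_int_of h1 h2 h
  · exact not_int_of h3 h4 h

theorem ham_anti {w w' : ℝ × ℝ} (h : Ham w = Ham w') (w2 : 0 ≤ w.2) (w1 : 0 ≤ w.1)
    (hx : w.1 < w'.1) : w'.2 < w.2 := by
  unfold Ham at h
  have := Pfun_strictMono w1 hx
  by_contra hc
  push Not at hc
  rcases hc.lt_or_eq with hc | hc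
  · have := Pfun_strictMono w2 hc
    linarith
  · rw [hc] at h; linarith

theorem qseq_dvd_succ (v : ℕ → ℕ) (j : ℕ) : qseq v j ∣ qseq v (j+1) := by
  cases j with
  | zero => simp [qseq]
  | succ j =>
    rw [qseq]
    split_ifs
    · exact dvd_refl _
    · exact Nat.dvd_lcm_right _ _

theorem qseq_dvd (v : ℕ → ℕ) {i j : ℕ} (h : i ≤ j) : qseq v i ∣ qseq v j := by
  induction j, h using Nat.le_induction with
  | base => exact dvd_refl _
  | succ j _ ih => exact ih.trans (qseq_dvd_succ v j)

theorem qseq_odd (v : ℕ → ℕ) (j : ℕ) : Odd (qseq v j) ∧ 0 < qseq v j := by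
  have hodd : ∀ a b : ℕ, Odd a → Odd b → Odd (Nat.lcm a b) := by
    intro a b ha hb
    have h1 : Nat.lcm a b ∣ a * b := Nat.lcm_dvd_mul a b
    exact Odd.of_dvd_nat (ha.mul hb) h1
  have h2 : Odd (qseq v j) := by
    induction j with
    | zero => simp only [qseq]; exact (odd_two_mul_add_one _).pow
    | succ j ih =>
      cases j with
      | zero => simp only [qseq]; exact (odd_two_mul_add_one _).pow
      | succ j =>
        rw [qseq]
        split_ifs
        · exact ih
        · exact hodd _ _ ((odd_two_mul_add_one _).mul (odd_two_mul_add_one _)) ih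
  exact ⟨h2, h2.pos⟩

theorem qval_facts (e : ℕ) (v : ℕ → ℕ) :
    Odd (qval e v) ∧ 0 < qval e v ∧ (2 * v 1 + 1)^2 ∣ qval e v := by
  refine ⟨(qseq_odd _ _).1, (qseq_odd _ _).2, ?_⟩
  have := qseq_dvd (vext e v) (show 1 ≤ 2 * (Nat.sqrt e + 1) - 1 by omega)
  simp only [qseq] at this
  rw [show vext e v 1 = v 1 by simp [vext]] at this
  exact this

theorem qval_consec (e : ℕ) (v : ℕ → ℕ) (i : ℕ) (h1 : 1 ≤ i) (h2 : i + 1 ≤ Nat.sqrt e + 1)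
    (hne : v (i+1) ≠ v i) : (2 * v (i+1) + 1) * (2 * v i + 1) ∣ qval e v := by
  have h := qseq_dvd (vext e v) (show i + 1 ≤ 2 * (Nat.sqrt e + 1) - 1 by omega)
  refine dvd_trans ?_ h
  obtain ⟨t, rfl⟩ : ∃ t, i = t + 1 := ⟨i - 1, by omega⟩
  have e1 : vext e v (t+2) = v (t+2) := by simp only [vext]; rw [if_pos (by omega)]
  have e2 : vext e v (t+1) = v (t+1) := by simp only [vext]; rw [if_pos (by omega)]
  show _ ∣ qseq (vext e v) (t+2)
  rw [qseq, e1, e2, if_neg hne]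
  exact Nat.dvd_lcm_left _ _

/-- two vertices on the boundary of one box are consecutive -/
theorem vl_consec {e : ℕ} {v : ℕ → ℕ} {o : ℕ → Bool} (hv : IsVertexList e v o) {a : ℝ}
    (ha : a ∈ Icrit e) {w1 w2 : ℝ × ℝ} {m j : ℤ} (j0 : 0 ≤ j) (jm : j < m)
    (H1 : Ham w1 = a) (H2 : Ham w2 = a) (D1 : w1 ∈ DeltaSet) (D2 : w2 ∈ DeltaSet)
    (x1 : (m:ℝ) ≤ w1.1) (x2 : w1.1 < w2.1) (x3 : w2.1 ≤ m + 1)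
    (y1 : (j:ℝ) ≤ w2.2) (y3 : w1.2 ≤ j + 1) (y0 : (j:ℝ) ≤ w1.2)
    (ht : vtype w1 ≠ vtype w2) :
    (2 * vtype w2 + 1) * (2 * vtype w1 + 1) ∣ qval e v := by
  obtain ⟨p, hp1, hp2, hp3⟩ := hv a ha
  have j0' : (0:ℝ) ≤ j := by exact_mod_cast j0
  have jm' : (j:ℝ) + 1 ≤ m := by exact_mod_cast jm
  have y2 : w2.2 < w1.2 := ham_anti (H1.trans H2.symm) (by linarith) (by linarith) x2
  obtain ⟨i, i1, i2, rfl⟩ := hp3 w1 H1 D1 (by linarith) (by linarith)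
  obtain ⟨k, k1, k2, rfl⟩ := hp3 w2 H2 D2 (by linarith) (by linarith)
  have hik : i < k := by
    by_contra hc
    rcases (not_lt.1 hc).lt_or_eq with h | h
    · have := hp2 k i k1 h i2; linarith
    · rw [h] at x2; exact lt_irrefl _ x2
  have hk : k = i + 1 := by
    by_contra hc
    have h1 : i + 1 < k := by omega
    have e1 := hp2 i (i+1) i1 (by omega) (by omega)
    have e2 := hp2 (i+1) k (by omega) h1 k2
    obtain ⟨q1, q2, q3, q4, -⟩ := hp1 (i+1) (by omega) (by omega)
    have f1 := ham_anti (H1.trans q1.symm) (by linarith) (by linarith) e1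
    have f2 := ham_anti (q1.trans H2.symm) q3 (by linarith) e2
    exact not_delta (x := (p (i+1)).1) (y := (p (i+1)).2) (m := m) (j := j) (by linarith)
      (by linarith) (by linarith) (by linarith) q2
  subst hk
  rw [(hp1 i i1 i2).2.2.2.2.1, (hp1 (i+1) k1 k2).2.2.2.2.1] at ht ⊢
  exact qval_consec e v i i1 k2 (Ne.symm ht)

theorem ham_pair (x y : ℝ) : Ham (x, y) = Pfun x + Pfun y := rfl

theorem icrit_gap {e : ℕ} {a : ℝ} (ha : a ∈ Icrit e) (x y : ℤ) :
    (x^2 + y^2 ≤ (e:ℤ) → (x:ℝ)^2 + (y:ℝ)^2 < a) ∧ ((e:ℤ) < x^2 + y^2 → a < (x:ℝ)^2 + (y:ℝ)^2) := by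
  constructor
  · intro h
    have : (x:ℝ)^2 + (y:ℝ)^2 ≤ e := by exact_mod_cast h
    exact this.trans_lt ha.1
  · intro h
    have h2 : (nextE e : ℤ) ≤ x^2 + y^2 := (nextE_alt e x y).resolve_left (not_le.2 h)
    have : (nextE e : ℝ) ≤ (x:ℝ)^2 + (y:ℝ)^2 := by exact_mod_cast h2
    exact ha.2.trans_le this

theorem icrit_mem (e : ℕ) : ((e:ℝ) + 1/2) ∈ Icrit e := by
  have := (nextE_spec e).2
  have h : ((e+1 : ℕ):ℝ) ≤ nextE e := by exact_mod_cast this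
  push_cast at h
  constructor <;> linarith

theorem vl_yx {e : ℕ} {v : ℕ → ℕ} {o : ℕ → Bool} (hv : IsVertexList e v o)
    {m j : ℤ} (j0 : 0 ≤ j) (jm : j < m) (c1 : m^2 + (j+1)^2 ≤ (e:ℤ)) (c2 : (m+1)^2 + j^2 ≤ (e:ℤ))
    (c3 : (e:ℤ) < (m+1)^2 + (j+1)^2) : (2*m+1)*(2*j+1) ∣ (qval e v : ℤ) := by
  have ha := icrit_mem e
  set a : ℝ := (e:ℝ) + 1/2
  have g1 := (icrit_gap ha m (j+1)).1 c1
  have g2 := (icrit_gap ha (m+1) j).1 c2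
  have g3 := (icrit_gap ha (m+1) (j+1)).2 c3
  push_cast at g1 g2 g3
  obtain ⟨x, x1, x2, x3⟩ := Pfun_inv (n := m) (c := a - ((j:ℝ)+1)^2) (by omega) (by linarith) (by linarith)
  obtain ⟨y, y1, y2, y3⟩ := Pfun_inv (n := j) (c := a - ((m:ℝ)+1)^2) (by omega) (by linarith) (by linarith)
  have p1 := Pfun_int (n := j+1)
  have p2 := Pfun_int (n := m+1)
  have t1 := vtype_h (y := ((j+1:ℤ):ℝ)) (show 0 ≤ m by omega) x1 x2
  have t2 := vtype_v (k := m+1) j0 y1 y2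
  have := vl_consec hv ha (w1 := (x, ((j+1:ℤ):ℝ))) (w2 := (((m+1:ℤ):ℝ), y)) j0 jm
    (by rw [ham_pair, x3, p1]; push_cast; ring) (by rw [ham_pair, y3, p2]; push_cast; ring)
    (Or.inr ⟨_, rfl⟩) (Or.inl ⟨_, rfl⟩) x1.le (by push_cast; exact x2) (by push_cast; exact le_rfl)
    y1.le (by push_cast; exact le_rfl) (by push_cast; linarith) (by
      intro h
      omega)
  have h2 : ((2 * vtype (((m+1:ℤ):ℝ), y) + 1 : ℕ) : ℤ) * ((2 * vtype (x, ((j+1:ℤ):ℝ)) + 1 : ℕ) : ℤ) ∣ (qval e v : ℤ) := by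
    exact_mod_cast this
  push_cast at h2 t1 t2
  rw [t1, t2] at h2
  rwa [mul_comm]

theorem vl_xy {e : ℕ} {v : ℕ → ℕ} {o : ℕ → Bool} (hv : IsVertexList e v o)
    {m j : ℤ} (j0 : 0 ≤ j) (jm : j < m) (c1 : m^2 + j^2 ≤ (e:ℤ)) (c2 : (e:ℤ) < m^2 + (j+1)^2)
    (c3 : (e:ℤ) < (m+1)^2 + j^2) : (2*m+1)*(2*j+1) ∣ (qval e v : ℤ) := by
  have ha := icrit_mem e
  set a : ℝ := (e:ℝ) + 1/2
  have g1 := (icrit_gap ha m j).1 c1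
  have g2 := (icrit_gap ha m (j+1)).2 c2
  have g3 := (icrit_gap ha (m+1) j).2 c3
  push_cast at g1 g2 g3
  obtain ⟨x, x1, x2, x3⟩ := Pfun_inv (n := m) (c := a - (j:ℝ)^2) (by omega) (by linarith) (by linarith)
  obtain ⟨y, y1, y2, y3⟩ := Pfun_inv (n := j) (c := a - (m:ℝ)^2) (by omega) (by linarith) (by linarith)
  have p1 := Pfun_int (n := j)
  have p2 := Pfun_int (n := m)
  have t1 := vtype_h (y := (j:ℝ)) (show 0 ≤ m by omega) x1 x2
  have t2 := vtype_v (k := m) j0 y1 y2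
  have := vl_consec hv ha (w1 := ((m:ℝ), y)) (w2 := (x, (j:ℝ))) j0 jm
    (by rw [ham_pair, y3, p2]; ring) (by rw [ham_pair, x3, p1]; ring)
    (Or.inl ⟨_, rfl⟩) (Or.inr ⟨_, rfl⟩) le_rfl x1 x2.le
    le_rfl y2.le y1.le (by
      intro h
      omega)
  have h2 : ((2 * vtype (x, (j:ℝ)) + 1 : ℕ) : ℤ) * ((2 * vtype ((m:ℝ), y) + 1 : ℕ) : ℤ) ∣ (qval e v : ℤ) := by
    exact_mod_cast this
  push_cast at h2 t1 t2
  rw [t1, t2] at h2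
  exact h2

theorem exists_mu (e : ℕ) : ∃ μ : ℤ, 0 ≤ μ ∧ 2 * μ^2 ≤ (e:ℤ) ∧ (e:ℤ) < 2 * (μ+1)^2 := by
  refine ⟨Nat.sqrt (e/2), by positivity, ?_, ?_⟩
  · have := Nat.sqrt_le' (e/2)
    zify at this
    have h2 : 2 * ((e:ℤ)/2) ≤ e := by omega
    linarith
  · have := Nat.lt_succ_sqrt' (e/2)
    have h3 : e/2 + 1 ≤ (Nat.sqrt (e/2) + 1)^2 := this
    zify at h3
    have h2 : (e:ℤ) < 2 * ((e:ℤ)/2) + 2 := by omega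
    linarith

theorem vl_first {e : ℕ} {v : ℕ → ℕ} {o : ℕ → Bool} (hv : IsVertexList e v o) {μ : ℤ} (m0 : 0 ≤ μ)
    (h1 : 2 * μ^2 ≤ (e:ℤ)) (h2 : (e:ℤ) < 2 * (μ+1)^2) : (v 1 : ℤ) = μ := by
  have ha := icrit_mem e
  set a : ℝ := (e:ℝ) + 1/2
  have m0' : (0:ℝ) ≤ μ := by exact_mod_cast m0
  obtain ⟨p, hp1, hp2, hp3⟩ := hv a ha
  -- the first vertex
  have key : ∃ w : ℝ × ℝ, Ham w = a ∧ w ∈ DeltaSet ∧ (μ:ℝ) ≤ w.2 ∧ w.2 ≤ w.1 ∧ w.1 ≤ μ + 1 ∧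
      (vtype w : ℤ) = μ := by
    have g1 := (icrit_gap ha μ μ).1 (by linarith)
    have g2 := (icrit_gap ha (μ+1) (μ+1)).2 (by linarith)
    push_cast at g2
    rcases lt_or_ge (e:ℤ) ((μ+1)^2 + μ^2) with hc | hc
    · have g3 := (icrit_gap ha (μ+1) μ).2 hc
      push_cast at g3
      obtain ⟨x, x1, x2, x3⟩ := Pfun_inv (n := μ) (c := a - (μ:ℝ)^2) m0 (by linarith) (by linarith)
      refine ⟨(x, (μ:ℝ)), by rw [ham_pair, x3, Pfun_int]; ring, Or.inr ⟨_, rfl⟩, le_rfl, x1.le, x2.le,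
        vtype_h m0 x1 x2⟩
    · have g3 := (icrit_gap ha (μ+1) μ).1 hc
      push_cast at g3
      obtain ⟨y, y1, y2, y3⟩ := Pfun_inv (n := μ) (c := a - ((μ:ℝ)+1)^2) m0 (by linarith) (by linarith)
      refine ⟨(((μ+1:ℤ):ℝ), y), by rw [ham_pair, y3, Pfun_int]; push_cast; ring, Or.inl ⟨_, rfl⟩, y1.le,
        by push_cast; exact y2.le, by push_cast; exact le_rfl, vtype_v m0 y1 y2⟩
  obtain ⟨w, w1, w2, w3, w4, w5, w6⟩ := key
  obtain ⟨i, i1, i2, rfl⟩ := hp3 w w1 w2 (by linarith) w4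
  rcases i1.lt_or_eq with hi | hi
  · exfalso
    have e1 := hp2 1 i le_rfl hi i2
    obtain ⟨q1, q2, q3, q4, -⟩ := hp1 1 le_rfl (by omega)
    have e2 := ham_anti (q1.trans w1.symm) q3 (by linarith) e1
    exact not_delta (x := (p 1).1) (y := (p 1).2) (m := μ) (j := μ) (by linarith)
      (by linarith) (by linarith) (by linarith) q2
  · subst hi
    rw [(hp1 1 le_rfl i2).2.2.2.2.1] at w6
    exact w6

theorem turnDvd_of {e : ℕ} {v : ℕ → ℕ} {o : ℕ → Bool} (hv : IsVertexList e v o) {H : ℤ}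
    (hH : (qval e v : ℤ) ∣ H) : TurnDvd e (v 1) H := by
  obtain ⟨μ, m0, h1, h2⟩ := exists_mu e
  have h3 := vl_first hv m0 h1 h2
  rw [h3]
  refine ⟨fun m j a b c d f => (vl_yx hv a b c d f).trans hH,
    fun m j a b c d f => (vl_xy hv a b c d f).trans hH, ?_, h1, h2, m0⟩
  refine dvd_trans ?_ hH
  have := (qval_facts e v).2.2
  have h4 : ((2 * v 1 + 1 : ℕ):ℤ)^2 ∣ (qval e v : ℤ) := by exact_mod_cast this
  push_cast at h4
  rw [h3] at h4
  rw [← sq]; exact h4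


theorem FC.nonneg {f C : ℤ → ℤ} {G : ℤ} (h : FC f C G) {X : ℤ} : 0 ≤ f X ↔ 0 ≤ X := by
  rw [h.iff, h.zero]

theorem FC.neg {f C : ℤ → ℤ} {G : ℤ} (h : FC f C G) {X : ℤ} : f X < 0 ↔ X < 0 := by
  rw [h.lt, h.zero]

theorem FC.mulG {f C : ℤ → ℤ} {G : ℤ} (h : FC f C G) {k : ℤ} (hk : 0 ≤ k) : G * k ≤ C k := by
  induction k, hk using Int.leInduction with
  | base => rw [h.zero]; simp
  | succ k _ ih => have := h.gap k; linarith

/-- `G f(X) ≤ X` -/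
theorem FC.small {f C : ℤ → ℤ} {G : ℤ} (h : FC f C G) {X : ℤ} (hX : 0 ≤ X) : G * f X ≤ X :=
  (h.mulG (h.nonneg.2 hX)).trans (h.low X)

theorem FC.fzero {f C : ℤ → ℤ} {G : ℤ} (h : FC f C G) {X : ℤ} (hX : 0 ≤ X) (hG : X < G) : f X = 0 := by
  apply h.eq
  · rw [h.zero]; exact hX
  · have := h.gap 0
    rw [h.zero] at this; omega

/-- basic step in the quarter plane -/
theorem qstep {f C : ℤ → ℤ} {G K X Y : ℤ} (h : FC f C G) (hG : 10 * K + 20 ≤ G)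
    (X0 : 0 ≤ X) (Yf : f X < Y) (fX : f X ≤ K) (fY : f Y ≤ K) :
    (F4 f (X, Y)).2 ≤ Y - (2 * f X + 1) ∧ Y - (2 * f X + 2) ≤ (F4 f (X, Y)).2 ∧
    X ≤ (F4 f (X, Y)).1 ∧ (F4 f (X, Y)).1 ≤ X + (2 * f Y + 1) ∧
    (0 ≤ (F4 f (X, Y)).2 → X + 1 ≤ (F4 f (X, Y)).1) ∧ f (f X - Y) < 0 ∧
    (X + K + 2 ≤ G → (F4 f (X, Y)).2 = Y - 1) := by
  have a0 : 0 ≤ f X := h.nonneg.2 X0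
  have b0 : 0 ≤ f Y := h.nonneg.2 (by omega)
  set a := f X with ha
  set n := f Y with hn
  have g0 := h.low X
  have g1 := h.high X
  have g2 := h.low Y
  have g3 := h.high Y
  rw [← ha] at g0 g1
  rw [← hn] at g2 g3
  have n1 := h.neg2 (n+1)
  have n2 := h.neg1 n
  have n3 := h.gap (-n)
  have n4 := h.neg1 a
  have n5 := h.neg2 (a+1)
  have n6 := h.gap (-a-2)
  have n7 := h.gap (-1)
  have hz := h.zero
  rw [show -a - 2 + 1 = -(a+1) by ring] at n6
  norm_num at n7
  have e2 : f (a - Y) < 0 := h.neg.2 (by omega)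
  have e2l : -(n+1) ≤ f (a - Y) := by rw [h.iff]; omega
  have e2u : f (a - Y) < -n + 1 := by rw [h.lt]; omega
  have e3 : f (f (a - Y) - X) < -a := by rw [h.lt]; omega
  have e3l : -a - 2 ≤ f (f (a - Y) - X) := by rw [h.iff]; omega
  have e4u : f (Y + f (f (a - Y) - X) - a) ≤ n := by
    rw [hn]; exact h.mono (by omega)
  have e4l : -1 ≤ f (Y + f (f (a - Y) - X) - a) := by rw [h.iff]; omega
  rw [F4_eq f X Y ha.symm rfl rfl rfl]
  refine ⟨by simp only; omega, by simp only; omega, by simp only; omega, by simp only; omega, ?_, e2, ?_⟩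
  · intro hh
    simp only at hh ⊢
    have := h.nonneg.2 hh
    omega
  · intro hh
    have a00 : a = 0 := h.fzero X0 (by omega)
    have : -1 ≤ f (f (a - Y) - X) := by rw [h.iff]; omega
    simp only
    omega

def dI (p : ℤ × ℤ) : ℤ := |p.1 - p.2|

def XI (f : ℤ → ℤ) (p : ℤ × ℤ) : Prop :=
  0 ≤ p.1 ∧ 0 ≤ p.2 ∧ dI p ≤ dI (F4 f p) ∧ dI p < dI (F4 f p.swap)

theorem not_XI {f C : ℤ → ℤ} {G K X Y : ℤ} (h : FC f C G) (hG : 10 * K + 20 ≤ G)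
    (Yf : Y ≤ f X) (X1 : 1 ≤ X) (fX : f X ≤ K) : ¬ XI f (X, Y) := by
  rintro ⟨-, Y0, -, h4⟩
  simp only [Prod.swap_prod_mk] at h4 Y0
  have s1 := h.small (X := X) (by omega)
  have a0 : 0 ≤ f X := h.nonneg.2 (by omega)
  have y0 : f Y = 0 := h.fzero Y0 (by omega)
  have hlt : f Y < X := by omega
  obtain ⟨q1, q2, q3, q4, -, -, q7⟩ := qstep h hG Y0 hlt (by omega) fX
  have q8 := q7 (by omega)
  have : dI (F4 f (Y, X)) ≤ dI (X, Y) := by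
    unfold dI
    have e1 : X - Y = |X - Y| := by
      rw [abs_of_nonneg]
      nlinarith
    simp only
    rw [← e1, abs_le]
    constructor
    · nlinarith
    · nlinarith
  omega

/-- a nonzero point of the return domain -/
theorem XI_Q {f C : ℤ → ℤ} {G K X Y : ℤ} (h : FC f C G) (hG : 10 * K + 20 ≤ G)
    (fX : f X ≤ K) (fY : f Y ≤ K) (hx : XI f (X, Y)) (hne : ¬ (X = 0 ∧ Y = 0)) :
    1 ≤ X ∧ f X < Y := by
  have X0 : 0 ≤ X := hx.1
  have Y0 : 0 ≤ Y := hx.2.1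
  have K0 : 0 ≤ K := (h.nonneg.2 X0).trans fX
  have X1 : 1 ≤ X := by
    by_contra hc
    have : X = 0 := by omega
    subst this
    have f0 : f 0 = 0 := h.fzero le_rfl (by omega)
    obtain ⟨q1, q2, q3, q4, -, -, q7⟩ := qstep (Y := Y) h hG le_rfl (by omega) fX fY
    have q8 := q7 (by omega)
    have s1 := h.small Y0
    have b0 : 0 ≤ f Y := h.nonneg.2 Y0
    rcases (show Y = 1 ∨ 2 ≤ Y by omega) with y1 | y1
    · subst y1
      have h4 := hx.2.2.2
      simp only [Prod.swap_prod_mk] at h4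
      have f1 : f 1 = 0 := h.fzero (by omega) (by omega)
      have g1 := h.gap (-1)
      have hz := h.zero
      norm_num at g1
      have fm : f (-1) = -1 := h.eq (by omega) (by norm_num; omega)
      rw [F4_eq f 1 0 f1 (by simpa using f0) (a3 := -1) (by simpa using fm) (a4 := -1) (by simpa using fm)] at h4
      simp [dI] at h4
    · have h3 := hx.2.2.1
      unfold dI at h3
      simp only at h3
      have e1 : |(0:ℤ) - Y| = Y := by rw [abs_of_nonpos] <;> omega
      rw [e1] at h3
      have : |(F4 f (0, Y)).1 - (F4 f (0, Y)).2| < Y := by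
        rw [abs_lt]; constructor
        · omega
        · nlinarith
      omega
  refine ⟨X1, ?_⟩
  by_contra hc
  exact not_XI h hG (by omega) X1 fX hx

theorem iter_four (f : ℤ → ℤ) (p : ℤ × ℤ) (i : ℕ) : (FI f)^[4 * (i+1)] p = F4 f ((FI f)^[4 * i] p) := by
  rw [show 4 * (i+1) = 4 + 4 * i by ring, Function.iterate_add_apply]
  rfl

theorem iter_comm (f : ℤ → ℤ) (p : ℤ × ℤ) : FI f (F4 f p) = F4 f (FI f p) := rfl

theorem F4inv_swap {f : ℤ → ℤ} (p : ℤ × ℤ) : F4 f (F4 f p).swap = p.swap := by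
  have key : ∀ q : ℤ × ℤ, FI f (FI f q).swap = q.swap := by
    rintro ⟨a, b⟩
    simp [FI]
  unfold F4
  rw [key, key, key, key]


theorem phase1 {f C : ℤ → ℤ} {G K K0 B : ℤ} (h : FC f C G) (hG : 20 * K + 60 ≤ G) (K00 : 0 ≤ K0)
    (hKK : K0 ≤ K)
    {z : ℕ → ℤ × ℤ} (hz : ∀ i, z (i+1) = F4 f (z i)) (x0 : 1 ≤ (z 0).1) (q0 : f (z 0).1 < (z 0).2)
    (fy : f (z 0).2 ≤ K0) (hB : (z 0).1 + (2 * K0 + 1) * (z 0).2 = B) (fB : f B ≤ K) :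
    ∃ i0 : ℕ, 1 ≤ i0 ∧
      (∀ i, i < i0 → f (z i).1 < (z i).2 ∧ 1 ≤ (z i).1 ∧ f (z i).1 ≤ K ∧ f (z i).2 ≤ K) ∧
      (z i0).2 ≤ f (z i0).1 ∧ 1 ≤ (z i0).1 ∧ (z i0).1 ≤ B ∧ f (z i0).1 - (z i0).2 ≤ 2 * K + 1 ∧
      ((2 ≤ (z i0).1 ∧ f (z i0).1 - (z i0).2 = 0) ∨ G - K - 1 ≤ (z i0).1) := by
  have hfB : ∀ x, x ≤ B → f x ≤ K := fun x hx => (h.mono hx).trans fB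
  have Kp : 0 ≤ K := by omega
  have inv : ∀ i : ℕ, (∀ j, j < i → f (z j).1 < (z j).2) →
      1 ≤ (z i).1 ∧ (z i).1 ≤ (z 0).1 + (2*K0+1) * i ∧ (z i).2 ≤ (z 0).2 - i ∧ (i:ℤ) ≤ (z 0).2 := by
    intro i
    induction i with
    | zero =>
      intro _
      have := h.nonneg.2 (show 0 ≤ (z 0).1 by omega)
      simp; omega
    | succ i ih =>
      intro hq
      obtain ⟨i1, i2, i3, i4⟩ := ih (fun j hj => hq j (by omega))
      have qi := hq i (by omega)
      have a0 := h.nonneg.2 (show 0 ≤ (z i).1 by omega)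
      have fyi : f (z i).2 ≤ K0 := (h.mono (by omega)).trans fy
      have fxi : f (z i).1 ≤ K := hfB _ (by rw [← hB]; nlinarith)
      obtain ⟨s1, s2, s3, s4, -, -, -⟩ := qstep h (K := K) (by omega) (by omega) qi fxi (by omega)
      rw [Prod.mk.eta, ← hz] at s1 s2 s3 s4
      push_cast
      refine ⟨by omega, by nlinarith, by omega, by omega⟩
  have bnd : ∀ i : ℕ, (∀ j, j < i → f (z j).1 < (z j).2) → (z i).1 ≤ B := by
    intro i hi
    obtain ⟨i1, i2, i3, i4⟩ := inv i hi
    rw [← hB]; nlinarith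
  have hex : ∃ i : ℕ, (z i).2 ≤ f (z i).1 := by
    by_contra hc
    push Not at hc
    have := (inv ((z 0).2.toNat + 1) (fun j _ => hc j)).2.2.2
    push_cast at this
    omega
  have hs := Nat.find_spec hex
  have hm : ∀ i, i < Nat.find hex → f (z i).1 < (z i).2 := fun i hi => not_le.1 (Nat.find_min hex hi)
  set i0 := Nat.find hex
  have hi0 : 1 ≤ i0 := by
    by_contra hc
    have : i0 = 0 := by omega
    rw [this] at hs; omega
  have qall : ∀ i, i < i0 → f (z i).1 < (z i).2 ∧ 1 ≤ (z i).1 ∧ f (z i).1 ≤ K ∧ f (z i).2 ≤ K := by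
    intro i hi
    have hj : ∀ j, j < i → f (z j).1 < (z j).2 := fun j hj => hm j (by omega)
    obtain ⟨i1, i2, i3, i4⟩ := inv i hj
    exact ⟨hm i hi, i1, hfB _ (bnd i hj), ((h.mono (by omega)).trans fy).trans hKK⟩
  refine ⟨i0, hi0, qall, hs, (inv i0 hm).1, bnd i0 hm, ?_⟩
  obtain ⟨t, ht⟩ : ∃ t, i0 = t + 1 := ⟨i0 - 1, by omega⟩
  obtain ⟨r1, r2, r3, r4⟩ := qall t (by omega)
  obtain ⟨s1, s2, s3, s4, s5, -, s7⟩ := qstep h (K := K) (by omega) (by omega) r1 r3 r4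
  rw [Prod.mk.eta, ← hz] at s1 s2 s3 s4 s5 s7
  have b := hfB _ (bnd i0 hm)
  rw [ht] at hs b ⊢
  have a0 := h.nonneg.2 (show 0 ≤ (z t).1 by omega)
  refine ⟨by omega, ?_⟩
  by_cases hc : G - K - 1 ≤ (z (t+1)).1
  · exact Or.inr hc
  · left
    have := s7 (by omega)
    have f0 : f (z (t+1)).1 = 0 := h.fzero (by omega) (by omega)
    have := s5 (by omega)
    omega

/-- the difference of coordinates -/
def uu (p : ℤ × ℤ) : ℤ := p.1 - p.2

theorem phase2 {f C : ℤ → ℤ} {G K B : ℤ} (h : FC f C G) (hG : 20 * K + 60 ≤ G) (Kp : 0 ≤ K)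
    {q : ℕ → ℤ × ℤ} (hq : ∀ i, q (i+1) = F4 f (q i)) (x0 : 0 ≤ (q 0).1) (x1 : (q 0).1 ≤ 2 * K + 1)
    (y1 : (q 0).2 ≤ B) (fB : f B ≤ K)
    (hs : (2 ≤ (q 0).2 ∧ (q 0).1 = 0) ∨ G - K - 1 ≤ (q 0).2) :
    ∃ T : ℕ, 1 ≤ T ∧
      (∀ i, i < T → f (q i).1 < (q i).2 ∧ 0 ≤ (q i).1 ∧ f (q i).1 ≤ K ∧ f (q i).2 ≤ K ∧
        uu (q i) < 0 ∧ uu (q i) < uu (q (i+1)) ∧ uu (q i) + uu (q (i+1)) < 0) ∧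
      f (q T).1 < (q T).2 ∧ 0 ≤ (q T).1 ∧ f (q T).1 ≤ K + 1 ∧ f (q T).2 ≤ K ∧
      uu (q T) < uu (q (T+1)) ∧ 0 ≤ uu (q T) + uu (q (T+1)) := by
  have hfB : ∀ x, x ≤ B → f x ≤ K := fun x hx => (h.mono hx).trans fB
  unfold uu
  have G' : 10 * (K+1) + 20 ≤ G := by omega
  have stp : ∀ i : ℕ, f (q i).1 < (q i).2 → 0 ≤ (q i).1 → f (q i).1 ≤ K + 1 → (q i).2 ≤ (q 0).2 →
      (q (i+1)).2 ≤ (q i).2 - (2 * f (q i).1 + 1) ∧ (q i).2 - (2 * f (q i).1 + 2) ≤ (q (i+1)).2 ∧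
      (q i).1 ≤ (q (i+1)).1 ∧ (q (i+1)).1 ≤ (q i).1 + (2 * f (q i).2 + 1) ∧
      (0 ≤ (q (i+1)).2 → (q i).1 + 1 ≤ (q (i+1)).1) ∧
      ((q i).1 + (K+1) + 2 ≤ G → (q (i+1)).2 = (q i).2 - 1) ∧ 0 ≤ f (q i).1 ∧ f (q i).2 ≤ K := by
    intro i a b c d
    have e : f (q i).2 ≤ K := hfB _ (by omega)
    obtain ⟨s1, s2, s3, s4, s5, -, s7⟩ := qstep h G' b a c (by omega)
    rw [Prod.mk.eta, ← hq] at s1 s2 s3 s4 s5 s7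
    exact ⟨s1, s2, s3, s4, s5, s7, h.nonneg.2 b, e⟩
  have f0 : f (q 0).1 = 0 := h.fzero x0 (by omega)
  have inv : ∀ i : ℕ, (∀ j, j < i → ((q j).1 - (q j).2) + ((q (j+1)).1 - (q (j+1)).2) < 0) →
      f (q i).1 < (q i).2 ∧ 0 ≤ (q i).1 ∧ f (q i).1 ≤ K + 1 ∧ (q i).2 ≤ (q 0).2 ∧
      (q 0).1 - (q 0).2 + i ≤ (q i).1 - (q i).2 := by
    intro i
    induction i with
    | zero => intro _; refine ⟨by omega, by omega, by omega, le_rfl, by simp⟩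
    | succ i ih =>
      intro hj
      obtain ⟨i1, i2, i3, i4, i5⟩ := ih (fun j h1 => hj j (by omega))
      have hS := hj i (by omega)
      obtain ⟨s1, s2, s3, s4, s5, s6, s7, s8⟩ := stp i i1 i2 i3 i4
      have hx : f (q i).1 ≤ K := hfB _ (by omega)
      have g1 := h.high (q i).1
      have g2 := h.gap (f (q i).1 + 1)
      have fx' : f (q (i+1)).1 < f (q i).1 + 1 + 1 := by rw [h.lt]; omega
      have sm := h.small (show 0 ≤ (q (i+1)).1 by omega)
      have a0 := h.nonneg.2 (show 0 ≤ (q (i+1)).1 by omega)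
      refine ⟨?_, by omega, by omega, by omega, by push_cast; omega⟩
      rcases (show f (q (i+1)).1 = 0 ∨ 1 ≤ f (q (i+1)).1 by omega) with c | c
      · rw [c]
        by_cases hc : (q i).1 + (K+1) + 2 ≤ G
        · have := s6 hc
          by_contra hn
          have : (q i).2 = 1 := by omega
          have := s5 (by omega)
          omega
        · omega
      · nlinarith
  have hS0 : ((q 0).1 - (q 0).2) + ((q 1).1 - (q 1).2) < 0 := by
    obtain ⟨i1, i2, i3, i4, i5⟩ := inv 0 (fun j hj => absurd hj (by omega))
    obtain ⟨s1, s2, s3, s4, s5, s6, s7, s8⟩ := stp 0 i1 i2 i3 i4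
    simp only [zero_add] at s1 s2 s3 s4 s5 s6
    have sm := h.small (show 0 ≤ (q 0).2 by omega)
    have b0 := h.nonneg.2 (show 0 ≤ (q 0).2 by omega)
    rcases hs with hs | hs
    · have := s6 (by omega)
      nlinarith
    · omega
  have hex : ∃ i : ℕ, ¬ (((q i).1 - (q i).2) + ((q (i+1)).1 - (q (i+1)).2) < 0) := by
    by_contra hc
    push Not at hc
    have a := (inv ((q 0).2 - (q 0).1).toNat (fun j _ => hc j)).2.2.2.2
    have b := (inv (((q 0).2 - (q 0).1).toNat + 1) (fun j _ => hc j)).2.2.2.2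
    have c := hc ((q 0).2 - (q 0).1).toNat
    push_cast at a b
    omega
  have hT := Nat.find_spec hex
  have hm : ∀ i, i < Nat.find hex → ((q i).1 - (q i).2) + ((q (i+1)).1 - (q (i+1)).2) < 0 :=
    fun i hi => not_not.1 (Nat.find_min hex hi)
  set T := Nat.find hex
  refine ⟨T, ?_, ?_, ?_⟩
  · by_contra hc
    have : T = 0 := by omega
    rw [this] at hT
    exact hT hS0
  · intro i hi
    obtain ⟨i1, i2, i3, i4, i5⟩ := inv i (fun j hj => hm j (by omega))
    obtain ⟨s1, s2, s3, s4, s5, s6, s7, s8⟩ := stp i i1 i2 i3 i4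
    have := hm i hi
    exact ⟨i1, i2, hfB _ (by omega), s8, by omega, by omega, this⟩
  · obtain ⟨i1, i2, i3, i4, i5⟩ := inv T (fun j hj => hm j hj)
    obtain ⟨s1, s2, s3, s4, s5, s6, s7, s8⟩ := stp T i1 i2 i3 i4
    exact ⟨i1, i2, i3, s8, by omega, by omega⟩


/-- the sampled orbit -/
def zs (f : ℤ → ℤ) (p : ℤ × ℤ) (i : ℕ) : ℤ × ℤ := (FI f)^[4 * i] p

theorem zs_succ (f : ℤ → ℤ) (p : ℤ × ℤ) (i : ℕ) : zs f p (i+1) = F4 f (zs f p i) := iter_four f p i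

/-- structure of the return orbit -/
structure Ret (f : ℤ → ℤ) (K : ℤ) (p : ℤ × ℤ) (i0 T : ℕ) : Prop where
  i0p : 1 ≤ i0
  i0T : i0 < T
  ph1 : ∀ i, i < i0 → f (zs f p i).1 < (zs f p i).2 ∧ 1 ≤ (zs f p i).1 ∧ f (zs f p i).1 ≤ K ∧
    f (zs f p i).2 ≤ K
  ph2 : ∀ i, i0 ≤ i → i < T → f (FI f (zs f p i)).1 < (FI f (zs f p i)).2 ∧ 0 ≤ (FI f (zs f p i)).1 ∧
    f (FI f (zs f p i)).1 ≤ K ∧ f (FI f (zs f p i)).2 ≤ K ∧ uu (FI f (zs f p i)) < 0 ∧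
    uu (FI f (zs f p i)) < uu (FI f (zs f p (i+1))) ∧
    uu (FI f (zs f p i)) + uu (FI f (zs f p (i+1))) < 0
  t1 : f (FI f (zs f p T)).1 < (FI f (zs f p T)).2
  t2 : 0 ≤ (FI f (zs f p T)).1
  t3 : f (FI f (zs f p T)).1 ≤ K + 1
  t4 : f (FI f (zs f p T)).2 ≤ K
  notin : ∀ k, 1 ≤ k → k < 4 * T + 1 → ¬ XI f ((FI f)^[k] p)
  isin : XI f (FI f (zs f p T))

theorem ret_exists {f C : ℤ → ℤ} {G K K0 : ℤ} {p : ℤ × ℤ} (h : FC f C G) (hG : 20 * K + 60 ≤ G)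
    (hKK : K0 ≤ K) (hp : XI f p) (hne : ¬ (p.1 = 0 ∧ p.2 = 0))
    (fx : f p.1 ≤ K0) (fy : f p.2 ≤ K0) (fB : f (p.1 + (2 * K0 + 1) * p.2) ≤ K) :
    ∃ i0 T, Ret f K p i0 T := by
  have K00 : 0 ≤ K0 := (h.nonneg.2 hp.1).trans fx
  obtain ⟨x1, q0⟩ := XI_Q h (K := K) (X := p.1) (Y := p.2) (by omega) (by omega) (by omega) hp hne
  obtain ⟨i0, i0p, ph1, e1, e2, e3, e4, e5⟩ := phase1 h hG K00 hKK (z := zs f p) (zs_succ f p)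
    x1 q0 fy rfl fB
  obtain ⟨T, T1, ph2, t1, t2, t3, t4, t5, t6⟩ := phase2 h hG (K00.trans hKK)
    (q := fun i => FI f (zs f p (i0 + i))) (B := p.1 + (2 * K0 + 1) * p.2)
    (fun i => by rw [← iter_comm, ← zs_succ]; rfl)
    (by simp only [FI, add_zero]; omega) (by simp only [FI, add_zero]; omega)
    (by simp only [FI, add_zero]; exact e3) fB (by simp only [FI, add_zero]; omega)
  have ph2' : ∀ i, i0 ≤ i → i < i0 + T → f (FI f (zs f p i)).1 < (FI f (zs f p i)).2 ∧ 0 ≤ (FI f (zs f p i)).1 ∧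
    f (FI f (zs f p i)).1 ≤ K ∧ f (FI f (zs f p i)).2 ≤ K ∧ uu (FI f (zs f p i)) < 0 ∧
    uu (FI f (zs f p i)) < uu (FI f (zs f p (i+1))) ∧
    uu (FI f (zs f p i)) + uu (FI f (zs f p (i+1))) < 0 := by
    intro i hi hi2
    obtain ⟨t, rfl⟩ : ∃ t, i = i0 + t := ⟨i - i0, by omega⟩
    exact ph2 t (by omega)
  rw [← add_assoc] at t5 t6
  -- phase one: distances
  have dst : ∀ i, i < i0 → dI (zs f p i) ≤ dI (zs f p (i+1)) ∧ 0 < uu (zs f p (i+1)) := by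
    have up : ∀ i, i < i0 → uu (zs f p i) < uu (zs f p (i+1)) := by
      intro i hi
      obtain ⟨r1, r2, r3, r4⟩ := ph1 i hi
      obtain ⟨s1, s2, s3, s4, -, -, -⟩ := qstep h (K := K) (by omega) (by omega) r1 r3 r4
      rw [Prod.mk.eta, ← zs_succ] at s1 s2 s3 s4
      have a0 := h.nonneg.2 (show 0 ≤ (zs f p i).1 by omega)
      unfold uu; omega
    intro i
    induction i with
    | zero =>
      intro hi
      have a := hp.2.2.1
      have b := up 0 hi
      have c : zs f p (0+1) = F4 f p := zs_succ f p 0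
      have d : zs f p 0 = p := rfl
      rw [c, d] at b ⊢
      refine ⟨a, ?_⟩
      unfold uu at b ⊢
      unfold dI at a
      by_contra hc
      rw [abs_of_nonpos (by omega : (F4 f p).1 - (F4 f p).2 ≤ 0),
        abs_of_nonpos (by omega : p.1 - p.2 ≤ 0)] at a
      omega
    | succ i ih =>
      intro hi
      have a := (ih (by omega)).2
      have b := up (i+1) hi
      refine ⟨?_, by omega⟩
      unfold uu at a b
      unfold dI
      rw [abs_of_nonneg (by omega), abs_of_nonneg (by omega)]; omega
  refine ⟨i0, i0 + T, i0p, by omega, ph1, ph2', t1, t2, t3, t4, ?_, ?_⟩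
  · intro k k1 k2
    have it : ∀ (r : ℕ) (i : ℕ), (FI f)^[4 * i + r] p = (FI f)^[r] (zs f p i) := by
      intro r i
      rw [add_comm, Function.iterate_add_apply]; rfl
    obtain ⟨i, r, hr, rfl⟩ : ∃ i r, r < 4 ∧ k = 4 * i + r := ⟨k / 4, k % 4, by omega, by omega⟩
    rw [it]
    have hi4 : i < i0 + T ∨ (i = i0 + T ∧ r = 0) := by omega
    rcases (show r = 0 ∨ (r = 1 ∧ i < i0 + T) ∨ (r = 2 ∧ i < i0 + T) ∨ (r = 3 ∧ i < i0 + T) by omega) with rfl | ⟨rfl, hi⟩ | ⟨rfl, hi⟩ | ⟨rfl, hi⟩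
    · -- points of the sampled orbit
      simp only [Function.iterate_zero, id]
      obtain ⟨t, rfl⟩ : ∃ t, i = t + 1 := ⟨i - 1, by omega⟩
      rcases lt_or_ge t i0 with ht | ht
      · intro hX
        have a := (dst t ht).1
        have b := hX.2.2.2
        have c : F4 f (zs f p (t+1)).swap = (zs f p t).swap := by
          rw [zs_succ]; exact F4inv_swap _
        rw [c] at b
        have d : dI (zs f p t).swap = dI (zs f p t) := by
          unfold dI; simp [abs_sub_comm]
        omega
      · have key : 0 ≤ (FI f (zs f p (t+1))).1 ∧ 1 ≤ (FI f (zs f p (t+1))).2 ∧ f (FI f (zs f p (t+1))).2 ≤ K := by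
          rcases hi4 with hi | ⟨hi, -⟩
          · obtain ⟨a, b, c, d, -⟩ := ph2' (t+1) (by omega) hi
            have := h.nonneg.2 b
            exact ⟨b, by omega, d⟩
          · rw [hi]
            have := h.nonneg.2 t2
            exact ⟨t2, by omega, t4⟩
        simp only [FI] at key
        exact not_XI h (K := K) (X := (zs f p (t+1)).1) (Y := (zs f p (t+1)).2) (by omega) (by omega) key.2.1 key.2.2
    · simp only [Function.iterate_one]
      rcases lt_or_ge i i0 with ht | ht
      · intro hX
        have := (ph1 i ht).1
        have := hX.1
        simp only [FI] at this
        omega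
      · intro hX
        obtain ⟨a, b, c, d, e, g, l⟩ := ph2' i ht hi
        have := hX.2.2.1
        rw [← iter_comm, ← zs_succ] at this
        have e' := e; have g' := g; have l' := l
        unfold uu at e g l
        have : dI (FI f (zs f p (i+1))) < dI (FI f (zs f p i)) := by
          unfold dI
          rw [abs_of_nonpos (by omega : (FI f (zs f p i)).1 - (FI f (zs f p i)).2 ≤ 0), abs_lt]
          omega
        omega
    · show ¬ XI f (FI f (FI f (zs f p i)))
      rcases lt_or_ge i i0 with ht | ht
      · intro hX
        have := (ph1 i ht).1
        have := hX.2.1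
        simp only [FI] at this
        omega
      · intro hX
        have := (ph2' i ht hi).1
        have := hX.1
        simp only [FI] at *
        omega
    · show ¬ XI f (FI f (FI f (FI f (zs f p i))))
      rcases lt_or_ge i i0 with ht | ht
      · intro hX
        obtain ⟨r1, r2, r3, r4⟩ := ph1 i ht
        have := hX.2.1
        simp only [FI] at this
        have : f (f (zs f p i).1 - (zs f p i).2) < 0 := h.neg.2 (by omega)
        omega
      · intro hX
        have := (ph2' i ht hi).1
        have := hX.2.1
        simp only [FI] at *
        omega
  · have hT0 : 1 ≤ i0 + T := by omega
    obtain ⟨t, ht⟩ : ∃ t, i0 + T = t + 1 := ⟨i0 + T - 1, by omega⟩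
    obtain ⟨a, b, c, d, e, g, l⟩ := ph2' t (by omega) (by omega)
    rw [ht] at t1 t2 t3 t4 t5 t6 ⊢
    have a0 := h.nonneg.2 t2
    refine ⟨t2, by omega, ?_, ?_⟩
    · rw [← iter_comm, ← zs_succ]
      unfold uu at t5 t6
      unfold dI
      rw [abs_of_nonneg (by omega : 0 ≤ (FI f (zs f p (t+1+1))).1 - (FI f (zs f p (t+1+1))).2), abs_le]
      omega
    · have c : F4 f (FI f (zs f p (t+1))).swap = (FI f (zs f p t)).swap := by
        rw [zs_succ, iter_comm]; exact F4inv_swap _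
      rw [c]
      unfold uu at e g l
      unfold dI
      simp only [Prod.fst_swap, Prod.snd_swap]
      rw [abs_of_nonneg (by omega : 0 ≤ (FI f (zs f p t)).2 - (FI f (zs f p t)).1), abs_lt]
      omega


theorem Fl_emb (lam : ℝ) (p : ℤ × ℤ) : Fl lam (emb lam p) = emb lam (FI (fl lam) p) := by
  unfold Fl emb FI fl
  simp only [Prod.mk.injEq, and_true]
  push_cast; ring

theorem Flinv_emb (lam : ℝ) (p : ℤ × ℤ) :
    Flinv lam (emb lam p) = emb lam (FI (fl lam) p.swap).swap := by
  unfold Flinv emb FI fl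
  simp only [Prod.swap, Prod.mk.injEq, true_and]
  push_cast; ring

theorem Fl_iter_emb (lam : ℝ) (k : ℕ) (p : ℤ × ℤ) :
    (Fl lam)^[k] (emb lam p) = emb lam ((FI (fl lam))^[k] p) := by
  induction k with
  | zero => rfl
  | succ k ih => rw [Function.iterate_succ_apply', ih, Fl_emb, Function.iterate_succ_apply' (FI (fl lam))]

theorem Flinv_four_emb (lam : ℝ) (p : ℤ × ℤ) :
    (Flinv lam)^[4] (emb lam p) = emb lam (F4 (fl lam) p.swap).swap := by
  show Flinv lam (Flinv lam (Flinv lam (Flinv lam (emb lam p)))) = _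
  simp only [Flinv_emb, Prod.swap_swap]
  rfl

theorem dG_emb {lam : ℝ} (h : 0 < lam) (p : ℤ × ℤ) : dG (emb lam p) = (lam / Real.sqrt 2) * (dI p : ℝ) := by
  unfold dG emb dI
  simp only
  rw [← mul_sub, abs_mul, abs_of_pos h]
  push_cast; ring

theorem dG_le {lam : ℝ} (h : 0 < lam) (p q : ℤ × ℤ) :
    dG (emb lam p) ≤ dG (emb lam q) ↔ dI p ≤ dI q := by
  rw [dG_emb h, dG_emb h, mul_le_mul_iff_right₀ (by positivity)]
  exact_mod_cast Iff.rfl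

theorem dG_lt {lam : ℝ} (h : 0 < lam) (p q : ℤ × ℤ) :
    dG (emb lam p) < dG (emb lam q) ↔ dI p < dI q := by
  rw [← not_le, dG_le h, not_le]

theorem dI_swap (p : ℤ × ℤ) : dI p.swap = dI p := by
  unfold dI; simp [abs_sub_comm]

theorem Xdom_emb {lam : ℝ} (h : 0 < lam) (p : ℤ × ℤ) : emb lam p ∈ Xdom lam ↔ XI (fl lam) p := by
  unfold Xdom XI
  simp only [Set.mem_ofPred_eq]
  rw [Fl_iter_emb, Flinv_four_emb, dG_le h, dG_lt h, dI_swap (F4 _ _)]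
  have e1 : IsLatticePt lam (emb lam p) := ⟨p.1, p.2, rfl⟩
  have e2 : 0 ≤ (emb lam p).1 ↔ 0 ≤ p.1 := by
    unfold emb; simp only
    rw [mul_nonneg_iff_of_pos_left h]; exact_mod_cast Iff.rfl
  have e3 : 0 ≤ (emb lam p).2 ↔ 0 ≤ p.2 := by
    unfold emb; simp only
    rw [mul_nonneg_iff_of_pos_left h]; exact_mod_cast Iff.rfl
  rw [e2, e3]
  exact ⟨fun ⟨_, a⟩ => a, fun a => ⟨e1, a⟩⟩

theorem tau_of_ret {lam : ℝ} (h : 0 < lam) {K : ℤ} {p : ℤ × ℤ} {i0 T : ℕ} (hr : Ret (fl lam) K p i0 T) :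
    tau lam (emb lam p) = 4 * T + 1 := by
  have hmem : 4 * T + 1 ∈ {k : ℕ | 1 ≤ k ∧ (Fl lam)^[k] (emb lam p) ∈ Xdom lam} := by
    refine ⟨by omega, ?_⟩
    rw [Fl_iter_emb, Xdom_emb h, Function.iterate_succ_apply']
    exact hr.isin
  unfold tau
  apply le_antisymm
  · exact Nat.sInf_le hmem
  · by_contra hc
    push Not at hc
    have hm := Nat.sInf_mem ⟨_, hmem⟩
    obtain ⟨a, b⟩ := hm
    rw [Fl_iter_emb, Xdom_emb h] at b
    exact hr.notin _ a hc b

theorem tauMinus_zero {lam : ℝ} {z : ℝ × ℝ} (hz : z ∈ Xdom lam) : tauMinus lam z = 0 := by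
  unfold tauMinus
  exact Nat.sInf_eq_zero.2 (Or.inl hz)

theorem orbit_mem {lam : ℝ} (h : 0 < lam) {K : ℤ} {p : ℤ × ℤ} {i0 T : ℕ} (hr : Ret (fl lam) K p i0 T)
    {k : ℕ} (hk : k ≤ 4 * T + 1) : emb lam ((FI (fl lam))^[k] p) ∈ returnOrbit lam (emb lam p) := by
  refine ⟨k, by omega, by rw [tau_of_ret h hr]; exact_mod_cast hk, ?_⟩
  unfold FlIter
  rw [if_pos (by omega)]
  simp [Fl_iter_emb]

theorem orbit_mem_iff {lam : ℝ} (h : 0 < lam) {K : ℤ} {p : ℤ × ℤ} {i0 T : ℕ} (hr : Ret (fl lam) K p i0 T)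
    (hX : XI (fl lam) p) (w : ℝ × ℝ) :
    w ∈ returnOrbit lam (emb lam p) ↔ ∃ k : ℕ, k ≤ 4 * T + 1 ∧ w = emb lam ((FI (fl lam))^[k] p) := by
  constructor
  · rintro ⟨k, k1, k2, rfl⟩
    rw [tauMinus_zero ((Xdom_emb h p).2 hX)] at k1
    rw [tau_of_ret h hr] at k2
    simp only [Nat.cast_zero, neg_zero] at k1
    obtain ⟨n, rfl⟩ := Int.eq_ofNat_of_zero_le k1
    refine ⟨n, by exact_mod_cast k2, ?_⟩
    unfold FlIter
    rw [if_pos k1]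
    simp [Fl_iter_emb]
  · rintro ⟨k, hk, rfl⟩
    exact orbit_mem h hr hk

theorem Rfl_emb (lam : ℝ) (p : ℤ × ℤ) : Rfl (emb lam p) = RI (fl lam) p := rfl

theorem Trans_emb (lam : ℝ) (p : ℤ × ℤ) :
    emb lam p ∈ TransSet lam ↔ RI (fl lam) (F4 (fl lam) p) ≠ RI (fl lam) p := by
  unfold TransSet
  simp only [Set.mem_ofPred_eq]
  rw [Fl_iter_emb, Rfl_emb, Rfl_emb]
  exact ⟨fun a => a.2, fun a => ⟨⟨p.1, p.2, rfl⟩, a⟩⟩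

theorem NS_of_not_sigma {lam : ℝ} (h : 0 < lam) {p : ℤ × ℤ} (hp : emb lam p ∉ SigmaSet lam) :
    NS (fl lam) (cl lam) p := by
  intro hT m n hn
  exact hp ⟨(Trans_emb lam p).2 hT, m, n, NC_dist h hn⟩

theorem latt_emb {lam : ℝ} {z : ℝ × ℝ} (hz : z ∈ Xdom lam) : ∃ p, z = emb lam p := by
  obtain ⟨⟨a, b, rfl⟩, -⟩ := hz
  exact ⟨(a, b), rfl⟩

theorem Pfun_nonneg (x : ℝ) : 0 ≤ Pfun x ∧ (⌊x⌋:ℝ)^2 ≤ Pfun x ∨ (⌊x⌋ < 0 ∧ ((⌊x⌋:ℝ)+1)^2 < Pfun x) := by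
  unfold Pfun
  have h1 := Int.floor_le x
  have h2 := Int.lt_floor_add_one x
  rcases le_or_gt 0 ⌊x⌋ with h | h
  · left
    have h' : (0:ℝ) ≤ ⌊x⌋ := by exact_mod_cast h
    have : 0 ≤ (2 * (⌊x⌋:ℝ) + 1) * (x - ⌊x⌋) := mul_nonneg (by linarith) (by linarith)
    constructor <;> nlinarith [sq_nonneg (⌊x⌋:ℝ)]
  · right
    refine ⟨h, ?_⟩
    have h' : (⌊x⌋:ℝ) ≤ -1 := by exact_mod_cast (show ⌊x⌋ ≤ -1 by omega)
    nlinarith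

/-- integer data of a point of `X^e` -/
structure XData (lam : ℝ) (e K : ℤ) (e' : ℤ) (p : ℤ × ℤ) (i0 T : ℕ) : Prop where
  xi : XI (fl lam) p
  ret : Ret (fl lam) K p i0 T
  ham : ∀ k : ℕ, k ≤ 4 * T + 1 → (e:ℝ) < Ham (emb lam ((FI (fl lam))^[k] p)) ∧
    Ham (emb lam ((FI (fl lam))^[k] p)) < e'
  phi : Phi lam (emb lam p) = emb lam (FI (fl lam) (zs (fl lam) p T))
  fx : fl lam p.1 ≤ e'
  fy : fl lam p.2 ≤ e'

theorem floor_bound {lam : ℝ} {e e' : ℤ} (h : 0 < lam) (_he : 0 ≤ e') (hE : ∀ a b : ℤ, a^2 + b^2 ≤ e ∨ e' ≤ a^2 + b^2)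
    (hee : e < e') {p : ℤ × ℤ} (p1 : 0 ≤ p.1) (p2 : 0 ≤ p.2)
    (H1 : (e:ℝ) < Ham (emb lam p)) (H2 : Ham (emb lam p) < e') : fl lam p.1 ≤ e' ∧ fl lam p.2 ≤ e' := by
  have h1 : 0 ≤ fl lam p.1 := Int.floor_nonneg.2 (by positivity)
  have h2 : 0 ≤ fl lam p.2 := Int.floor_nonneg.2 (by positivity)
  have := inv_of_ham (X := p.1) (Y := p.2) hE rfl rfl h1 H1 H2
  unfold InvB at this
  rw [if_pos h2] at this
  have := sq_le_bound this.1
  omega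

theorem exists_ret {lam : ℝ} {G K e' : ℤ} (h : 0 < lam) (hGl : (G:ℝ) * lam ≤ 1) (he : 0 ≤ e')
    (hG : 20 * K + 60 ≤ G) (hK : K = 2 * (e' + 1)^2) {p : ℤ × ℤ} (hX : XI (fl lam) p)
    (hne : ¬ (p.1 = 0 ∧ p.2 = 0)) (fx : fl lam p.1 ≤ e') (fy : fl lam p.2 ≤ e') :
    ∃ i0 T, Ret (fl lam) K p i0 T := by
  have hFC := fl_FC h hGl
  refine ret_exists hFC hG (by rw [hK]; nlinarith) hX hne fx fy ?_
  have l1 : lam * p.1 < e' + 1 := by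
    have := Int.lt_floor_add_one (lam * (p.1:ℝ))
    have h2 : ((fl lam p.1 : ℤ) : ℝ) ≤ e' := by exact_mod_cast fx
    unfold fl at h2; linarith
  have l2 : lam * p.2 < e' + 1 := by
    have := Int.lt_floor_add_one (lam * (p.2:ℝ))
    have h2 : ((fl lam p.2 : ℤ) : ℝ) ≤ e' := by exact_mod_cast fy
    unfold fl at h2; linarith
  have he' : (0:ℝ) ≤ e' := by exact_mod_cast he
  unfold fl
  have : lam * ((p.1 + (2 * e' + 1) * p.2 : ℤ):ℝ) < ((K:ℤ):ℝ) := by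
    rw [hK]; push_cast; nlinarith
  exact (Int.floor_lt.2 this).le

theorem xdata_of {lam : ℝ} {G K : ℤ} {e : ℕ} (h : 0 < lam) (hGl : (G:ℝ) * lam ≤ 1)
    (hG : 20 * K + 60 ≤ G) (hK : K = 2 * ((nextE e:ℤ) + 1)^2) {z : ℝ × ℝ} (hz : z ∈ Xe lam e) :
    ∃ p i0 T, z = emb lam p ∧ XData lam e K (nextE e) p i0 T := by
  obtain ⟨hX, hH⟩ := hz
  obtain ⟨p, rfl⟩ := latt_emb hX
  have xi := (Xdom_emb h p).1 hX
  have h0 : emb lam p ∈ returnOrbit lam (emb lam p) := by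
    refine ⟨0, by simp, by positivity, rfl⟩
  have hH0 := hH _ h0
  have e0 : (0:ℤ) ≤ nextE e := by positivity
  have hne : ¬ (p.1 = 0 ∧ p.2 = 0) := by
    rintro ⟨a, b⟩
    have : Ham (emb lam p) = 0 := by unfold Ham emb Pfun; simp [a, b]
    rw [this] at hH0
    have := hH0.1
    have : (0:ℝ) ≤ e := by positivity
    linarith
  have hE := nextE_alt e
  obtain ⟨b1, b2⟩ := floor_bound h e0 hE (by exact_mod_cast (nextE_spec e).2) xi.1 xi.2.1 hH0.1 hH0.2
  obtain ⟨i0, T, hr⟩ := exists_ret h hGl e0 hG hK xi hne b1 b2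
  refine ⟨p, i0, T, rfl, xi, hr, ?_, ?_, b1, b2⟩
  · intro k hk
    exact hH _ (orbit_mem h hr hk)
  · unfold Phi
    rw [tau_of_ret h hr, Fl_iter_emb, Function.iterate_succ_apply']
    rfl


theorem F4_fst_le {f C : ℤ → ℤ} {G X Y : ℤ} (h : FC f C G) (X0 : 0 ≤ f X) :
    (F4 f (X, Y)).1 ≤ X + f (F4 f (X, Y)).2 + f Y + 1 := by
  rw [F4_eq f X Y rfl rfl rfl rfl]
  have g3 := h.high Y
  have n1 := h.neg2 (f Y + 1)
  have e2l : -(f Y+1) ≤ f (f X - Y) := by rw [h.iff]; omega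
  simp only
  omega

/-- near the diagonal -/
theorem XI_near {f C : ℤ → ℤ} {G K X Y : ℤ} (h : FC f C G) (hG : 10 * K + 20 ≤ G)
    (fX : f X ≤ K) (fY : f Y ≤ K) (hx : XI f (X, Y)) (hne : ¬ (X = 0 ∧ Y = 0)) :
    1 ≤ X ∧ f X < Y ∧ f Y < X ∧ X - Y ≤ f X + f Y + 1 ∧ Y - X ≤ f X + f Y + 1 := by
  obtain ⟨X1, Q⟩ := XI_Q h hG fX fY hx hne
  obtain ⟨q1, q2, q3, q4, -, -, -⟩ := qstep h hG (by omega) Q fX fY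
  have a0 := h.nonneg.2 (show 0 ≤ X by omega)
  have b0 := h.nonneg.2 (show 0 ≤ Y by omega)
  have d1 := hx.2.2.1
  have d2 := hx.2.2.2
  have A : Y - X ≤ f X + f Y + 1 := by
    by_contra hc
    have : dI (F4 f (X, Y)) < dI (X, Y) := by
      unfold dI
      simp only
      rw [abs_of_nonpos (by omega : X - Y ≤ 0), abs_lt]
      omega
    omega
  have sX := h.small (show 0 ≤ X by omega)
  have sY := h.small (show 0 ≤ Y by omega)
  have B : f Y < X := by
    by_contra hc
    have x0 : f X = 0 := h.fzero (by omega) (by omega)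
    nlinarith
  obtain ⟨r1, r2, r3, r4, -, -, -⟩ := qstep h hG (by omega) B fY fX
  refine ⟨X1, Q, B, ?_, A⟩
  by_contra hc
  have : dI (F4 f (Y, X)) ≤ dI (X, Y) := by
    unfold dI
    simp only
    rw [abs_of_nonneg (by omega : 0 ≤ X - Y), abs_le]
    omega
  simp only [Prod.swap_prod_mk] at d2
  omega

theorem FC.le_succ {f C : ℤ → ℤ} {G X Y : ℤ} (h : FC f C G) (hd : Y - X ≤ G) : f Y ≤ f X + 1 := by
  have g1 := h.high X
  have g2 := h.gap (f X + 1)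
  have : f Y < f X + 1 + 1 := by rw [h.lt]; omega
  omega

/-- above the diagonal: a transition near the corner -/
theorem loc_above {f C : ℤ → ℤ} {G K X Y : ℤ} (h : FC f C G) (hG : 10 * K + 20 ≤ G)
    (fX : f X ≤ K) (fY : f Y ≤ K) (hx : XI f (X, Y)) (hne : ¬ (X = 0 ∧ Y = 0)) (hlt : f X < f Y) :
    ¬ NS f C (X, Y) := by
  obtain ⟨X1, Q, Q', d1, d2⟩ := XI_near h hG fX fY hx hne
  obtain ⟨q1, q2, q3, q4, -, -, -⟩ := qstep h hG (by omega) Q fX fY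
  have a0 := h.nonneg.2 (show 0 ≤ X by omega)
  have e1 : f Y = f X + 1 := by
    have := h.le_succ (X := X) (Y := Y) (by omega)
    omega
  have g1 := h.high X
  have g2 := h.low Y
  rw [e1] at g2
  intro hS
  refine hS ?_ (f X + 1) (f X + 1) ?_
  · intro hR
    simp only [RI, Prod.mk.injEq] at hR
    have g3 := h.high (F4 f (X, Y)).1
    have g4 := h.low (F4 f (X, Y)).2
    rw [hR.1] at g3
    rw [hR.2, e1] at g4
    have d3 := hx.2.2.1
    unfold dI at d3
    simp only at d3
    rw [abs_of_nonpos (by omega), abs_of_nonpos (by omega)] at d3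
    omega
  · exact NC_ext (r := 2 * (f X + 1)) (s := 2 * (f X + 1)) (by omega) (by omega) (by omega) (by omega) (by omega) (by omega)

/-- below the diagonal -/
theorem loc_below {f C : ℤ → ℤ} {G K X Y : ℤ} (h : FC f C G) (hG : 10 * K + 20 ≤ G)
    (fX : f X ≤ K) (fY : f Y ≤ K) (hx : XI f (X, Y)) (hne : ¬ (X = 0 ∧ Y = 0)) (hlt : f Y < f X) :
    f X = f Y + 1 ∧ X - Y ≤ 2 * f X - 1 ∧ ¬ NS f C (F4 f (Y, X)).swap := by
  obtain ⟨X1, Q, Q', d1, d2⟩ := XI_near h hG fX fY hx hne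
  have b0 := h.nonneg.2 (show 0 ≤ Y by omega)
  obtain ⟨q1, q2, q3, q4, -, -, -⟩ := qstep h hG (by omega) Q' fY fX
  have q9 := F4_fst_le (Y := X) h b0
  have e1 : f X = f Y + 1 := by
    have := h.le_succ (X := Y) (Y := X) (by omega)
    omega
  have g1 := h.high Y
  have g2 := h.low X
  have g0 := h.gap (f Y)
  rw [← e1] at g1 g0
  have d3 := hx.2.2.2
  simp only [Prod.swap_prod_mk] at d3
  unfold dI at d3
  simp only at d3
  rw [abs_of_nonneg (by omega : 0 ≤ X - Y)] at d3
  have hs : X - Y ≤ 2 * f X - 1 := by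
    by_contra hc
    have hb : (F4 f (Y, X)).2 < C (f X) ∨ (F4 f (Y,X)).2 = X - (2 * f Y + 1) := by omega
    rcases hb with hb | hb
    · have := h.lt.2 hb
      have : |(F4 f (Y, X)).1 - (F4 f (Y, X)).2| ≤ X - Y := by
        rw [abs_le]; omega
      omega
    · have : |(F4 f (Y, X)).1 - (F4 f (Y, X)).2| ≤ X - Y := by
        rw [abs_le]; omega
      omega
  refine ⟨e1, hs, ?_⟩
  intro hS
  refine hS ?_ (f X) (f X) ?_
  · have e2 : F4 f (F4 f (Y, X)).swap = (X, Y) := by rw [F4inv_swap]; rfl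
    rw [e2]
    intro hR
    simp only [RI, Prod.mk.injEq, Prod.fst_swap, Prod.snd_swap] at hR
    have g3 := h.low (F4 f (Y, X)).2
    have g4 := h.high (F4 f (Y, X)).1
    rw [← hR.1] at g3
    rw [← hR.2, ← e1] at g4
    have : |(F4 f (Y, X)).1 - (F4 f (Y, X)).2| ≤ X - Y := by
      rw [abs_le]; omega
    omega
  · exact NC_ext (X := (F4 f (Y, X)).2) (Y := (F4 f (Y, X)).1) (r := 2 * f X + 2) (s := 2 * f X + 2) (by omega) (by omega) (by omega) (by omega) (by omega) (by omega)

/-- integer data of a regular point -/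
structure RegData (lam : ℝ) (e K : ℤ) (e' : ℤ) (p : ℤ × ℤ) (i0 T : ℕ) : Prop extends
    XData lam e K e' p i0 T where
  nt : RI (fl lam) (F4 (fl lam) p) = RI (fl lam) p
  ns : ∀ k : ℕ, k ≤ 4 * T + 1 → NS (fl lam) (cl lam) ((FI (fl lam))^[k] p)

theorem regdata_of {lam : ℝ} {K : ℤ} {e : ℕ} {p : ℤ × ℤ} {i0 T : ℕ} (h : 0 < lam)
    (hd : XData lam e K (nextE e) p i0 T) (hr : IsRegularPt lam e (emb lam p)) :
    RegData lam e K (nextE e) p i0 T := by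
  obtain ⟨h1, h2, h3⟩ := hr
  refine ⟨hd, ?_, ?_⟩
  · rw [Trans_emb] at h2
    exact not_not.1 h2
  · intro k hk
    apply NS_of_not_sigma h
    intro hs
    have : emb lam ((FI (fl lam))^[k] p) ∈ returnOrbit lam (emb lam p) ∩ SigmaSet lam :=
      ⟨orbit_mem h hd.ret hk, hs⟩
    rw [h3] at this
    exact this

/-- the end point lies in a diagonal box -/
theorem end_diag {lam : ℝ} {G K e e' : ℤ} (h : 0 < lam) (hGl : (G:ℝ) * lam ≤ 1)
    (hG : 20 * K + 60 ≤ G) (hee : e < e')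
    (hE : ∀ a b : ℤ, a^2 + b^2 ≤ e ∨ e' ≤ a^2 + b^2) {p : ℤ × ℤ} {i0 T : ℕ}
    (hd : RegData lam e K e' p i0 T) {μ : ℤ} (m0 : 0 ≤ μ) (m1 : 2 * μ^2 ≤ e) (m2 : e < 2 * (μ+1)^2) :
    fl lam (FI (fl lam) (zs (fl lam) p T)).1 = μ ∧ fl lam (FI (fl lam) (zs (fl lam) p T)).2 = μ := by
  have hFC := fl_FC h hGl
  have hr := hd.ret
  set f := fl lam with hf
  set ζ := FI f (zs f p T) with hζ
  have hx : XI f (ζ.1, ζ.2) := hr.isin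
  have t1 : f ζ.1 < ζ.2 := hr.t1
  have t2 : 0 ≤ ζ.1 := hr.t2
  have t3 : f ζ.1 ≤ K + 1 := hr.t3
  have t4 : f ζ.2 ≤ K := hr.t4
  have a0 := hFC.nonneg.2 t2
  have hne : ¬ (ζ.1 = 0 ∧ ζ.2 = 0) := by rintro ⟨-, hh⟩; omega
  have Kp : 0 ≤ K := by
    have := hFC.nonneg.2 (show 0 ≤ ζ.2 by omega)
    omega
  have b0 := hFC.nonneg.2 (show 0 ≤ ζ.2 by omega)
  have hT := hr.i0T
  have i1 : ¬ f ζ.1 < f ζ.2 := by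
    intro hlt
    refine loc_above hFC (K := K+1) (by omega) t3 (by omega) hx hne hlt ?_
    have := hd.ns (4 * T + 1) le_rfl
    rwa [Function.iterate_succ_apply'] at this
  have i2 : ¬ f ζ.2 < f ζ.1 := by
    intro hlt
    refine (loc_below hFC (K := K+1) (by omega) t3 (by omega) hx hne hlt).2.2 ?_
    obtain ⟨t, ht⟩ : ∃ t, T = t + 1 := ⟨T - 1, by omega⟩
    have e1 : F4 f (ζ.2, ζ.1) = (FI f (zs f p t)).swap := by
      have : ζ = F4 f (FI f (zs f p t)) := by rw [hζ, ht, zs_succ, iter_comm]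
      rw [show (ζ.2, ζ.1) = ζ.swap from rfl, this, F4inv_swap]
    rw [e1, Prod.swap_swap]
    have := hd.ns (4 * t + 1) (by omega)
    rwa [Function.iterate_succ_apply'] at this
  have hh := hd.ham (4 * T + 1) le_rfl
  rw [Function.iterate_succ_apply'] at hh
  have inv := inv_of_ham (X := ζ.1) (Y := ζ.2) hE rfl rfl a0 hh.1 hh.2
  rw [← hf] at inv
  have eq : f ζ.2 = f ζ.1 := by omega
  rw [eq] at inv ⊢
  unfold InvB at inv
  rw [if_pos a0] at inv
  have := mu_unique m1 m2 m0 a0 (by linarith [inv.1]) (by linarith [inv.2])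
  exact ⟨this, this⟩


theorem Ret.X_pos {f C : ℤ → ℤ} {G K : ℤ} {p : ℤ × ℤ} {i0 T : ℕ} (h : FC f C G) (hr : Ret f K p i0 T)
    {i : ℕ} (hi : i ≤ T) : 1 ≤ (zs f p i).1 := by
  rcases lt_or_ge i i0 with c | c
  · exact (hr.ph1 i c).2.1
  · rcases hi.lt_or_eq with c2 | c2
    · obtain ⟨a, b, -⟩ := hr.ph2 i c c2
      have := h.nonneg.2 b
      simp only [FI] at a this
      omega
    · subst c2
      have a := hr.t1
      have := h.nonneg.2 hr.t2
      simp only [FI] at a this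
      omega

theorem Ret.diag' {f C : ℤ → ℤ} {G K : ℤ} {p : ℤ × ℤ} {i0 T : ℕ} (h : FC f C G) (hr : Ret f K p i0 T)
    {i : ℕ} (hi : i < T) (hn : f (zs f p i).2 < 0) : -1 ≤ f (zs f p i).1 + f (zs f p i).2 := by
  have a0 := h.nonneg.2 (show 0 ≤ (zs f p i).1 by have := hr.X_pos h hi.le; omega)
  rcases lt_or_ge i i0 with c | c
  · obtain ⟨a, -⟩ := hr.ph1 i c
    have := h.nonneg.2 (show 0 ≤ (zs f p i).2 by omega)
    omega
  · obtain ⟨-, -, -, -, a, -⟩ := hr.ph2 i c hi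
    unfold uu at a
    simp only [FI] at a
    have g := h.high (zs f p i).1
    have n2 := h.neg2 (f (zs f p i).1 + 1)
    have : -(f (zs f p i).1 + 1) ≤ f (zs f p i).2 := by rw [h.iff]; omega
    omega

theorem rpath_of {lam : ℝ} {G K e e' : ℤ} (h : 0 < lam) (hGl : (G:ℝ) * lam ≤ 1)
    (hG : 20 * K + 60 ≤ G) (hK : e' ≤ K) (hee : e < e')
    (hE : ∀ a b : ℤ, a^2 + b^2 ≤ e ∨ e' ≤ a^2 + b^2) {p : ℤ × ℤ} {i0 T : ℕ}
    (hd : RegData lam e K e' p i0 T) {μ : ℤ} (m0 : 0 ≤ μ) (m1 : 2 * μ^2 ≤ e) (m2 : e < 2 * (μ+1)^2) :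
    ∃ S : ℕ, RPath (fl lam) (cl lam) e μ (zs (fl lam) p) S ∧ S ≤ T + 1 ∧
      ∃ c : ℤ, FI (fl lam) (zs (fl lam) p S) = FI (fl lam) (zs (fl lam) p T) + (c * (2 * μ + 1), -(c * (2 * μ+1))) := by
  have hFC := fl_FC h hGl
  have hr := hd.ret
  obtain ⟨d1, d2⟩ := end_diag h hGl hG hee hE hd m0 m1 m2
  have t1 := hr.t1
  have isin := hr.isin
  have hns := fun i (hi : i ≤ T) => hd.ns (4 * i) (by omega)
  have hham := fun i (hi : i ≤ T) => hd.ham (4 * i) (by omega)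
  change ∀ i, i ≤ T → NS (fl lam) (cl lam) (zs (fl lam) p i) at hns
  change ∀ i, i ≤ T → (e:ℝ) < Ham (emb lam (zs (fl lam) p i)) ∧ Ham (emb lam (zs (fl lam) p i)) < e' at hham
  have Xp := fun i (hi : i ≤ T) => hr.X_pos hFC hi
  have hdiag := fun i (hi : i < T) => hr.diag' hFC hi
  have t4 := hr.t4
  set f := fl lam with hf
  set C := cl lam with hC
  set z := zs f p with hz
  have mK : μ ≤ K := by omega
  have pos : ∀ i, i ≤ T → 0 ≤ f (z i).1 := fun i hi => hFC.nonneg.2 (by have := Xp i hi; omega)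
  have inv : ∀ i, i ≤ T → InvB e (f (z i).1) (f (z i).2) := fun i hi =>
    inv_of_ham (X := (z i).1) (Y := (z i).2) hE rfl rfl (pos i hi) (hham i hi).1 (hham i hi).2
  have stp : ∀ i, i ≤ T → StepOK f C e (z i) (f (z i).1) (f (z i).2) ∨
      (f (z i).1 = 0 ∧ f (z i).2 < 0 ∧ (F4 f (z i)).1 < 0) := fun i hi =>
    stepOK_of (X := (z i).1) (Y := (z i).2) h hGl (by omega) hK hee hE rfl rfl (pos i hi)
      (fun _ => Or.inl (by have := Xp i hi; omega)) (hham i hi).1 (hham i hi).2 (hns i hi)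
  have stp' : ∀ i, i < T → StepOK f C e (z i) (f (z i).1) (f (z i).2) := by
    intro i hi
    rcases stp i hi.le with c | ⟨-, -, c⟩
    · exact c
    · have := Xp (i+1) hi
      rw [hz, zs_succ] at this
      rw [hz] at c
      omega
  simp only [FI] at d1 d2
  have g1 := hFC.low (f (z T).1 - (z T).2)
  have g2 := hFC.high (f (z T).1 - (z T).2)
  rw [d1, d2] at g1 g2
  have n2 := hFC.neg2 (μ + 1)
  have n1 := hFC.neg1 μ
  have n3 : -(μ+1) ≤ f (z T).2 := by rw [hFC.iff]; omega
  have n4 : f (z T).2 < -μ + 1 := by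
    have := hFC.gap (-μ)
    rw [hFC.lt]
    omega
  by_cases hc : f (z T).2 = -μ - 1
  · refine ⟨T, ⟨fun i _ => zs_succ f p i, stp', fun i hi => inv i hi.le, pos, ?_, ?_⟩, by omega, 0, by simp⟩
    · intro i hi hn
      rcases hi.lt_or_eq with c | c
      · exact hdiag i c hn
      · subst c; omega
    · simp only [RI]; rw [d2, hc]
  have hc' : f (z T).2 = -μ := by omega
  have key : z (T+1) = ((z T).1 - (2 * μ + 1), (z T).2 - (2 * μ + 1)) ∧ RI f (z (T+1)) = (μ, -μ-1) ∧
      StepOK f C e (z T) (f (z T).1) (f (z T).2) := by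
    rcases stp T le_rfl with c | ⟨c1, c2, c⟩
    · have c' := c
      rw [d2, hc'] at c
      rw [d2] at d1
      unfold StepOK at c
      rw [← zs_succ, ← hz] at c
      rcases c with ⟨e1, e2⟩ | ⟨e1, e2, -⟩ | ⟨e1, e2, e3, e4, e5, e6⟩ | ⟨e1, e2, e3, e4, e5, e6, e7⟩
      · exfalso
        simp only [RI, Prod.mk.injEq] at e2
        have := hFC.low (z (T+1)).2
        rw [e2.2, e1] at this
        simp only at this
        omega
      · refine ⟨?_, e2, c'⟩
        rw [e1, d1]
        ext <;> simp only <;> ring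
      · exfalso
        have mz : μ = 0 := by omega
        subst mz
        have nn := XI_near (X := (FI f (z T)).1) (Y := (FI f (z T)).2) (K := K + 1) hFC (by omega)
          (by simp only [FI]; rw [d2, d1]; omega) (by omega) isin (by
            rintro ⟨-, hh⟩; have := Xp T le_rfl; simp only [FI] at hh; omega)
        simp only [FI] at nn
        rw [d2, d1] at nn
        have := hFC.gap 0
        have := hFC.low (z T).2
        rw [hc'] at this
        simp only [neg_zero, zero_add, mul_zero, hFC.zero] at *
        omega
      · exfalso
        apply e7
        unfold exY
        rw [if_neg (by omega)]
        nlinarith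
    · omega
  obtain ⟨k1, k2, k3⟩ := key
  refine ⟨T + 1, ⟨fun i _ => zs_succ f p i, ?_, fun i hi => inv i (by omega), ?_, ?_, k2⟩, le_rfl, 1, ?_⟩
  · intro i hi
    rcases (Nat.lt_succ_iff.1 hi).lt_or_eq with c | c
    · exact stp' i c
    · subst c; exact k3
  · intro i hi
    rcases hi.lt_or_eq with c | c
    · exact pos i (by omega)
    · subst c
      simp only [RI, Prod.mk.injEq] at k2
      omega
  · intro i hi hn
    simp only [RI, Prod.mk.injEq] at k2
    rcases lt_or_ge i T with c | c
    · exact hdiag i c hn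
    · rcases c.lt_or_eq with c | c
      · have : i = T + 1 := by omega
        subst this; omega
      · subst c; omega
  · simp only [RI, Prod.mk.injEq] at k2
    have k3 := k2.1
    simp only [FI]
    rw [k3, d2, k1]
    ext <;> simp <;> ring

theorem final_const {f C : ℤ → ℤ} {e μ : ℤ} {z : ℕ → ℤ × ℤ} {S : ℕ} (hz : RPath f C e μ z S) (m0 : 0 ≤ μ)
    {j : ℕ} (hb : RI f (z j) = (μ, -μ-1)) : ∀ d : ℕ, j + d ≤ S →
      RI f (z (j+d)) = (μ, -μ-1) ∧ ∃ c : ℤ, z (j+d) = z j - (c * (2*μ+1), c * (2*μ+1)) := by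
  intro d
  induction d with
  | zero => intro _; exact ⟨hb, 0, by ext <;> simp⟩
  | succ d ih =>
    intro hd
    obtain ⟨b, c, hc⟩ := ih (by omega)
    have s := hz.step (j+d) (by omega)
    have n := hz.next (j+d) (by omega)
    have dg := hz.diag (j+d+1) hd
    simp only [RI, Prod.mk.injEq] at b
    rw [b.1, b.2] at s
    unfold StepOK at s
    rw [← n] at s
    rw [← add_assoc]
    rcases s with ⟨e1, e2⟩ | ⟨e1, e2, -⟩ | ⟨e1, e2, e3, e4, e5, e6⟩ | ⟨e1, e2, e3, e4, e5, e6, e7⟩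
    · refine ⟨e2, c + 1, ?_⟩
      rw [e1, hc]
      ext <;> simp <;> ring
    · simp only [RI, Prod.mk.injEq] at e2; omega
    · omega
    · simp only [RI, Prod.mk.injEq] at e2; omega

/-- conclusion from a synchronised state -/
theorem concl {lam : ℝ} {e μ H : ℤ} {p p' : ℤ × ℤ} {S S' T T' : ℕ} (m0 : 0 ≤ μ)
    (hT : TurnDvd e μ H)
    (hz : RPath (fl lam) (cl lam) e μ (zs (fl lam) p) S) (hz' : RPath (fl lam) (cl lam) e μ (zs (fl lam) p') S')
    (hc : ∃ c : ℤ, FI (fl lam) (zs (fl lam) p S) = FI (fl lam) (zs (fl lam) p T) + (c * (2 * μ + 1), -(c * (2 * μ+1))))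
    (hc' : ∃ c : ℤ, FI (fl lam) (zs (fl lam) p' S') = FI (fl lam) (zs (fl lam) p' T') + (c * (2 * μ + 1), -(c * (2 * μ+1))))
    {i i' : ℕ} {m n : ℤ} (hi : i ≤ S) (hi' : i' ≤ S')
    (st : SyncSt (fl lam) e μ H (zs (fl lam) p i) (zs (fl lam) p' i') m n) {l : ℤ × ℤ}
    (hl : (2 * μ + 1) ∣ l.1) (hH : H = (2 * μ + 1) * (l.1 + l.2)) :
    ∃ c : ℤ, FI (fl lam) (zs (fl lam) p' T') - FI (fl lam) (zs (fl lam) p T) - l =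
      (c * (2 * μ + 1), -(c * (2 * μ+1))) := by
  obtain ⟨j, j', hj, hj', s⟩ := pair_sync hT hz hz' _ i i' m n hi hi' rfl st
  obtain ⟨b1, c1, f1⟩ := final_const hz m0 s.box (S - j) (by omega)
  obtain ⟨b2, c2, f2⟩ := final_const hz' m0 s.box' (S' - j') (by omega)
  rw [show j + (S - j) = S by omega] at b1 f1
  rw [show j' + (S' - j') = S' by omega] at b2 f2
  obtain ⟨c3, h3⟩ := hc
  obtain ⟨c4, h4⟩ := hc'
  obtain ⟨d1, h1⟩ := s.dy (Or.inr ⟨rfl, rfl⟩)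
  obtain ⟨d2, h2⟩ := hl
  have ham := s.ham
  rw [hH] at ham
  have pos : (2 * μ + 1) ≠ 0 := by omega
  have ham' : ((zs (fl lam) p' j').1 - (zs (fl lam) p j).1) - ((zs (fl lam) p' j').2 - (zs (fl lam) p j).2) = l.1 + l.2 := by
    apply mul_left_cancel₀ pos
    linear_combination ham
  simp only [FI, RI, Prod.mk.injEq] at *
  rw [b1.1, f1] at h3
  rw [b2.1, f2] at h4
  have h31 := congrArg Prod.fst h3
  have h32 := congrArg Prod.snd h3
  have h41 := congrArg Prod.fst h4
  have h42 := congrArg Prod.snd h4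
  simp only [Prod.fst_add, Prod.snd_add, Prod.fst_sub, Prod.snd_sub] at h31 h32 h41 h42
  refine ⟨c2 - c1 + c3 - c4 - d1 - d2, ?_⟩
  ext
  · simp only [Prod.fst_sub]
    linear_combination h31 - h41 - h1 - h2
  · simp only [Prod.snd_sub]
    linear_combination h32 - h42 + h1 + h2 + ham'


theorem lattice_int {lam : ℝ} {e : ℕ} {v : ℕ → ℕ} {l : ℝ × ℝ}
    (hl : l ∈ latticeL lam (v 1) (qval e v)) (hodd : Odd (qval e v)) (hdv : (2 * v 1 + 1)^2 ∣ qval e v) :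
    ∃ d : ℤ × ℤ, l = emb lam d ∧ (2 * (v 1:ℤ) + 1) ∣ d.1 ∧ (2 * (v 1:ℤ) + 1) ∣ d.2 ∧
      (qval e v : ℤ) ∣ (2 * (v 1:ℤ) + 1) * (d.1 + d.2) := by
  obtain ⟨r, hr⟩ := hdv
  have ro : Odd r := by
    rw [hr] at hodd
    exact (Nat.odd_mul.1 hodd).2
  obtain ⟨s, hs⟩ : ∃ s, r = 2 * s + 1 := ro
  have hs' : (r:ℝ) = 2 * s + 1 := by rw [hs]; push_cast; ring
  have w0 : (2 * (v 1:ℝ) + 1) ≠ 0 := by positivity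
  have hq : lam * (qval e v : ℝ) / (2 * (v 1:ℝ) + 1) = lam * ((2 * (v 1:ℝ) + 1) * r) := by
    rw [hr]; push_cast; field_simp
  have hqz : (qval e v : ℤ) = (2 * (v 1:ℤ) + 1)^2 * (2 * s + 1) := by rw [hr, hs]; push_cast; ring
  refine AddSubgroup.closure_induction (p := fun l _ => ∃ d : ℤ × ℤ, l = emb lam d ∧ (2 * (v 1:ℤ) + 1) ∣ d.1 ∧ (2 * (v 1:ℤ) + 1) ∣ d.2 ∧
      (qval e v : ℤ) ∣ (2 * (v 1:ℤ) + 1) * (d.1 + d.2)) ?_ ?_ ?_ ?_ hl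
  · intro x hx
    rcases hx with rfl | hx
    · refine ⟨((2 * (v 1:ℤ) + 1) * r, (2 * (v 1:ℤ) + 1) * r), ?_, Dvd.intro _ rfl, Dvd.intro _ rfl, ?_⟩
      · unfold Lvec emb
        rw [hq]; push_cast; rfl
      · rw [hqz, hs]; push_cast
        exact ⟨2, by ring⟩
    · rw [Set.mem_singleton_iff] at hx
      subst hx
      refine ⟨((2 * (v 1:ℤ) + 1) * s, (2 * (v 1:ℤ) + 1) * (s + 1)), ?_, Dvd.intro _ rfl, Dvd.intro _ rfl, ?_⟩
      · unfold Lvec emb wmn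
        rw [hq, hs']
        ext <;> simp <;> ring
      · rw [hqz]
        exact ⟨1, by ring⟩
  · exact ⟨0, by ext <;> simp [emb], by simp, by simp, by simp⟩
  · rintro x y _ _ ⟨d, h1, h2, h3, h4⟩ ⟨d', g1, g2, g3, g4⟩
    refine ⟨d + d', ?_, h2.add g2, h3.add g3, ?_⟩
    · rw [h1, g1]; ext <;> simp [emb] <;> ring
    · have := h4.add g4
      rw [← mul_add] at this
      rwa [show (d + d').1 + (d + d').2 = d.1 + d.2 + (d'.1 + d'.2) by rw [Prod.fst_add, Prod.snd_add]; ring]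
  · rintro x _ ⟨d, h1, h2, h3, h4⟩
    refine ⟨-d, ?_, (dvd_neg.2 h2), dvd_neg.2 h3, ?_⟩
    · rw [h1]; ext <;> simp [emb]
    · rw [show (2 * (v 1:ℤ) + 1) * ((-d).1 + (-d).2) = -((2 * (v 1:ℤ) + 1) * (d.1 + d.2)) by simp; ring]
      exact dvd_neg.2 h4


/-- a point of the return domain below the diagonal -/
structure Bad (f : ℤ → ℤ) (C : ℤ → ℤ) (e m : ℤ) (p : ℤ × ℤ) : Prop where
  m1 : 1 ≤ m
  bx : RI f p = (m, m - 1)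
  a0 : C m ≤ p.1
  b0 : p.2 < C m
  ab : p.1 - p.2 ≤ 2 * m - 1
  i1 : m^2 + (m-1)^2 ≤ e
  i2 : e < (m+1)^2 + m^2

theorem start_cases {lam : ℝ} {G K e e' : ℤ} (h : 0 < lam) (hGl : (G:ℝ) * lam ≤ 1)
    (hG : 20 * K + 60 ≤ G) (hK : e' ≤ K)
    (hE : ∀ a b : ℤ, a^2 + b^2 ≤ e ∨ e' ≤ a^2 + b^2) {p : ℤ × ℤ} {i0 T : ℕ}
    (hd : RegData lam e K e' p i0 T) {μ : ℤ} (m0 : 0 ≤ μ) (m1 : 2 * μ^2 ≤ e) (m2 : e < 2 * (μ+1)^2) :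
    RI (fl lam) p = (μ, μ) ∨ ∃ m, Bad (fl lam) (cl lam) e m p := by
  have hFC := fl_FC h hGl
  have x1 := hd.ret.X_pos hFC (Nat.zero_le _)
  change 1 ≤ p.1 at x1
  have hne : ¬ (p.1 = 0 ∧ p.2 = 0) := by omega
  have fx := hd.fx
  have fy := hd.fy
  have y0 := hd.xi.2.1
  have a0 := hFC.nonneg.2 (show 0 ≤ p.1 by omega)
  have b0 := hFC.nonneg.2 y0
  have Kp : 0 ≤ K := by omega
  have hh := hd.ham 0 (by omega)
  have inv := inv_of_ham (X := p.1) (Y := p.2) hE rfl rfl a0 hh.1 hh.2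
  unfold InvB at inv
  rw [if_pos b0] at inv
  rcases lt_trichotomy (fl lam p.1) (fl lam p.2) with c | c | c
  · exact absurd (hd.ns 0 (by omega)) (loc_above (X := p.1) (Y := p.2) (K := K) hFC (by omega) (by omega) (by omega) hd.xi hne c)
  · left
    rw [← c] at inv
    have := mu_unique m1 m2 m0 a0 (by linarith [inv.1]) (by linarith [inv.2])
    simp only [RI]
    rw [← c, this]
  · right
    obtain ⟨l1, l2, -⟩ := loc_below (X := p.1) (Y := p.2) (K := K) hFC (by omega) (by omega) (by omega) hd.xi hne c
    have e1 : fl lam p.2 = fl lam p.1 - 1 := by omega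
    have g1 := hFC.low p.1
    have g2 := hFC.high p.2
    rw [e1, sub_add_cancel] at g2
    rw [e1] at inv
    refine ⟨fl lam p.1, by omega, by simp only [RI]; rw [e1], g1, g2, l2, inv.1, by linarith [inv.2]⟩

/-- leaving the diagonal box -/
theorem exit_diag {f C : ℤ → ℤ} {e μ : ℤ} {z : ℕ → ℤ × ℤ} {S : ℕ} (hz : RPath f C e μ z S) (m0 : 0 ≤ μ)
    (hb : RI f (z 0) = (μ, μ)) : ∃ i, i < S ∧ RI f (z i) = (μ, μ) ∧
      (∃ c : ℤ, z i = z 0 + (c * (2*μ+1), - (c * (2*μ+1)))) ∧ RI f (z (i+1)) ≠ (μ, μ) := by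
  by_contra hcon
  push Not at hcon
  have key : ∀ i, i ≤ S → RI f (z i) = (μ, μ) ∧ (∃ c : ℤ, z i = z 0 + (c * (2*μ+1), - (c * (2*μ+1)))) := by
    intro i
    induction i with
    | zero => intro _; exact ⟨hb, 0, by ext <;> simp⟩
    | succ i ih =>
      intro hi
      obtain ⟨b, c, hc⟩ := ih (by omega)
      have r := hcon i hi b ⟨c, hc⟩
      refine ⟨r, ?_⟩
      have s := hz.step i hi
      have n := hz.next i hi
      simp only [RI, Prod.mk.injEq] at b
      rw [b.1, b.2] at s
      unfold StepOK at s
      rw [← n, r] at s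
      rcases s with ⟨e1, e2⟩ | ⟨e1, e2, -⟩ | ⟨e1, e2, -⟩ | ⟨e1, e2, -⟩
      · refine ⟨c + 1, ?_⟩
        rw [e1, hc]
        ext <;> simp <;> ring
      · simp only [Prod.mk.injEq] at e2; omega
      · simp only [Prod.mk.injEq] at e2; omega
      · simp only [Prod.mk.injEq] at e2; omega
  have := (key S le_rfl).1
  rw [hz.fin] at this
  simp only [Prod.mk.injEq] at this
  omega

theorem bad_down_a {lam : ℝ} {G K e e' m : ℤ} (h : 0 < lam) (hGl : (G:ℝ) * lam ≤ 1)
    (hG : 20 * K + 60 ≤ G) (hK : e' ≤ K) {p : ℤ × ℤ} {i0 T : ℕ}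
    (hd : RegData lam e K e' p i0 T) (hb : Bad (fl lam) (cl lam) e m p) (hdn : e' ≤ 2 * m^2) :
    p.1 ≤ cl lam m + m - 2 := by
  by_contra hc
  have hFC := fl_FC h hGl
  obtain ⟨m1, bx, a0, b0, ab, i1, i2⟩ := hb
  simp only [RI, Prod.mk.injEq] at bx
  have mK : m ≤ K := by
    have := hd.fx
    omega
  have hT := hd.ret.i0T
  have h1 := (hd.ham 0 (by omega)).2
  have h2 := (hd.ham 2 (by omega)).2
  have c1 := cl_ge h m
  have c2 := cl_lt h m
  set C := cl lam m with hC
  obtain ⟨φ, hφ⟩ : ∃ φ : ℝ, lam * C = m + lam * φ := ⟨(lam * C - m) / lam, by field_simp; ring⟩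
  have φ0 : 0 ≤ φ := by
    by_contra hh
    have : lam * φ < 0 := mul_neg_of_pos_of_neg h (by linarith)
    linarith
  have dn : (e':ℝ) ≤ 2 * (m:ℝ)^2 := by exact_mod_cast hdn
  have m1' : (1:ℝ) ≤ m := by exact_mod_cast m1
  have P1 := (Pfun_box bx.1).1
  have P2 := (Pfun_box bx.2).1
  simp only [Function.iterate_zero, id, Ham, emb] at h1
  rw [P1, P2] at h1
  obtain ⟨a, ha⟩ : ∃ a, p.1 = C + a := ⟨p.1 - C, by ring⟩
  obtain ⟨b, hbb⟩ : ∃ b, p.2 = C - b := ⟨C - p.2, by ring⟩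
  have key : (2 * m + 1) * a < (2 * m - 1) * b := by
    by_contra hh
    have hh' : ((2 * m - 1 : ℤ):ℝ) * b ≤ ((2 * m + 1 : ℤ):ℝ) * a := by exact_mod_cast (not_lt.1 hh)
    push_cast at hh'
    rw [ha, hbb] at h1
    push_cast at h1
    have : lam * ((2 * m - 1) * b) ≤ lam * ((2 * m + 1) * a) := mul_le_mul_of_nonneg_left hh' h.le
    have : 0 ≤ lam * φ := by positivity
    have : 0 ≤ (lam * φ) * m := by positivity
    nlinarith
  have b1 : b = m := by
    have : m - 1 < b := by nlinarith
    omega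
  have a1 : a = m - 1 := by omega
  have n1 := hFC.neg1 m
  have n2 := hFC.neg2 m
  have g1 := hFC.gap (-m)
  have g2 := hFC.gap (-m-1)
  rw [show -m - 1 + 1 = -m by ring] at g2
  rw [← hC] at n1 n2
  have F1 : FI (fl lam) p = (2 * m - C, C + m - 1) := by
    unfold FI; rw [bx.1, ha, hbb, a1, b1]; ext <;> simp <;> ring
  have f1 : fl lam (2 * m - C) = -m := hFC.eq (by omega) (by omega)
  have F2 : (FI (fl lam))^[2] p = (-C - 2 * m + 1, 2 * m - C) := by
    change FI (fl lam) (FI (fl lam) p) = _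
    rw [F1]; unfold FI; simp only; rw [f1]; ext <;> simp; ring
  have f2 : fl lam (-C - 2 * m + 1) = -m - 1 := hFC.eq (by omega) (by rw [show -m - 1 + 1 = -m by ring]; omega)
  have Q1 := (Pfun_box f1).1
  have Q2 := (Pfun_box f2).1
  rw [F2] at h2
  simp only [Ham, emb] at h2
  rw [Q1, Q2] at h2
  push_cast at h2
  have : 0 ≤ (lam * φ) * m := by positivity
  have : lam * 1 ≤ lam * m := mul_le_mul_of_nonneg_left m1' h.le
  nlinarith

theorem bad_down {lam : ℝ} {G K e e' m H : ℤ} (h : 0 < lam) (hGl : (G:ℝ) * lam ≤ 1)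
    (hG : 20 * K + 60 ≤ G) (hK : e' ≤ K) (hee : e < e') {p p' l : ℤ × ℤ} {i0 T S' : ℕ}
    (hd : RegData lam e K e' p i0 T) (hb : Bad (fl lam) (cl lam) e m p) (hdn : e' ≤ 2 * m^2)
    (hz' : RPath (fl lam) (cl lam) e (m-1) (zs (fl lam) p') S') (hT : TurnDvd e (m-1) H)
    (hp' : RI (fl lam) p' = (m-1, m-1)) (hl : p' = p + l) (l1 : (2 * (m-1) + 1) ∣ l.1)
    (hH : H = (2 * (m-1) + 1) * (l.1 + l.2)) :
    ∃ i', i' ≤ S' ∧ SyncSt (fl lam) e (m-1) H (zs (fl lam) p 0) (zs (fl lam) p' i') m (m-1) := by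
  have hFC := fl_FC h hGl
  have ha := bad_down_a h hGl hG hK hd hb hdn
  obtain ⟨m1, bx, a0, b0, ab, i1, i2⟩ := hb
  have mK : m ≤ K := by
    have := hd.fx
    simp only [RI, Prod.mk.injEq] at bx
    omega
  obtain ⟨i, hi, bi, ⟨c, hc⟩, hne⟩ := exit_diag hz' (by omega) hp'
  have s := hz'.step i hi
  have n := hz'.next i hi
  simp only [RI, Prod.mk.injEq] at bi
  rw [bi.1, bi.2] at s
  unfold StepOK at s
  rw [← n] at s
  have z0 : zs (fl lam) p' 0 = p' := rfl
  rw [z0] at hc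
  have hl1 : p'.1 = p.1 + l.1 := by rw [hl]; rfl
  have hl2 : p'.2 = p.2 + l.2 := by rw [hl]; rfl
  have hc1 := congrArg Prod.fst hc
  have hc2 := congrArg Prod.snd hc
  simp only [Prod.fst_add, Prod.snd_add] at hc1 hc2
  rcases s with ⟨e1, e2⟩ | ⟨e1, e2, e3, e4, e5⟩ | ⟨e1, e2, e3, e4, e5, e6⟩ | ⟨e1, e2, e3, e4, e5, e6, e7⟩
  · exact absurd e2 hne
  · exfalso
    unfold exY at e5
    rw [if_pos (by omega), sub_add_cancel] at e5
    omega
  · rw [sub_add_cancel] at e2 e3 e4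
    have hX : (zs (fl lam) p' i).1 = p.1 - (2 * (m-1) + 1) := by
      refine eq_of_window (c := cl lam m - (2 * (m-1) + 1)) (w := 2 * (m-1)+1) ?_ (by omega) (by omega) (by omega) (by omega)
      rw [hc1, hl1]
      obtain ⟨d, hd⟩ := l1
      exact ⟨d + c + 1, by rw [hd]; ring⟩
    have f1 : fl lam (-(m-1) - 1 - (p.1 - (2 * (m-1) + 1))) = -m := by
      have n1 := hFC.neg1 m
      have n2 := hFC.neg2 m
      have g1 := hFC.gap (-m)
      exact hFC.eq (by omega) (by omega)
    rw [hX, f1] at e1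
    have E1 : (zs (fl lam) p' (i+1)).1 = p.1 := by rw [e1]; simp
    have E2 : (zs (fl lam) p' (i+1)).2 = p.2 + (l.1 + l.2) := by
      rw [e1]; simp only
      linarith
    refine ⟨i+1, hi, bx, e2, by omega, ?_, ?_, ?_⟩
    · change (2 * m + 1) * (_ - p.1) + _ * (_ - p.2) = H
      rw [E1, E2, hH]; ring
    · intro _
      change _ ∣ _ - p.2
      rw [E2]
      have := hT.xy m (m-1) (by omega) (by omega) i1 (by rw [sub_add_cancel]; linarith) (by nlinarith)
      rw [hH, mul_comm (2 * m + 1)] at this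
      have := (mul_dvd_mul_iff_left (show (2 * (m-1) + 1) ≠ 0 by omega)).1 this
      simpa using this
    · intro _
      change _ ∣ _ - p.1
      rw [E1]; simp
  · omega


/-- the Hamiltonian at a clean horizontal crossing -/
theorem ham_cross {lam : ℝ} {G m n : ℤ} (h : 0 < lam) (hGl : (G:ℝ) * lam ≤ 1) (m0 : 0 ≤ m)
    (hG : 2 * m + 5 ≤ G) {p q : ℤ × ℤ} (hb : RI (fl lam) p = (m, n))
    (hq : q = (p.1 + (n - 1) - fl lam (m - p.2), p.2 - (2 * m + 1)))
    (hq2 : RI (fl lam) q = (m, n - 1)) (c1 : cl lam n ≤ p.2) (c2 : p.2 < cl lam n + (2 * m + 1)) :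
    Ham (emb lam q) ≤ Ham (emb lam p) + lam := by
  have hFC := fl_FC h hGl
  simp only [RI, Prod.mk.injEq] at hb hq2
  have n1 := hFC.neg1 n
  have n2 := hFC.neg2 n
  have g1 := hFC.gap (-n)
  have g2 := hFC.gap (-n-1)
  rw [show -n - 1 + 1 = -n by ring] at g2
  have d1 := cl_ge h n
  have P1 := (Pfun_box hb.1).1
  have P2 := (Pfun_box hb.2).1
  have P3 := (Pfun_box hq2.1).1
  have P4 := (Pfun_box hq2.2).1
  simp only [Ham, emb]
  rw [P1, P2, P3, P4, hq]
  have c1' : (cl lam n : ℝ) ≤ p.2 := by exact_mod_cast c1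
  have m0' : (0:ℝ) ≤ m := by exact_mod_cast m0
  have yy : (n:ℝ) ≤ lam * p.2 := (Pfun_box hb.2).2.1
  by_cases hc : fl lam (m - p.2) = -n
  · rw [hc]
    push_cast
    nlinarith
  · have hx : m - p.2 < cl lam (-n) := by
      by_contra hh
      exact hc (hFC.eq (by omega) (by omega))
    have hc2 : fl lam (m - p.2) = -n - 1 :=
      hFC.eq (by omega) (by rw [show -n - 1 + 1 = -n by ring]; exact hx)
    rw [hc2]
    have c3 : cl lam n + m ≤ p.2 := by omega
    have c3' : (cl lam n : ℝ) + m ≤ p.2 := by exact_mod_cast c3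
    have : lam * ((cl lam n : ℝ) + m) ≤ lam * p.2 := mul_le_mul_of_nonneg_left c3' h.le
    push_cast
    nlinarith

theorem up_e {lam : ℝ} {G K e e' m : ℤ} (h : 0 < lam) (hGl : (G:ℝ) * lam ≤ 1)
    (hG : 100 * (K + 2)^2 ≤ G) (hK : e' ≤ K) {p : ℤ × ℤ} {i0 T : ℕ}
    (hd : RegData lam e K e' p i0 T) (hb : Bad (fl lam) (cl lam) e m p) (hup : 2 * m^2 ≤ e) :
    e = 2 * m^2 ∧ Ham (emb lam p) ≤ 2 * (m:ℝ)^2 + lam * (4 * m^2 - 1) := by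
  obtain ⟨m1, bx, a0, b0, ab, i1, i2⟩ := hb
  simp only [RI, Prod.mk.injEq] at bx
  have mK : m ≤ K := by
    have := hd.fx
    omega
  have h1 := (hd.ham 0 (by omega)).1
  have c1 := cl_ge h m
  have c2 := cl_lt h m
  have P1 := (Pfun_box bx.1).1
  have P2 := (Pfun_box bx.2).1
  have m1' : (1:ℝ) ≤ m := by exact_mod_cast m1
  have key : Ham (emb lam p) ≤ 2 * (m:ℝ)^2 + lam * (4 * m^2 - 1) := by
    simp only [Ham, emb]
    rw [P1, P2]
    push_cast
    have x1 : (p.1:ℝ) ≤ p.2 + (2 * m - 1) := by exact_mod_cast (show p.1 ≤ p.2 + (2 * m - 1) by omega)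
    have y1 : (p.2:ℝ) ≤ cl lam m - 1 := by exact_mod_cast (show p.2 ≤ cl lam m - 1 by omega)
    have x2 : lam * p.1 ≤ lam * (p.2 + (2 * m - 1)) := mul_le_mul_of_nonneg_left x1 h.le
    have y2 : lam * p.2 ≤ lam * (cl lam m - 1) := mul_le_mul_of_nonneg_left y1 h.le
    have y3 : lam * p.2 ≤ m := by linarith
    have x3 : lam * p.1 - m ≤ lam * (2 * m - 1) := by linarith
    have : (2 * (m:ℝ) + 1) * (lam * p.1 - m) ≤ (2 * (m:ℝ) + 1) * (lam * (2 * m - 1)) :=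
      mul_le_mul_of_nonneg_left x3 (by linarith)
    nlinarith
  refine ⟨?_, key⟩
  have h1' : (e:ℝ) < Ham (emb lam p) := h1
  have : (4 * (m:ℝ)^2 - 1) * lam ≤ 1 := by
    have g : 4 * m^2 - 1 ≤ G := by nlinarith
    have g' : (4 * (m:ℝ)^2 - 1) ≤ G := by exact_mod_cast g
    have := mul_le_mul_of_nonneg_right g' h.le
    linarith
  have : (e:ℝ) < 2 * (m:ℝ)^2 + 1 := by linarith
  have : e < 2 * m^2 + 1 := by exact_mod_cast this
  omega

theorem up_direct {lam : ℝ} {G K e e' m : ℤ} (h : 0 < lam) (hGl : (G:ℝ) * lam ≤ 1)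
    (hG : 100 * (K + 2)^2 ≤ G) (hK : e' ≤ K) {p : ℤ × ℤ} {i0 T S : ℕ}
    (hd : RegData lam e K e' p i0 T) (hb : Bad (fl lam) (cl lam) e m p) (hup : 2 * m^2 ≤ e)
    (hm : m ≤ 2) (hz : RPath (fl lam) (cl lam) e m (zs (fl lam) p) S) (hS : S ≤ T + 1) : False := by
  have hFC := fl_FC h hGl
  obtain ⟨ee, hh⟩ := up_e h hGl hG hK hd hb hup
  have fx := hd.fx
  obtain ⟨m1, bx, a0, b0, ab, i1, i2⟩ := hb
  have bx' := bx
  simp only [RI, Prod.mk.injEq] at bx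
  have hG' : 2 * m + 5 ≤ G := by nlinarith
  have key : ∀ i, i ≤ S → ∃ n, RI (fl lam) (zs (fl lam) p i) = (m, n) ∧ -m ≤ n ∧ n ≤ m - 1 ∧
      Ham (emb lam (zs (fl lam) p i)) ≤ Ham (emb lam p) + lam * (m - 1 - n) := by
    intro i
    induction i with
    | zero =>
      intro _
      refine ⟨m - 1, bx', by omega, le_rfl, ?_⟩
      push_cast
      have : zs (fl lam) p 0 = p := rfl
      rw [this]; linarith
    | succ i ih =>
      intro hi
      obtain ⟨n, b, n1, n2, hn⟩ := ih (by omega)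
      have s := hz.step i hi
      have nx := hz.next i hi
      have b' := b
      simp only [RI, Prod.mk.injEq] at b
      rw [b.1, b.2] at s
      have hex : exY e m n := by
        unfold exY
        split_ifs with c
        · rw [ee]; nlinarith
        · rw [ee]; nlinarith
      have hns := hd.ns (4 * i) (by omega)
      change NS _ _ (zs (fl lam) p i) at hns
      unfold StepOK at s
      unfold NS at hns
      rw [← nx] at s hns
      rcases s with ⟨e1, e2⟩ | ⟨e1, e2, e3, e4, e5⟩ | ⟨e1, e2, e3, e4, e5, e6⟩ | ⟨e1, e2, e3, e4, e5, e6, e7⟩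
      · refine ⟨n, e2, n1, n2, ?_⟩
        have : Ham (emb lam (zs (fl lam) p (i+1))) = Ham (emb lam (zs (fl lam) p i)) := by
          simp only [RI, Prod.mk.injEq] at e2
          simp only [Ham, emb]
          rw [(Pfun_box b.1).1, (Pfun_box b.2).1, (Pfun_box e2.1).1, (Pfun_box e2.2).1, e1]
          push_cast; ring
        rw [this]; exact hn
      · have hx := ham_cross h hGl (by omega) hG' b' e1 e2 e3 e4
        rcases n1.lt_or_eq with c | c
        · refine ⟨n - 1, e2, by omega, by omega, ?_⟩
          push_cast
          linarith
        · exfalso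
          have nc := hns (by rw [e2, b']; simp) m n
          have x1 : cl lam m + (2 * m + 3) ≤ (zs (fl lam) p i).1 := by
            by_contra hcc
            apply nc
            have := hFC.low (zs (fl lam) p i).1
            rw [b.1] at this
            exact NC_ext (X := (zs (fl lam) p i).1) (Y := (zs (fl lam) p i).2) (r := 2 * m + 2) (s := 2 * m) (by omega)
              (by omega) (by omega) (by omega) (by omega) (by omega)
          have y1 : (zs (fl lam) p i).2 ≤ cl lam n + 2 * m := by omega
          have x1' : (cl lam m:ℝ) + (2 * m + 3) ≤ (zs (fl lam) p i).1 := by exact_mod_cast x1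
          have y1' : ((zs (fl lam) p i).2:ℝ) ≤ cl lam n + 2 * m := by exact_mod_cast y1
          have c1 := cl_ge h m
          have c2 := cl_lt h n
          have x2 := mul_le_mul_of_nonneg_left x1' h.le
          have y2 := mul_le_mul_of_nonneg_left y1' h.le
          subst c
          simp only [Ham, emb] at hn hh
          rw [(Pfun_box b.1).1, (Pfun_box b.2).1] at hn
          push_cast at hn y1' y2 c2
          have m1' : (1:ℝ) ≤ m := by exact_mod_cast m1
          have x3 : lam * (2 * m + 3) ≤ lam * (zs (fl lam) p i).1 - m := by linarith
          have y3 : lam * (zs (fl lam) p i).2 + m ≤ lam * (2 * m + 1) := by linarith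
          have x4 := mul_le_mul_of_nonneg_left x3 (show 0 ≤ 2 * (m:ℝ) + 1 by linarith)
          have y4 := mul_le_mul_of_nonneg_left y3 (show 0 ≤ 2 * (m:ℝ) - 1 by linarith)
          have fin : lam * (8 * m + 4) ≤ lam * (4 * m^2 - 1 + (2 * m - 1)) := by
            nlinarith
          have fin2 := le_of_mul_le_mul_left fin h
          have fin3 : 8 * m + 4 ≤ 4 * m^2 - 1 + (2 * m - 1) := by exact_mod_cast fin2
          nlinarith
      · exact absurd hex e6
      · exact absurd hex e7
  obtain ⟨n, b, n1, n2, -⟩ := key S le_rfl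
  rw [hz.fin] at b
  simp only [Prod.mk.injEq] at b
  omega


theorem FC.refl_pos {f C : ℤ → ℤ} {G : ℤ} (h : FC f C G) {a Y : ℤ} (a0 : 0 ≤ a) :
    0 ≤ f Y + f (a - Y) + 1 := by
  have h1 := (h.iff (-(f Y + 1)) (a - Y)).2 (by
    have := h.neg2 (f Y + 1)
    have := h.high Y
    omega)
  omega

theorem FC.refl_neg {f C : ℤ → ℤ} {G : ℤ} (h : FC f C G) {a Y : ℤ} (a0 : a < 0) :
    f Y + f (a - Y) + 1 ≤ 0 := by
  by_contra hc
  have h1 := (h.iff (-(f Y)) (a - Y)).1 (by omega)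
  have := h.neg1 (f Y)
  have := h.low Y
  omega

theorem FC.refl_one {f C : ℤ → ℤ} {G : ℤ} (h : FC f C G) {a Y : ℤ} (a1 : -G ≤ a) (a2 : a < G) :
    -1 ≤ f Y + f (a - Y) + 1 ∧ f Y + f (a - Y) + 1 ≤ 1 := by
  constructor
  · have h1 := (h.iff (-(f Y + 1 + 1)) (a - Y)).2 (by
      have := h.neg2 (f Y + 1 + 1)
      have := h.high Y
      have := h.gap (f Y + 1)
      omega)
    omega
  · by_contra hc
    have h1 := (h.iff (-(f Y - 1)) (a - Y)).1 (by omega)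
    have := h.neg1 (f Y - 1)
    have := h.low Y
    have := h.gap (f Y - 1)
    rw [sub_add_cancel] at this
    omega

/-- floor defect at a step of the map -/
def Dd (f : ℤ → ℤ) (p : ℤ × ℤ) : ℤ := |f p.2 + f (f p.1 - p.2) + 1|

/-- corrected energy -/
noncomputable def En (lam : ℝ) (p : ℤ × ℤ) : ℝ :=
  Ham (emb lam p) / lam - (fl lam p.1 : ℝ) * (fl lam p.2 : ℝ)

theorem En_step {lam : ℝ} {G : ℤ} (h : 0 < lam) (hGl : (G:ℝ) * lam ≤ 1) {p : ℤ × ℤ}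
    (g1 : -G ≤ fl lam p.1) (g2 : fl lam p.1 < G) :
    |En lam (FI (fl lam) p) - En lam p| ≤ |(fl lam p.1 : ℝ)| * (Dd (fl lam) p : ℝ) := by
  have hFC := fl_FC h hGl
  obtain ⟨X, Y⟩ := p
  simp only at g1 g2
  obtain ⟨r1, r2⟩ := hFC.refl_one (Y := Y) g1 g2
  have hpos := fun a0 => hFC.refl_pos (a := fl lam X) (Y := Y) a0
  have hneg := fun a0 => hFC.refl_neg (a := fl lam X) (Y := Y) a0
  simp only [En, FI, Dd, Ham, emb]
  obtain ⟨P1, l1, u1⟩ := Pfun_box (lam := lam) (X := Y) rfl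
  obtain ⟨P2, l2, u2⟩ := Pfun_box (lam := lam) (X := fl lam X - Y) rfl
  rw [P1, P2]
  generalize fl lam X = a at *
  generalize fl lam Y = n at *
  generalize hk : fl lam (a - Y) = k at *
  have hc : n + k + 1 = 0 ∨ (0 ≤ a ∧ n + k + 1 = 1) ∨ (a < 0 ∧ n + k + 1 = -1) := by
    rcases le_or_gt 0 a with a0 | a0
    · have := hpos a0; omega
    · have := hneg a0; omega
  have key : ∀ t : ℝ, lam * t = ((k : ℝ)^2 + (2 * k + 1) * (lam * ((a - Y : ℤ):ℝ) - k)) -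
      ((n : ℝ)^2 + (2 * n + 1) * (lam * (Y:ℝ) - n)) - lam * (a * k - a * n) →
      |t| ≤ |(a:ℝ)| * ((|n + k + 1| : ℤ) : ℝ) := by
    intro t ht
    push_cast at ht l2 u2
    rcases hc with hc | ⟨a0, hc⟩ | ⟨a0, hc⟩
    · have hk' : (k:ℝ) = - n - 1 := by exact_mod_cast (show k = -n - 1 by omega)
      rw [hk'] at ht
      have : lam * t = 0 := by rw [ht]; ring
      have : t = 0 := by
        rcases mul_eq_zero.1 this with h' | h'
        · exact absurd h' h.ne'
        · exact h'
      rw [this, hc]; simp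
    · have hk' : (k:ℝ) = - n := by exact_mod_cast (show k = -n by omega)
      rw [hk'] at ht l2 u2
      have e1 : lam * t = lam * a + 2 * (n - lam * Y) := by rw [ht]; ring
      have a0' : (0:ℝ) ≤ a := by exact_mod_cast a0
      rw [hc, abs_of_nonneg a0']
      simp only [abs_one, Int.cast_one, mul_one]
      rw [abs_le]
      constructor
      · refine le_of_mul_le_mul_left ?_ h
        linarith
      · refine le_of_mul_le_mul_left ?_ h
        linarith
    · have hk' : (k:ℝ) = - n - 2 := by exact_mod_cast (show k = -n - 2 by omega)
      rw [hk'] at ht l2 u2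
      have e1 : lam * t = - (lam * a) + 2 * (lam * Y - n - 1) := by rw [ht]; ring
      have a0' : (a:ℝ) < 0 := by exact_mod_cast a0
      rw [hc, abs_of_neg a0']
      simp only [abs_neg, abs_one, Int.cast_one, mul_one]
      rw [abs_le]
      constructor
      · refine le_of_mul_le_mul_left ?_ h
        linarith
      · refine le_of_mul_le_mul_left ?_ h
        linarith
  apply key
  field_simp
  ring

theorem Dd_nonneg (f : ℤ → ℤ) (p : ℤ × ℤ) : 0 ≤ Dd f p := abs_nonneg _

theorem Dd_le {f C : ℤ → ℤ} {G : ℤ} (h : FC f C G) {p : ℤ × ℤ} (g1 : -G ≤ f p.1) (g2 : f p.1 < G) :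
    Dd f p ≤ 1 := by
  unfold Dd
  rw [abs_le]
  exact h.refl_one g1 g2

/-- total defect over a block of four steps -/
theorem block {f C : ℤ → ℤ} {G M : ℤ} (h : FC f C G) (hG : M + 10 ≤ G) {p : ℤ × ℤ}
    (x0 : 0 ≤ f p.1) (xy : f p.1 < p.2) (xM : f p.1 ≤ M) (yM : f p.2 ≤ M) :
    let p1 := FI f p
    let p2 := FI f p1
    let p3 := FI f p2
    (Dd f p ≤ 1 ∧ Dd f p1 ≤ 1 ∧ Dd f p2 ≤ 1 ∧ Dd f p3 ≤ 1) ∧ -1 ≤ f (F4 f p).2 ∧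
    (-M - 2 ≤ f p.1 ∧ -M - 2 ≤ f p1.1 ∧ -M - 2 ≤ f p2.1 ∧ -M - 2 ≤ f p3.1 ∧ -M - 2 ≤ f (F4 f p).1) ∧
    (f p1.1 ≤ M + 2 ∧ f p2.1 ≤ M + 2 ∧ f p3.1 ≤ M + 2 ∧ f (F4 f p).1 ≤ M + 2) ∧
    Dd f p + Dd f p1 + Dd f p2 + Dd f p3 ≤ (f p.2 - f p.1) - (f (F4 f p).2 - f (F4 f p).1) + 2 ∧
    (0 ≤ f (F4 f p).2 →
      Dd f p + Dd f p1 + Dd f p2 + Dd f p3 ≤ (f p.2 - f p.1) - (f (F4 f p).2 - f (F4 f p).1)) := by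
  intro p1 p2 p3
  obtain ⟨X, Y⟩ := p
  simp only at x0 xy xM yM
  have y0 : 0 ≤ f Y := h.nonneg.2 (by omega)
  obtain ⟨q0l, q0u⟩ := h.refl_one (a := f X) (Y := Y) (by omega) (by omega)
  have q0p := h.refl_pos (a := f X) (Y := Y) x0
  have n1 : f (f X - Y) < 0 := h.neg.2 (by omega)
  obtain ⟨q1l, q1u⟩ := h.refl_one (a := f (f X - Y)) (Y := X) (by omega) (by omega)
  have q1p := h.refl_neg (a := f (f X - Y)) (Y := X) n1
  obtain ⟨q2l, q2u⟩ := h.refl_one (a := f (f (f X - Y) - X)) (Y := f X - Y) (by omega) (by omega)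
  have q2p := h.refl_neg (a := f (f (f X - Y) - X)) (Y := f X - Y) (by omega)
  obtain ⟨q3l, q3u⟩ := h.refl_one (a := f (f (f (f X - Y) - X) - (f X - Y))) (Y := f (f X - Y) - X)
    (by omega) (by omega)
  have q3p := fun a0 => h.refl_pos (a := f (f (f (f X - Y) - X) - (f X - Y))) (Y := f (f X - Y) - X) a0
  simp only [p1, p2, p3, Dd, F4, FI]
  have hmax : |f (f (f X - Y) - X) + f (f (f (f (f X - Y) - X) - (f X - Y)) - (f (f X - Y) - X)) + 1| ≤
      f (f (f X - Y) - X) + f (f (f (f (f X - Y) - X) - (f X - Y)) - (f (f X - Y) - X)) + 1 + 2 := by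
    rw [abs_le]; omega
  rw [abs_of_nonneg q0p, abs_of_nonpos q1p, abs_of_nonpos q2p]
  generalize f (f (f (f (f X - Y) - X) - (f X - Y)) - (f (f X - Y) - X)) = a4 at *
  generalize f (f (f (f X - Y) - X) - (f X - Y)) = a3 at *
  generalize f (f (f X - Y) - X) = a2 at *
  generalize f (f X - Y) = a1 at *
  refine ⟨⟨by omega, by omega, by omega, by rw [abs_le]; omega⟩, by omega, ⟨by omega, by omega, by omega, by omega, by omega⟩,
    ⟨by omega, by omega, by omega, by omega⟩, by omega, ?_⟩
  intro a0
  rw [abs_of_nonneg (q3p a0)]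
  omega


/-- accumulated defect -/
def Vs (f : ℤ → ℤ) (p : ℤ × ℤ) (k : ℕ) : ℤ := ∑ j ∈ Finset.range k, Dd f ((FI f)^[j] p)

theorem Vs_succ (f : ℤ → ℤ) (p : ℤ × ℤ) (k : ℕ) : Vs f p (k+1) = Vs f p k + Dd f ((FI f)^[k] p) := by
  unfold Vs; rw [Finset.sum_range_succ]

theorem Vs_mono (f : ℤ → ℤ) (p : ℤ × ℤ) {k l : ℕ} (hk : k ≤ l) : Vs f p k ≤ Vs f p l := by
  unfold Vs
  exact Finset.sum_le_sum_of_subset_of_nonneg (Finset.range_mono hk) (fun _ _ _ => Dd_nonneg f _)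

theorem Vs_four (f : ℤ → ℤ) (p : ℤ × ℤ) (k : ℕ) : Vs f p (k+4) = Vs f p k +
    (Dd f ((FI f)^[k] p) + Dd f (FI f ((FI f)^[k] p)) + Dd f (FI f (FI f ((FI f)^[k] p))) +
      Dd f (FI f (FI f (FI f ((FI f)^[k] p))))) := by
  rw [show k + 4 = k + 1 + 1 + 1 + 1 from rfl, Vs_succ, Vs_succ, Vs_succ, Vs_succ]
  simp only [Function.iterate_succ_apply']
  ring

theorem En_bound {lam : ℝ} {G W : ℤ} (h : 0 < lam) (hGl : (G:ℝ) * lam ≤ 1) (hW : W < G) {p : ℤ × ℤ} {N : ℕ}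
    (hb : ∀ k, k ≤ N → |fl lam ((FI (fl lam))^[k] p).1| ≤ W) (k : ℕ) (hk : k ≤ N) :
    |En lam ((FI (fl lam))^[k] p) - En lam p| ≤ (W:ℝ) * (Vs (fl lam) p k : ℝ) := by
  induction k with
  | zero => simp [Vs]
  | succ k ih =>
    have ih := ih (by omega)
    have hb' := hb k (by omega)
    have hb2 := abs_le.1 hb'
    have st := En_step (p := (FI (fl lam))^[k] p) h hGl (by omega) (by omega)
    rw [← Function.iterate_succ_apply' (FI (fl lam))] at st
    rw [Vs_succ]
    push_cast
    have hD : (0:ℝ) ≤ (Dd (fl lam) ((FI (fl lam))^[k] p) : ℝ) := by exact_mod_cast Dd_nonneg _ _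
    have h3 : |(fl lam ((FI (fl lam))^[k] p).1 : ℝ)| ≤ W := by exact_mod_cast hb'
    have h4 := mul_le_mul_of_nonneg_right h3 hD
    have h5 := abs_sub_le (En lam ((FI (fl lam))^[k+1] p)) (En lam ((FI (fl lam))^[k] p)) (En lam p)
    linarith

theorem ret_bounds {f C : ℤ → ℤ} {G K : ℤ} (h : FC f C G) (hG : K + 10 ≤ G) {p : ℤ × ℤ} {i0 T : ℕ}
    (hr : Ret f K p i0 T) (k : ℕ) (hk : k ≤ 4 * T + 1) : |f ((FI f)^[k] p).1| ≤ K + 2 := by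
  have main : ∀ q : ℤ × ℤ, 0 ≤ f q.1 → f q.1 < q.2 → f q.1 ≤ K → f q.2 ≤ K → ∀ j : ℕ, j ≤ 4 →
      |f ((FI f)^[j] q).1| ≤ K + 2 := by
    intro q h1 h2 h3 h4 j hj
    obtain ⟨-, -, ⟨c0, c1, c2, c3, c4⟩, ⟨d1, d2, d3, d4⟩, -⟩ := block h hG h1 h2 h3 h4
    rw [abs_le]
    interval_cases j
    · simp only [Function.iterate_zero, id]; omega
    · show _ ≤ f (FI f q).1 ∧ f (FI f q).1 ≤ _
      omega
    · show _ ≤ f (FI f (FI f q)).1 ∧ f (FI f (FI f q)).1 ≤ _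
      omega
    · show _ ≤ f (FI f (FI f (FI f q))).1 ∧ f (FI f (FI f (FI f q))).1 ≤ _
      omega
    · show _ ≤ f (F4 f q).1 ∧ f (F4 f q).1 ≤ _
      omega
  have i0p := hr.i0p
  have i0T := hr.i0T
  rcases le_or_gt k (4 * i0) with hc | hc
  · obtain ⟨i, j, hi, hj, rfl⟩ : ∃ i j, i < i0 ∧ j ≤ 4 ∧ k = j + 4 * i := by
      rcases lt_or_eq_of_le hc with hc | hc
      · exact ⟨k / 4, k % 4, by omega, by omega, by omega⟩
      · exact ⟨i0 - 1, 4, by omega, by omega, by omega⟩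
    obtain ⟨r1, r2, r3, r4⟩ := hr.ph1 i hi
    rw [Function.iterate_add_apply]
    exact main (zs f p i) (h.nonneg.2 (by omega)) r1 r3 r4 j hj
  · obtain ⟨i, j, hi0, hi, hj, rfl⟩ : ∃ i j, i0 ≤ i ∧ i < T ∧ j ≤ 4 ∧ k = j + (4 * i + 1) := by
      rcases lt_or_eq_of_le hk with hk | hk
      · exact ⟨(k - 1) / 4, (k - 1) % 4, by omega, by omega, by omega, by omega⟩
      · exact ⟨T - 1, 4, by omega, by omega, by omega, by omega⟩
    obtain ⟨r1, r2, r3, r4, -⟩ := hr.ph2 i hi0 hi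
    rw [Function.iterate_add_apply, Function.iterate_succ_apply']
    exact main (FI f (zs f p i)) (h.nonneg.2 r2) r1 r3 r4 j hj

theorem Vs_total {f C : ℤ → ℤ} {G K M : ℤ} (h : FC f C G) (hG : K + 10 ≤ G) {p : ℤ × ℤ} {i0 T : ℕ}
    (hr : Ret f K p i0 T) (h0 : f p.1 = f p.2) (hM : f (zs f p i0).1 ≤ M) :
    Vs f p (4 * T + 1) ≤ 2 * M + 8 := by
  have i0p := hr.i0p
  have i0T := hr.i0T
  have A : ∀ i, i < i0 → Vs f p (4 * i) ≤ f (zs f p i).1 - f (zs f p i).2 := by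
    intro i
    induction i with
    | zero =>
      intro _
      have : zs f p 0 = p := rfl
      rw [this, h0]; simp [Vs]
    | succ i ih =>
      intro hi
      have ih := ih (by omega)
      obtain ⟨r1, r2, r3, r4⟩ := hr.ph1 i (by omega)
      obtain ⟨s1, s2, s3, s4⟩ := hr.ph1 (i+1) hi
      obtain ⟨-, -, -, -, -, hb⟩ := block h hG (h.nonneg.2 (by omega)) r1 r3 r4
      rw [← zs_succ] at hb
      have := h.nonneg.2 (show 0 ≤ (zs f p (i+1)).1 by omega)
      have hb := hb (h.nonneg.2 (by omega))
      rw [show 4 * (i+1) = 4 * i + 4 from rfl, Vs_four]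
      unfold zs at *
      omega
  have B : Vs f p (4 * i0) ≤ M + 3 ∧ 0 ≤ f (zs f p i0).1 := by
    obtain ⟨i, rfl⟩ : ∃ i, i0 = i + 1 := ⟨i0 - 1, by omega⟩
    have ih := A i (by omega)
    obtain ⟨r1, r2, r3, r4⟩ := hr.ph1 i (by omega)
    obtain ⟨-, hl, -, -, hb, -⟩ := block h hG (h.nonneg.2 (by omega)) r1 r3 r4
    obtain ⟨s1, s2, s3, s4, -⟩ := hr.ph2 (i+1) (by omega) (by omega)
    have s5 : f (zs f p (i+1)).1 ≤ K := by
      simp only [FI] at s4; exact s4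
    rw [← zs_succ] at hb hl
    rw [show 4 * (i+1) = 4 * i + 4 from rfl, Vs_four]
    refine ⟨by unfold zs at *; omega, ?_⟩
    have s6 := h.nonneg.2 s2
    simp only [FI] at s1 s6
    exact h.nonneg.2 (by omega)
  obtain ⟨s1, s2, s3, s4, -⟩ := hr.ph2 i0 le_rfl (by omega)
  have s6 := h.nonneg.2 s2
  have C1 : Vs f p (4 * i0 + 1) ≤ M + 4 := by
    rw [Vs_succ]
    have := Dd_le h (p := (FI f)^[4 * i0] p) (by unfold zs at B; omega) (by
      simp only [FI] at s4; unfold zs at s4; omega)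
    omega
  have D : ∀ j, i0 + j < T → Vs f p (4 * (i0 + j) + 1) ≤ 2 * M + 4 -
      (f (FI f (zs f p (i0 + j))).2 - f (FI f (zs f p (i0 + j))).1) := by
    intro j
    induction j with
    | zero =>
      intro _
      have e2 : (FI f (zs f p i0)).2 = (zs f p i0).1 := rfl
      simp only [add_zero]
      rw [e2]
      omega
    | succ j ih =>
      intro hj
      have ih := ih (by omega)
      obtain ⟨r1, r2, r3, r4, -⟩ := hr.ph2 (i0 + j) (by omega) (by omega)
      obtain ⟨u1, u2, u3, u4, -⟩ := hr.ph2 (i0 + j + 1) (by omega) (by omega)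
      obtain ⟨-, -, -, -, -, hb⟩ := block h hG (h.nonneg.2 r2) r1 r3 r4
      rw [← iter_comm, ← zs_succ] at hb
      have := h.nonneg.2 u2
      have hb := hb (h.nonneg.2 (by omega))
      have e3 : Vs f p (4 * (i0 + j + 1) + 1) = _ := Vs_four f p (4 * (i0 + j) + 1)
      rw [Function.iterate_succ_apply'] at e3
      rw [← add_assoc]
      unfold zs at *
      omega
  obtain ⟨j, rfl⟩ : ∃ j, T = i0 + j + 1 := ⟨T - i0 - 1, by omega⟩
  have D1 := D j (by omega)
  obtain ⟨r1, r2, r3, r4, r5, -⟩ := hr.ph2 (i0 + j) (by omega) (by omega)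
  have r6 : f (FI f (zs f p (i0 + j))).1 ≤ f (FI f (zs f p (i0 + j))).2 := by
    apply h.mono
    unfold uu at r5; omega
  obtain ⟨⟨b1, b2, b3, b4⟩, -⟩ := block h hG (h.nonneg.2 r2) r1 r3 r4
  rw [show 4 * (i0 + j + 1) + 1 = (4 * (i0 + j) + 1) + 4 by ring, Vs_four]
  rw [Function.iterate_succ_apply']
  unfold zs at *
  omega


theorem ham_dev {lam : ℝ} {G W V : ℤ} (h : 0 < lam) (hGl : (G:ℝ) * lam ≤ 1) (hW : W < G) (W0 : 0 ≤ W)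
    {p : ℤ × ℤ} {N : ℕ}
    (hb : ∀ k, k ≤ N → |fl lam ((FI (fl lam))^[k] p).1| ≤ W) (hp : |fl lam p.2| ≤ W)
    (hV : Vs (fl lam) p N ≤ V) (k : ℕ) (hk : k ≤ N) :
    |Ham (emb lam ((FI (fl lam))^[k] p)) - Ham (emb lam p) + lam * (fl lam p.1 * fl lam p.2)| ≤
      lam * (W * V + W^2) := by
  have h1 := En_bound h hGl hW hb k hk
  have h2 : (Vs (fl lam) p k : ℝ) ≤ V := by exact_mod_cast (Vs_mono _ p hk).trans hV
  have W0' : (0:ℝ) ≤ W := by exact_mod_cast W0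
  have h3 := h1.trans (mul_le_mul_of_nonneg_left h2 W0')
  have h4 : |fl lam ((FI (fl lam))^[k] p).2| ≤ W := by
    cases k with
    | zero => exact hp
    | succ k =>
      rw [Function.iterate_succ_apply']
      exact hb k (by omega)
  have h5 : |(fl lam ((FI (fl lam))^[k] p).1 : ℝ) * fl lam ((FI (fl lam))^[k] p).2| ≤ (W:ℝ)^2 := by
    rw [abs_mul, sq]
    exact mul_le_mul (by exact_mod_cast hb k hk) (by exact_mod_cast h4) (abs_nonneg _) W0'
  simp only [En] at h3
  rw [show Ham (emb lam ((FI (fl lam))^[k] p)) - Ham (emb lam p) + lam * (fl lam p.1 * fl lam p.2) =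
    lam * ((Ham (emb lam ((FI (fl lam))^[k] p)) / lam - fl lam ((FI (fl lam))^[k] p).1 * fl lam ((FI (fl lam))^[k] p).2 -
      (Ham (emb lam p) / lam - fl lam p.1 * fl lam p.2)) +
      fl lam ((FI (fl lam))^[k] p).1 * fl lam ((FI (fl lam))^[k] p).2) by field_simp; ring]
  rw [abs_mul, abs_of_pos h]
  refine mul_le_mul_of_nonneg_left ?_ h.le
  refine (abs_add_le _ _).trans ?_
  linarith

theorem sqrt_bound {e e' M : ℤ} (hE : ∀ a b : ℤ, a^2 + b^2 ≤ e ∨ e' ≤ a^2 + b^2) (M0 : 0 ≤ M)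
    (hM : e < (M + 1)^2) {x y : ℝ} (hx : Pfun x + Pfun y < e') : |⌊x⌋| ≤ M + 1 ∧ ⌊x⌋ ≤ M := by
  have y0 : 0 ≤ Pfun y := by
    rcases Pfun_nonneg y with h | h
    · exact h.1
    · nlinarith
  rcases Pfun_nonneg x with hc | hc
  · have : (⌊x⌋:ℝ)^2 < e' := by linarith
    have h1 : ⌊x⌋^2 < e' := by exact_mod_cast this
    have h2 : ⌊x⌋^2 ≤ e := by
      rcases hE ⌊x⌋ 0 with h | h
      · simpa using h
      · exfalso; simp only [ne_eq, OfNat.ofNat_ne_zero, not_false_eq_true, zero_pow, add_zero] at h; omega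
    have h3 := abs_lt_of_sq_lt_sq (h2.trans_lt hM) (by omega)
    have h4 := le_abs_self ⌊x⌋
    omega
  · have : ((⌊x⌋:ℝ)+1)^2 < e' := by linarith [hc.2]
    have h1 : (⌊x⌋+1)^2 < e' := by exact_mod_cast this
    have h2 : (⌊x⌋+1)^2 ≤ e := by
      rcases hE (⌊x⌋+1) 0 with h | h
      · simpa using h
      · exfalso; simp only [ne_eq, OfNat.ofNat_ne_zero, not_false_eq_true, zero_pow, add_zero] at h; omega
    have h3 := abs_lt.1 (abs_lt_of_sq_lt_sq (h2.trans_lt hM) (by omega))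
    have := hc.1
    rw [abs_le]
    omega

theorem special_geo {f C : ℤ → ℤ} {G m : ℤ} (h : FC f C G) (hG : 20 * m + 20 ≤ G) (m1 : 1 ≤ m) :
    RI f (C m + 4 * m, C m + 2 * m) = (m, m) ∧
    F4 f (C m + 4 * m, C m + 2 * m) = (C m + 6 * m, C m - 1) ∧
    XI f (C m + 4 * m, C m + 2 * m) ∧ RI f (C m + 6 * m, C m - 1) ≠ (m, m) := by
  have g := h.gap m
  have g' := h.gap (m+1)
  have gm := h.gap (m-1)
  rw [sub_add_cancel] at gm
  have n1 := h.neg1 m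
  have n2 := h.neg2 (m+1)
  have n3 := h.neg2 m
  have c0 : 0 ≤ C m := by
    have := h.mulG (k := m) (by omega)
    nlinarith
  have fin : ∀ t, 0 ≤ t → t < G → f (C m + t) = m := fun t t0 t1 => h.eq (by omega) (by omega)
  have fneg : ∀ t, 1 ≤ t → t < G → f (-t - C m) = -m - 1 := by
    intro t t0 t1
    apply h.eq
    · rw [show -m - 1 = -(m+1) by ring]; omega
    · rw [show -m - 1 + 1 = -m by ring]; omega
  have fprev : f (C m - 1) = m - 1 := h.eq (by omega) (by rw [sub_add_cancel]; omega)
  have e1 : F4 f (C m + 4 * m, C m + 2 * m) = (C m + 6 * m, C m - 1) := by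
    rw [F4_eq f (C m + 4 * m) (C m + 2 * m) (a1 := m) (a2 := -m - 1) (a3 := -m - 1) (a4 := m - 1)]
    · ext <;> simp <;> ring
    · exact fin _ (by omega) (by omega)
    · rw [show m - (C m + 2 * m) = -m - C m by ring]; exact fneg _ (by omega) (by omega)
    · rw [show -m - 1 - (C m + 4 * m) = -(5 * m + 1) - C m by ring]; exact fneg _ (by omega) (by omega)
    · rw [show C m + 2 * m + (-m - 1) - m = C m - 1 by ring]; exact fprev
  have e2 : F4 f (C m + 2 * m, C m + 4 * m) = (C m + 4 * m + 1, C m + 2 * m - 1) := by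
    rw [F4_eq f (C m + 2 * m) (C m + 4 * m) (a1 := m) (a2 := -m - 1) (a3 := -m - 1) (a4 := m)]
    · ext <;> simp <;> ring
    · exact fin _ (by omega) (by omega)
    · rw [show m - (C m + 4 * m) = -(3 * m) - C m by ring]; exact fneg _ (by omega) (by omega)
    · rw [show -m - 1 - (C m + 2 * m) = -(3 * m + 1) - C m by ring]; exact fneg _ (by omega) (by omega)
    · rw [show C m + 4 * m + (-m - 1) - m = C m + (2 * m - 1) by ring]; exact fin _ (by omega) (by omega)
  refine ⟨?_, e1, ⟨by simp only; omega, by simp only; omega, ?_, ?_⟩, ?_⟩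
  · simp only [RI, Prod.mk.injEq]
    exact ⟨fin _ (by omega) (by omega), fin _ (by omega) (by omega)⟩
  · rw [e1]; unfold dI; simp only
    rw [abs_of_nonneg (by omega), abs_of_nonneg (by omega)]; omega
  · simp only [Prod.swap]
    rw [e2]; unfold dI; simp only
    rw [abs_of_nonneg (by omega), abs_of_nonneg (by omega)]; omega
  · simp only [RI, ne_eq, Prod.mk.injEq, fprev]
    omega

theorem num_M {m M : ℤ} (m3 : 3 ≤ m) (M0 : 0 ≤ M) (M1 : M^2 ≤ 2 * m^2) (M2 : 2 * m^2 < (M+1)^2) :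
    m ≤ M ∧ 2 * M ≤ 3 * m - 1 ∧
    (0:ℤ) < (2 * m + 1) * (6 * m) - m * m - ((M + 1) * (2 * M + 8) + (M + 1)^2) := by
  have a : m ≤ M := by
    by_contra hc
    have : (M+1)^2 ≤ m^2 := pow_le_pow_left₀ (by omega) (by omega) 2
    nlinarith
  have b : 2 * M ≤ 3 * m - 1 := by
    by_contra hc
    have : (3 * m)^2 ≤ (2 * M)^2 := pow_le_pow_left₀ (by omega) (by omega) 2
    nlinarith
  exact ⟨a, b, by nlinarith⟩

theorem num_K {m K lam : ℝ} (h : 0 < lam) (m3 : 3 ≤ m) (mK : m ≤ K) :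
    lam * ((2 * m + 1) * (6 * m)) + 2 * (2 * m + 1) * lam - lam * (m * m) +
        lam * ((K + 2) * (2 * (K + 2) + 8) + (K + 2)^2) < lam * (100 * (K + 2)^2) := by
  have : lam * ((2 * m + 1) * (6 * m)) + 2 * (2 * m + 1) * lam - lam * (m * m) +
        lam * ((K + 2) * (2 * (K + 2) + 8) + (K + 2)^2) = lam * ((2 * m + 1) * (6 * m) + 2 * (2 * m + 1) - m * m +
        ((K + 2) * (2 * (K + 2) + 8) + (K + 2)^2)) := by ring
  rw [this]
  refine mul_lt_mul_of_pos_left ?_ h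
  have : m^2 ≤ K^2 := by nlinarith
  nlinarith

theorem special {lam : ℝ} {G K m : ℤ} {e : ℕ} (h : 0 < lam) (hGl : (G:ℝ) * lam ≤ 1)
    (hG : 100 * (K + 2)^2 ≤ G) (hK : K = 2 * ((nextE e:ℤ) + 1)^2) (he : (e:ℤ) = 2 * m^2) (m3 : 3 ≤ m) :
    emb lam (cl lam m + 4 * m, cl lam m + 2 * m) ∈ Xe lam e ∧
    emb lam (cl lam m + 4 * m, cl lam m + 2 * m) ∈ TransSet lam ∧
    Ham (emb lam (cl lam m + 4 * m, cl lam m + 2 * m)) =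
      2 * (m:ℝ)^2 + lam * ((2 * m + 1) * (6 * m)) + 2 * (2 * m + 1) * (lam * cl lam m - m) := by
  have hFC := fl_FC h hGl
  have hE := nextE_alt e
  obtain ⟨ne1, ne2⟩ : e < nextE e ∧ True := ⟨(nextE_spec e).2, trivial⟩
  have hee : (e:ℤ) + 1 ≤ nextE e := by exact_mod_cast ne1
  generalize he' : (nextE e : ℤ) = e' at *
  have he'R : ((nextE e : ℕ) : ℝ) = (e':ℝ) := by rw [← he']; simp
  have mK : m ≤ e' := by nlinarith
  have eK : e' ≤ K := by nlinarith
  have mK2 : m ≤ K := by omega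
  have K0 : 0 ≤ K := by omega
  obtain ⟨bx, f4, xi, tr⟩ := special_geo (m := m) hFC (by nlinarith) (by omega)
  set p : ℤ × ℤ := (cl lam m + 4 * m, cl lam m + 2 * m) with hp
  have bx' := bx
  simp only [RI, Prod.mk.injEq] at bx
  obtain ⟨bx1, bx2⟩ := bx
  have hH : Ham (emb lam p) =
      2 * (m:ℝ)^2 + lam * ((2 * m + 1) * (6 * m)) + 2 * (2 * m + 1) * (lam * cl lam m - m) := by
    simp only [Ham, emb]
    rw [(Pfun_box bx1).1, (Pfun_box bx2).1]
    simp only [hp]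
    push_cast
    ring
  have ht : emb lam p ∈ TransSet lam := by
    rw [Trans_emb, f4, bx']; exact tr
  refine ⟨?_, ht, hH⟩
  obtain ⟨i0, T, hr⟩ := exists_ret h hGl (e' := e') (by omega) (by nlinarith) hK xi
    (by rintro ⟨a, b⟩; simp only [hp] at a b; omega) (by rw [bx1]; exact mK) (by rw [bx2]; exact mK)
  refine ⟨(Xdom_emb h p).2 xi, ?_⟩
  intro w hw
  obtain ⟨k, hk, rfl⟩ := (orbit_mem_iff h hr xi w).1 hw
  have hKG : K + 10 ≤ G := by nlinarith
  have c1 := cl_ge h m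
  have c2 := cl_lt h m
  have mR : (3:ℝ) ≤ m := by exact_mod_cast m3
  have mKR : (m:ℝ) ≤ K := by exact_mod_cast mK2
  have heR : (e:ℝ) = 2 * (m:ℝ)^2 := by exact_mod_cast he
  have rb := ret_bounds hFC hKG hr
  -- first pass
  have up : ∀ k, k ≤ 4 * T + 1 → Ham (emb lam ((FI (fl lam))^[k] p)) < e' := by
    intro k hk
    have hv := Vs_total hFC hKG hr (by rw [bx1, bx2]) (M := K + 2)
      ((le_abs_self _).trans (rb (4 * i0) (by have := hr.i0T; omega)))
    have := ham_dev h hGl (W := K + 2) (by nlinarith) (by omega) rb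
      (by rw [bx2, abs_of_nonneg (by omega)]; omega) hv k hk
    have := (abs_le.1 this).2
    rw [hH, bx1, bx2] at this
    have g1 : lam * (100 * ((K:ℝ) + 2)^2) ≤ 1 := by
      have : (100 * ((K:ℝ) + 2)^2) ≤ G := by exact_mod_cast hG
      nlinarith
    have e1 : (2 * (m:ℝ)^2) + 1 ≤ e' := by rw [← heR]; exact_mod_cast hee
    push_cast at this
    have e2 : 2 * (2 * (m:ℝ) + 1) * (lam * cl lam m - m) ≤ 2 * (2 * m + 1) * lam :=
      mul_le_mul_of_nonneg_left (by linarith) (by linarith)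
    have e3 := num_K (K := (K:ℝ)) h mR mKR
    linarith
  -- second pass
  obtain ⟨M, M0, M1, M2⟩ : ∃ M : ℤ, 0 ≤ M ∧ M^2 ≤ 2 * m^2 ∧ 2 * m^2 < (M+1)^2 := by
    refine ⟨(Nat.sqrt e : ℤ), by positivity, ?_, ?_⟩
    · rw [← he]; exact_mod_cast Nat.sqrt_le' e
    · rw [← he]; exact_mod_cast Nat.lt_succ_sqrt' e
  have fb : ∀ k, k ≤ 4 * T + 1 → |fl lam ((FI (fl lam))^[k] p).1| ≤ M + 1 ∧ fl lam ((FI (fl lam))^[k] p).1 ≤ M := by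
    intro k hk
    exact sqrt_bound hE M0 (by rw [he]; exact M2) (up k hk)
  obtain ⟨hmM, hMm, num⟩ := num_M m3 M0 M1 M2
  have hv := Vs_total hFC hKG hr (by rw [bx1, bx2]) (M := M) (fb (4 * i0) (by have := hr.i0T; omega)).2
  have dv := ham_dev h hGl (W := M + 1) (by nlinarith) (by omega) (fun k hk => (fb k hk).1)
      (by rw [bx2, abs_of_nonneg (by omega)]; omega) hv k hk
  have dv := (abs_le.1 dv).1
  rw [hH, bx1, bx2] at dv
  refine ⟨?_, by rw [he'R]; exact up k hk⟩
  rw [heR]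
  have fin : (0:ℝ) < (2 * m + 1) * (6 * m) - m * m - ((M + 1) * (2 * M + 8) + (M + 1)^2) := by
    exact_mod_cast num
  have fin2 := mul_pos h fin
  have e2 : 0 ≤ 2 * (2 * (m:ℝ) + 1) * (lam * cl lam m - m) :=
    mul_nonneg (by linarith) (by linarith)
  push_cast at dv
  nlinarith


theorem q_big {m q D : ℤ} (m3 : 3 ≤ m) (hq0 : 0 < q) (hodd : Odd q) (h1 : (2 * m + 1)^2 ∣ q)
    (h2 : (2 * m + 1) * (2 * m - 3) ∣ q) (hD : q ∣ (2 * m + 1) * D) (D0 : 0 < D) : 3 * (2 * m + 1) ≤ D := by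
  obtain ⟨r, rfl⟩ := h1
  have ro : Odd r := (Int.odd_mul.1 hodd).2
  have r0 : 0 < r := by
    by_contra hc
    have : (2 * m + 1)^2 * r ≤ 0 := mul_nonpos_of_nonneg_of_nonpos (by positivity) (by omega)
    omega
  have r1 : r ≠ 1 := by
    rintro rfl
    rw [mul_one, sq] at h2
    have h3 : 2 * m - 3 ∣ 2 * m + 1 := Int.dvd_of_mul_dvd_mul_left (by omega) h2
    have h4 : 2 * m - 3 ∣ 4 := by
      have := dvd_sub h3 (dvd_refl (2 * m - 3))
      rwa [show 2 * m + 1 - (2 * m - 3) = 4 by ring] at this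
    have := Int.le_of_dvd (by norm_num) h4
    have hm : m = 3 := by omega
    subst hm
    norm_num at h4
  have r3 : 3 ≤ r := by obtain ⟨t, ht⟩ := ro; omega
  obtain ⟨c, hc⟩ := hD
  have hc' : D = (2 * m + 1) * (r * c) := by
    have : (2 * m + 1) * D = (2 * m + 1) * ((2 * m + 1) * (r * c)) := by rw [hc]; ring
    exact mul_left_cancel₀ (by omega) this
  have c0 : 0 < r * c := by
    by_contra hcc
    have : (2 * m + 1) * (r * c) ≤ 0 := mul_nonpos_of_nonneg_of_nonpos (by omega) (by omega)
    omega
  have c1 : 0 < c := pos_of_mul_pos_right c0 (by omega)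
  have : 3 ≤ r * c := by nlinarith
  rw [hc']
  nlinarith

theorem up_drift {lam : ℝ} {G K m : ℤ} {e : ℕ} {v : ℕ → ℕ} {o : ℕ → Bool} {J : Set ℝ} (h : 0 < lam)
    (hGl : (G:ℝ) * lam ≤ 1)
    (hG : 100 * (K + 2)^2 ≤ G) (hK : K = 2 * ((nextE e:ℤ) + 1)^2) (hv : IsVertexList e v o)
    (hJ : IsMaxRegInterval lam e J) {p p' d : ℤ × ℤ} {i0 T : ℕ}
    (hd : RegData lam e K (nextE e) p i0 T) (hb : Bad (fl lam) (cl lam) e m p) (hup : 2 * m^2 ≤ (e:ℤ))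
    (m3 : 3 ≤ m) (hv1 : (v 1 : ℤ) = m) (hp' : RI (fl lam) p' = (m, m)) (hd' : p' = p + d)
    (j1 : Ham (emb lam p) ∈ J) (j2 : Ham (emb lam p') ∈ J)
    (l1 : 2 * m + 1 ∣ d.1) (lq : (qval e v : ℤ) ∣ (2 * m + 1) * (d.1 + d.2)) : False := by
  have hFC := fl_FC h hGl
  obtain ⟨ee, hh⟩ := up_e h hGl hG (by rw [hK]; nlinarith [(nextE e).cast_nonneg (α := ℤ)]) hd hb hup
  obtain ⟨s1, s2, s3⟩ := special h hGl hG hK ee m3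
  have hham := (hd.ham 0 (by omega)).1
  change ((e:ℤ):ℝ) < Ham (emb lam p) at hham
  obtain ⟨m1, bx, a0, b0, ab, i1, i2⟩ := hb
  simp only [RI, Prod.mk.injEq] at bx hp'
  have c0 := hFC.low p'.1
  have c1 := hFC.low p'.2
  rw [hp'.1] at c0
  rw [hp'.2] at c1
  have e1 : p'.1 = p.1 + d.1 := by rw [hd']; rfl
  have e2 : p'.2 = p.2 + d.2 := by rw [hd']; rfl
  have d1 : 0 ≤ d.1 := by
    by_contra hc
    have := Int.le_of_dvd (by omega) ((dvd_neg).2 l1)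
    omega
  obtain ⟨qo, q0, qd⟩ := qval_facts e v
  have big := q_big (q := (qval e v : ℤ)) (D := d.1 + d.2) m3 (by exact_mod_cast q0) (by exact_mod_cast qo)
    (by rw [← hv1]; exact_mod_cast qd)
    (by
      have := vl_yx hv (m := m) (j := m - 2) (by omega) (by omega) (by rw [ee]; nlinarith) (by rw [ee]; nlinarith)
        (by rw [ee]; nlinarith)
      rwa [show 2 * (m - 2) + 1 = 2 * m - 3 by ring] at this) lq (by omega)
  have k1 := cl_ge h m
  have k2 := cl_lt h m
  have mR : (3:ℝ) ≤ m := by exact_mod_cast m3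
  have ba : cl lam m - p.2 ≤ p.1 - cl lam m + 3 := by
    by_contra hc
    have hc' : (p.1:ℝ) - cl lam m + 4 ≤ cl lam m - p.2 := by exact_mod_cast (show p.1 - cl lam m + 4 ≤ cl lam m - p.2 by omega)
    have ab' : (p.1:ℝ) - p.2 ≤ 2 * m - 1 := by exact_mod_cast ab
    simp only [Ham, emb] at hham
    rw [(Pfun_box bx.1).1, (Pfun_box bx.2).1, ee] at hham
    push_cast at hham
    have key : (2 * (m:ℝ) + 1) * (p.1 - cl lam m) + (2 * m - 1) * (p.2 - cl lam m) + 4 * m ≤ 0 := by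
      have : (2 * (m:ℝ) - 1) * (p.2 - cl lam m) ≤ (2 * m - 1) * (-(p.1 - cl lam m + 4)) :=
        mul_le_mul_of_nonneg_left (by linarith) (by linarith)
      nlinarith
    have key2 := mul_nonpos_of_nonneg_of_nonpos h.le key
    have key3 : 4 * (m:ℝ) * (lam * cl lam m - m) ≤ 4 * m * lam :=
      mul_le_mul_of_nonneg_left (by linarith) (by linarith)
    nlinarith
  have st : 6 * m ≤ (p'.1 - cl lam m) + (p'.2 - cl lam m) := by omega
  have stR : 6 * (m:ℝ) ≤ (p'.1 - cl lam m) + (p'.2 - cl lam m) := by exact_mod_cast st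
  have H2 : Ham (emb lam (cl lam m + 4 * m, cl lam m + 2 * m)) ≤ Ham (emb lam p') := by
    rw [s3]
    simp only [Ham, emb]
    rw [(Pfun_box hp'.1).1, (Pfun_box hp'.2).1]
    have : lam * (2 * m + 1) * (6 * m) ≤ lam * (2 * m + 1) * ((p'.1 - cl lam m) + (p'.2 - cl lam m)) :=
      mul_le_mul_of_nonneg_left stR (by positivity)
    nlinarith
  have H1 : Ham (emb lam p) ≤ Ham (emb lam (cl lam m + 4 * m, cl lam m + 2 * m)) := by
    rw [s3]
    refine hh.trans ?_
    have : lam * (4 * (m:ℝ)^2 - 1) ≤ lam * ((2 * m + 1) * (6 * m)) := mul_le_mul_of_nonneg_left (by nlinarith) h.le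
    have : 0 ≤ 2 * (2 * (m:ℝ) + 1) * (lam * cl lam m - m) := mul_nonneg (by linarith) (by linarith)
    linarith
  have hin := hJ.2.1.out j1 j2 ⟨H1, H2⟩
  exact (hJ.2.2.1 _ s1 hin).2.1 s2


theorem emb_add (lam : ℝ) (p q : ℤ × ℤ) : emb lam (p + q) = emb lam p + emb lam q := by
  ext <;> simp [emb] <;> ring

theorem emb_sub (lam : ℝ) (p q : ℤ × ℤ) : emb lam (p - q) = emb lam p - emb lam q := by
  ext <;> simp [emb] <;> ring

theorem emb_inj {lam : ℝ} (h : 0 < lam) {p q : ℤ × ℤ} (hpq : emb lam p = emb lam q) : p = q := by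
  simp only [emb, Prod.mk.injEq, mul_eq_mul_left_iff, h.ne', or_false, Int.cast_inj] at hpq
  exact Prod.ext hpq.1 hpq.2

/-- the case in which the translated point starts in the diagonal box -/
theorem one_side {lam : ℝ} {G K μ : ℤ} {e : ℕ} {v : ℕ → ℕ} {o : ℕ → Bool} {J : Set ℝ} (h : 0 < lam)
    (hGl : (G:ℝ) * lam ≤ 1)
    (hG : 100 * (K + 2)^2 ≤ G) (hK : K = 2 * ((nextE e:ℤ) + 1)^2) (hv : IsVertexList e v o)
    (hJ : IsMaxRegInterval lam e J) (hv1 : (v 1 : ℤ) = μ) (m0 : 0 ≤ μ) (m1 : 2 * μ^2 ≤ (e:ℤ))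
    (m2 : (e:ℤ) < 2 * (μ+1)^2) {p p' d : ℤ × ℤ} {i0 T i0' T' : ℕ}
    (hd : RegData lam e K (nextE e) p i0 T) (hd' : RegData lam e K (nextE e) p' i0' T')
    (hp' : RI (fl lam) p' = (μ, μ)) (hpd : p' = p + d)
    (j1 : Ham (emb lam p) ∈ J) (j2 : Ham (emb lam p') ∈ J)
    (l1 : 2 * μ + 1 ∣ d.1) (l2 : 2 * μ + 1 ∣ d.2) (lq : (qval e v : ℤ) ∣ (2 * μ + 1) * (d.1 + d.2)) :
    ∃ c : ℤ, FI (fl lam) (zs (fl lam) p' T') - FI (fl lam) (zs (fl lam) p T) - d =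
      (c * (2 * μ + 1), -(c * (2 * μ+1))) := by
  have hE := nextE_alt e
  have hee : (e:ℤ) < nextE e := by exact_mod_cast (nextE_spec e).2
  have en : (0:ℤ) ≤ nextE e := by positivity
  have hKe : (nextE e:ℤ) ≤ K := by rw [hK]; nlinarith
  have hG' : 20 * K + 60 ≤ G := by nlinarith
  have hT := turnDvd_of hv lq
  rw [hv1] at hT
  obtain ⟨S, r1, r2, r3⟩ := rpath_of h hGl hG' hKe hee hE hd m0 m1 m2
  obtain ⟨S', r1', r2', r3'⟩ := rpath_of h hGl hG' hKe hee hE hd' m0 m1 m2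
  have e1 : p'.1 - p.1 = d.1 := by rw [hpd]; simp
  have e2 : p'.2 - p.2 = d.2 := by rw [hpd]; simp
  rcases start_cases h hGl hG' hKe hE hd m0 m1 m2 with hb | ⟨m, hb⟩
  · have st : SyncSt (fl lam) e μ ((2 * μ + 1) * (d.1 + d.2)) (zs (fl lam) p 0) (zs (fl lam) p' 0) μ μ := by
      change SyncSt (fl lam) e μ ((2 * μ + 1) * (d.1 + d.2)) p p' μ μ
      refine ⟨hb, hp', le_rfl, ?_, fun _ => ?_, fun _ => ?_⟩
      · rw [e1, e2]; ring
      · rw [e2]; exact l2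
      · rw [e1]; exact l1
    exact concl m0 hT r1 r1' r3 r3' (Nat.zero_le _) (Nat.zero_le _) st l1 rfl
  · have hb' := hb
    obtain ⟨b1, -, -, -, -, i1, i2⟩ := hb'
    rcases le_or_gt (2 * m^2) (e:ℤ) with hup | hup
    · have hm : m = μ := mu_unique m1 m2 m0 (by omega) hup (by nlinarith)
      subst hm
      exfalso
      rcases le_or_gt m 2 with hm | hm
      · exact up_direct h hGl hG hKe hd hb hup hm r1 r2
      · exact up_drift h hGl hG hK hv hJ hd hb hup (by omega) hv1 hp' hpd j1 j2 l1 lq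
    · have hm : m - 1 = μ := mu_unique m1 m2 m0 (by omega) (by nlinarith) (by rw [sub_add_cancel]; exact hup)
      subst hm
      have hdn : (nextE e:ℤ) ≤ 2 * m^2 := by
        rcases hE m m with h' | h'
        · exfalso; linarith
        · linarith
      obtain ⟨i', hi', st⟩ := bad_down h hGl hG' hKe hee hd hb hdn r1' hT hp' hpd l1 rfl
      exact concl m0 hT r1 r1' r3 r3' (Nat.zero_le _) hi' st l1 rfl

/-- two bad starting points which differ by a lattice vector coincide -/
theorem bad_bad {f C : ℤ → ℤ} {e m m' μ : ℤ} {p p' d : ℤ × ℤ} (hb : Bad f C e m p) (hb' : Bad f C e m' p')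
    (m0 : 0 ≤ μ) (m2 : e < 2 * (μ+1)^2) (hpd : p' = p + d) (l1 : 2 * μ + 1 ∣ d.1) (l2 : 2 * μ + 1 ∣ d.2) :
    d = 0 := by
  obtain ⟨b1, -, a0, b0, ab, i1, i2⟩ := hb
  obtain ⟨b1', -, a0', b0', ab', i1', i2'⟩ := hb'
  have mm : m = m' := by
    have h1 : m < m' + 1 := by
      by_contra hc
      have : (m'+1)^2 ≤ m^2 := pow_le_pow_left₀ (by omega) (by omega) 2
      have : m'^2 ≤ (m-1)^2 := pow_le_pow_left₀ (by omega) (by omega) 2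
      omega
    have h2 : m' < m + 1 := by
      by_contra hc
      have : (m+1)^2 ≤ m'^2 := pow_le_pow_left₀ (by omega) (by omega) 2
      have : m^2 ≤ (m'-1)^2 := pow_le_pow_left₀ (by omega) (by omega) 2
      omega
    omega
  subst mm
  have mu : m - 1 ≤ μ := by
    by_contra hc
    have : (μ+1)^2 ≤ (m-1)^2 := pow_le_pow_left₀ (by omega) (by omega) 2
    have : (m-1)^2 ≤ m^2 := pow_le_pow_left₀ (by omega) (by omega) 2
    omega
  have e1 : p'.1 - p.1 = d.1 := by rw [hpd]; simp
  have e2 : p'.2 - p.2 = d.2 := by rw [hpd]; simp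
  have z1 := Int.eq_zero_of_abs_lt_dvd l1 (by rw [abs_lt]; omega)
  have z2 := Int.eq_zero_of_abs_lt_dvd l2 (by rw [abs_lt]; omega)
  exact Prod.ext z1 z2

theorem main_aux :
    ∀ e ∈ Eset, ∀ v : ℕ → ℕ, ∀ o : ℕ → Bool, IsVertexList e v o →
      ∃ lam0 > (0 : ℝ), ∀ lam : ℝ, 0 < lam → lam < lam0 →
        ∀ J : Set ℝ, IsMaxRegInterval lam e J →
          ∀ l ∈ latticeL lam (v 1) (qval e v), ∀ z : ℝ × ℝ,
            z ∈ Xtilde lam e J → z + l ∈ Xtilde lam e J →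
            ∃ c : ℤ, Phi lam (z + l) - Phi lam z - l =
              c • wmn lam (v 1 : ℤ) (v 1 : ℤ) := by
  intro e _ v o hv
  obtain ⟨K, hK⟩ : ∃ K : ℤ, K = 2 * ((nextE e:ℤ) + 1)^2 := ⟨_, rfl⟩
  obtain ⟨G, hG⟩ : ∃ G : ℤ, G = 100 * (K + 2)^2 := ⟨_, rfl⟩
  have K0 : 0 ≤ K := by rw [hK]; positivity
  have G0 : 0 < G := by rw [hG]; positivity
  have G0' : (0:ℝ) < G := by exact_mod_cast G0
  refine ⟨1 / G, by positivity, ?_⟩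
  intro lam h hlam J hJ l hl z hz hzl
  have hGl : (G:ℝ) * lam ≤ 1 := by
    rw [lt_div_iff₀ G0'] at hlam; linarith
  have hG1 : 100 * (K + 2)^2 ≤ G := hG.ge
  have en : (0:ℤ) ≤ nextE e := by positivity
  have hKe : (nextE e:ℤ) ≤ K := by rw [hK]; nlinarith
  have hG' : 20 * K + 60 ≤ G := by nlinarith
  have hE := nextE_alt e
  obtain ⟨μ, m0, m1, m2⟩ := exists_mu e
  have hv1 := vl_first hv m0 m1 m2
  obtain ⟨qo, q0, qd⟩ := qval_facts e v
  obtain ⟨d, rfl, l1, l2, lq⟩ := lattice_int hl qo qd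
  obtain ⟨p, i0, T, rfl, xd⟩ := xdata_of h hGl hG' hK hz.1
  obtain ⟨p', i0', T', hp', xd'⟩ := xdata_of h hGl hG' hK hzl.1
  rw [← emb_add] at hp' hzl ⊢
  have hpd := (emb_inj h hp').symm
  rw [← hpd] at hzl ⊢
  have rd := regdata_of h xd (hJ.2.2.1 _ hz.1 hz.2)
  have rd' := regdata_of h xd' (hJ.2.2.1 _ hzl.1 hzl.2)
  rw [hv1] at l1 l2 lq ⊢
  have fin : ∀ c : ℤ, FI (fl lam) (zs (fl lam) p' T') - FI (fl lam) (zs (fl lam) p T) - d =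
      (c * (2 * μ + 1), -(c * (2 * μ+1))) → ∃ c : ℤ, Phi lam (emb lam p') - Phi lam (emb lam p) - emb lam d =
      c • wmn lam μ μ := by
    intro c hc
    refine ⟨c, ?_⟩
    rw [xd.phi, xd'.phi, ← emb_sub, ← emb_sub, hc]
    ext
    · simp [emb, wmn]; ring
    · simp [emb, wmn]; ring
  rcases start_cases h hGl hG' hKe hE rd' m0 m1 m2 with hb' | ⟨m', hb'⟩
  · obtain ⟨c, hc⟩ := one_side h hGl hG1 hK hv hJ hv1 m0 m1 m2 rd rd' hb' hpd hz.2 hzl.2 l1 l2 lq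
    exact fin c hc
  · rcases start_cases h hGl hG' hKe hE rd m0 m1 m2 with hb | ⟨m, hb⟩
    · obtain ⟨c, hc⟩ := one_side h hGl hG1 hK hv hJ hv1 m0 m1 m2 (d := -d) rd' rd hb (by rw [hpd]; simp)
        hzl.2 hz.2 (by simpa using l1) (by simpa using l2)
        (by
          have := (dvd_neg).2 lq
          rwa [show -((2 * μ + 1) * (d.1 + d.2)) = (2 * μ + 1) * ((-d).1 + (-d).2) by
            simp only [Prod.fst_neg, Prod.snd_neg]; ring] at this)
      apply fin (-c)
      have : FI (fl lam) (zs (fl lam) p' T') - FI (fl lam) (zs (fl lam) p T) - d =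
        -(FI (fl lam) (zs (fl lam) p T) - FI (fl lam) (zs (fl lam) p' T') - -d) := by abel
      rw [this, hc]
      ext <;> simp
    · have := bad_bad hb hb' m0 m2 hpd l1 l2
      subst this
      refine ⟨0, ?_⟩
      rw [add_zero] at hpd
      rw [hpd]
      ext <;> simp [emb]


/-- **Theorem A** (lattice equivariance of the return map). -/
theorem theoremA_lattice_equivariance :
    ∀ e ∈ Eset, ∀ v : ℕ → ℕ, ∀ o : ℕ → Bool, IsVertexList e v o →
      ∃ lam0 > (0 : ℝ), ∀ lam : ℝ, 0 < lam → lam < lam0 →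
        ∀ J : Set ℝ, IsMaxRegInterval lam e J →
          ∀ l ∈ latticeL lam (v 1) (qval e v), ∀ z : ℝ × ℝ,
            z ∈ Xtilde lam e J → z + l ∈ Xtilde lam e J →
            ∃ c : ℤ, Phi lam (z + l) - Phi lam z - l =
              c • wmn lam (v 1 : ℤ) (v 1 : ℤ) := by
  exact main_aux
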